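/- Let ρ : Fin r → Equiv.Perm (Fin n) be a string C-group in the two-blocks setup with r = n/2 and n/2 ≥ 7. Then the subgroup generated by {ρ j : j ∈ C ∪ L} is transitive on Fin n if and only if R = ∅. -/

import Mathlib

/-- A string group generated by involutions (sggi): each generator has order 2 and
nonconsecutive generators commute. -/
def IsSggi {n r : ℕ} (ρ : Fin r → Equiv.Perm (Fin n)) : Prop :=
  (∀ i, orderOf (ρ i) = 2) ∧
  ∀ i j : Fin r, 1 < |((i : ℕ) : ℤ) - ((j : ℕ) : ℤ)| → (ρ i * ρ j) ^ 2 = 1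

/-- A string C-group: an sggi satisfying the intersection property. -/
def IsStringC {n r : ℕ} (ρ : Fin r → Equiv.Perm (Fin n)) : Prop :=
  IsSggi ρ ∧ ∀ J K : Set (Fin r),
    Subgroup.closure (ρ '' J) ⊓ Subgroup.closure (ρ '' K) =
      Subgroup.closure (ρ '' (J ∩ K))

open Equiv Equiv.Perm Subgroup

set_option linter.unusedSectionVars false

namespace StringFamily

section Group

variable {ι Γ : Type*} [Group Γ]

/-- The subgroup generated by the members of a family indexed by `S`. -/
def gen (ρ : ι → Γ) (S : Finset ι) : Subgroup Γ := closure (ρ '' (S : Set ι))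

/-- No member of the family `ρ` on `S` lies in the subgroup generated by the others. -/
def Indep [DecidableEq ι] (ρ : ι → Γ) (S : Finset ι) : Prop :=
  ∀ i ∈ S, ρ i ∉ gen ρ (S.erase i)

variable {ρ : ι → Γ} {S T : Finset ι}

lemma mem_gen {i : ι} (h : i ∈ S) : ρ i ∈ gen ρ S :=
  subset_closure ⟨i, h, rfl⟩

lemma gen_le {H : Subgroup Γ} : gen ρ S ≤ H ↔ ∀ i ∈ S, ρ i ∈ H := by
  simp [gen, closure_le, Set.subset_def]

lemma gen_mono (h : S ⊆ T) : gen ρ S ≤ gen ρ T :=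
  gen_le.2 fun _ hi => mem_gen (h hi)

lemma gen_union [DecidableEq ι] : gen ρ (S ∪ T) = gen ρ S ⊔ gen ρ T := by
  simp [gen, Set.image_union, Subgroup.closure_union]

lemma gen_insert [DecidableEq ι] {i : ι} : gen ρ (insert i S) = gen ρ {i} ⊔ gen ρ S := by
  rw [Finset.insert_eq, gen_union]

lemma commute_gen {ι' : Type*} {ρ' : ι' → Γ} {T : Finset ι'}
    (h : ∀ i ∈ S, ∀ j ∈ T, Commute (ρ i) (ρ' j)) {x y : Γ} (hx : x ∈ gen ρ S)
    (hy : y ∈ gen ρ' T) : Commute x y := by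
  have key : gen ρ S ≤ centralizer (gen ρ' T : Set Γ) := by
    rw [gen_le]
    intro i hi
    have : gen ρ' T ≤ centralizer {ρ i} := by
      rw [gen_le]
      intro j hj
      rw [mem_centralizer_singleton_iff]
      exact (h i hi j hj).symm.eq
    rw [mem_centralizer_iff]
    intro z hz
    exact mem_centralizer_singleton_iff.1 (this hz)
  exact (mem_centralizer_iff.1 (key hx) y hy).symm

lemma commute_of_mem_gen {g x : Γ} (h : ∀ i ∈ S, Commute (ρ i) g) (hx : x ∈ gen ρ S) :
    Commute x g :=
  commute_gen (ρ' := fun _ : Unit => g) (T := {()}) (fun i hi _ _ => h i hi) hx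
    (mem_gen (ρ := fun _ : Unit => g) (i := ()) (by simp))

lemma mul_self_of_mem_gen (hc : ∀ i ∈ S, ∀ j ∈ S, Commute (ρ i) (ρ j))
    (h2 : ∀ i ∈ S, ρ i * ρ i = 1) {x : Γ} (hx : x ∈ gen ρ S) : x * x = 1 := by
  have hx' := hx
  unfold gen at hx
  induction hx using closure_induction with
  | mem x hx => obtain ⟨i, hi, rfl⟩ := hx; exact h2 i hi
  | one => simp
  | mul x y hx hy ihx ihy =>
    have : Commute x y := commute_gen hc hx hy
    calc x * y * (x * y) = (x * x) * (y * y) := by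
          rw [mul_assoc, ← mul_assoc y x y, this.eq.symm]; group
      _ = 1 := by rw [ihx hx, ihy hy, one_mul]
  | inv x hx ih => rw [← mul_inv_rev, ih hx, inv_one]

variable [DecidableEq ι]

lemma Indep.mono (h : Indep ρ T) (hST : S ⊆ T) : Indep ρ S :=
  fun i hi hmem => h i (hST hi) (gen_mono (Finset.erase_subset_erase i hST) hmem)

lemma Indep.notMem (h : Indep ρ T) {i : ι} (hi : i ∈ T) (hST : S ⊆ T) (hiS : i ∉ S) :
    ρ i ∉ gen ρ S :=
  fun hmem => h i hi (gen_mono (fun _ hj => Finset.mem_erase.2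
    ⟨by rintro rfl; exact hiS hj, hST hj⟩) hmem)

lemma Indep.ne (h : Indep ρ T) {i j : ι} (hi : i ∈ T) (hj : j ∈ T) (hij : i ≠ j) :
    ρ i ≠ ρ j := by
  intro e
  refine h.notMem (S := {j}) hi (by simpa using hj) (by simpa using hij) ?_
  rw [e]
  exact mem_gen (by simp)

lemma Indep.ne_one (h : Indep ρ T) {i : ι} (hi : i ∈ T) : ρ i ≠ 1 := by
  intro e
  refine h i hi ?_
  rw [e]
  exact one_mem _

lemma two_mul_card_le {H K : Subgroup Γ} [Finite Γ] (h : H < K) :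
    2 * Nat.card H ≤ Nat.card K := by
  obtain ⟨c, hc⟩ := Subgroup.card_dvd_of_le h.le
  have h0 : 0 < Nat.card K := Nat.card_pos
  have hne : c ≠ 1 := by
    rintro rfl
    exact h.ne (Subgroup.eq_of_le_of_card_ge h.le (by omega))
  have : c ≠ 0 := by rintro rfl; simp at hc; omega
  have : 2 ≤ c := by omega
  rw [hc, mul_comm]
  exact Nat.mul_le_mul_left _ this

lemma Indep.card_mul_two_pow_le [Finite Γ] (h : Indep ρ (S ∪ T)) (hd : Disjoint S T) :
    Nat.card (gen ρ S) * 2 ^ T.card ≤ Nat.card (gen ρ (S ∪ T)) := by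
  induction T using Finset.induction_on with
  | empty => simp
  | insert i T hi ih =>
    have hsub : S ∪ T ⊆ S ∪ insert i T :=
      Finset.union_subset_union_right (Finset.subset_insert _ _)
    have hiS : i ∉ S := fun hS => Finset.disjoint_left.1 hd hS (Finset.mem_insert_self _ _)
    have ih' := ih (h.mono hsub) (hd.mono_right (Finset.subset_insert _ _))
    have hlt : gen ρ (S ∪ T) < gen ρ (S ∪ insert i T) := by
      refine lt_of_le_of_ne (gen_mono hsub) fun e => ?_
      refine h.notMem (i := i) (by simp) hsub (by simp [hi, hiS]) ?_
      rw [e]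
      exact mem_gen (by simp)
    have := two_mul_card_le hlt
    rw [Finset.card_insert_of_notMem hi, pow_succ]
    nlinarith

lemma Indep.two_pow_card_le [Finite Γ] (h : Indep ρ S) : 2 ^ S.card ≤ Nat.card (gen ρ S) := by
  have := Indep.card_mul_two_pow_le (ρ := ρ) (S := ∅) (T := S) (by simpa using h) (by simp)
  have h1 : Nat.card (gen ρ (∅ : Finset ι)) = 1 := by simp [gen]
  rw [h1] at this
  simpa using this

/-- Two noncommuting involutions generate a group of order at least six. -/
lemma six_le_card [Finite Γ] {H : Subgroup Γ} {c d : Γ} (hc : c ∈ H) (hd : d ∈ H)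
    (hcc : c * c = 1) (hdd : d * d = 1) (hcd : ¬ Commute c d) : 6 ≤ Nat.card H := by
  have hci : c⁻¹ = c := inv_eq_of_mul_eq_one_left hcc
  have hdi : d⁻¹ = d := inv_eq_of_mul_eq_one_left hdd
  have hc1 : c ≠ 1 := fun e => hcd (e ▸ Commute.one_left d)
  have hd1 : d ≠ 1 := fun e => hcd (e ▸ Commute.one_right c)
  have hne : c ≠ d := fun e => hcd (e ▸ Commute.refl c)
  have hcd1 : c * d ≠ 1 := fun e => hne (by rw [← hdi]; exact eq_inv_of_mul_eq_one_left e)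
  have hdc1 : d * c ≠ 1 := fun e => hne (by rw [← hdi]; exact eq_inv_of_mul_eq_one_right e)
  have h5 : 5 ≤ Nat.card H := by
    classical
    let s : Finset Γ := {1, c, d, c * d, d * c}
    have hs : s.card = 5 := by
      rw [Finset.card_insert_of_notMem, Finset.card_insert_of_notMem,
        Finset.card_insert_of_notMem, Finset.card_insert_of_notMem, Finset.card_singleton]
      · exact fun e => hcd (Finset.mem_singleton.1 e)
      · simp [hc1]
      · simp [hne, hd1]
      · simp only [Finset.mem_insert, Finset.mem_singleton, not_or]
        exact ⟨hc1.symm, hd1.symm, hcd1.symm, hdc1.symm⟩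
    have hsub : (s : Set Γ) ⊆ H := by
      intro x hx
      simp only [s, Finset.coe_insert, Finset.coe_singleton, Set.mem_insert_iff,
        Set.mem_singleton_iff] at hx
      rcases hx with rfl | rfl | rfl | rfl | rfl
      · exact one_mem H
      · exact hc
      · exact hd
      · exact mul_mem hc hd
      · exact mul_mem hd hc
    calc 5 = (s : Set Γ).ncard := by rw [Set.ncard_coe_finset, hs]
      _ ≤ (H : Set Γ).ncard := Set.ncard_le_ncard hsub (Set.toFinite _)
      _ = Nat.card H := rfl
  have hdvd : 2 ∣ Nat.card H := by
    have : orderOf c = 2 := orderOf_eq_prime (by rw [sq, hcc]) hc1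
    rw [← this]
    simpa using orderOf_dvd_natCard (⟨c, hc⟩ : H)
  omega

lemma Indep.commute_of_card_lt [Finite Γ] (h : Indep ρ S) (h2 : ∀ i ∈ S, ρ i * ρ i = 1)
    (hS : 2 * Nat.card (gen ρ S) < 3 * 2 ^ S.card) :
    ∀ i ∈ S, ∀ j ∈ S, Commute (ρ i) (ρ j) := by
  intro i hi j hj
  by_contra hcomm
  have hij : i ≠ j := fun e => hcomm (e ▸ Commute.refl _)
  have hsub : {i, j} ⊆ S := by
    intro x hx
    rw [Finset.mem_insert, Finset.mem_singleton] at hx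
    rcases hx with rfl | rfl <;> assumption
  have hu : {i, j} ∪ (S \ {i, j}) = S := Finset.union_sdiff_of_subset hsub
  have h1 := Indep.card_mul_two_pow_le (ρ := ρ) (S := {i, j}) (T := S \ {i, j})
    (by rwa [hu]) Finset.disjoint_sdiff
  rw [hu, Finset.card_sdiff_of_subset hsub, Finset.card_pair hij] at h1
  have h6 : 6 ≤ Nat.card (gen ρ {i, j}) :=
    six_le_card (mem_gen (by simp)) (mem_gen (by simp)) (h2 i hi) (h2 j hj) hcomm
  have hc : 2 ≤ S.card := by
    rw [← Finset.card_pair hij]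
    exact Finset.card_le_card hsub
  obtain ⟨k, hk⟩ := Nat.exists_eq_add_of_le hc
  rw [hk] at h1 hS
  simp only [Nat.add_sub_cancel_left, pow_add] at h1 hS
  have : 6 * 2 ^ k ≤ Nat.card (gen ρ {i, j}) * 2 ^ k := Nat.mul_le_mul_right _ h6
  omega

/-- A family of involutions, indexed along a line, in which nonadjacent members commute, and
which is independent. -/
structure StrFam (ρ : ι → Γ) (pos : ι → ℤ) (S : Finset ι) : Prop where
  invol : ∀ i ∈ S, ρ i * ρ i = 1
  comm : ∀ i ∈ S, ∀ j ∈ S, 2 ≤ |pos i - pos j| → Commute (ρ i) (ρ j)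
  inj : ∀ i ∈ S, ∀ j ∈ S, pos i = pos j → i = j
  indep : Indep ρ S

lemma StrFam.mono {pos : ι → ℤ} (h : StrFam ρ pos T) (hST : S ⊆ T) : StrFam ρ pos S where
  invol i hi := h.invol i (hST hi)
  comm i hi j hj := h.comm i (hST hi) j (hST hj)
  inj i hi j hj := h.inj i (hST hi) j (hST hj)
  indep := h.indep.mono hST

/-- At least half of the members of a string family commute pairwise. -/
lemma StrFam.exists_commuting {pos : ι → ℤ} (h : StrFam ρ pos S) :
    ∃ F ⊆ S, S.card ≤ 2 * F.card ∧ ∀ i ∈ F, ∀ j ∈ F, Commute (ρ i) (ρ j) := by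
  have key : ∀ P : ℤ → Prop, (∀ a b, P a → P b → 2 ∣ a - b) → ∀ i ∈ S, ∀ j ∈ S,
      P (pos i) → P (pos j) → Commute (ρ i) (ρ j) := by
    intro P hP i hi j hj hPi hPj
    by_cases hij : i = j
    · rw [hij]
    · have hne : pos i ≠ pos j := fun e => hij (h.inj i hi j hj e)
      refine h.comm i hi j hj ?_
      have := hP _ _ hPi hPj
      rcases abs_cases (pos i - pos j) with h | h <;> omega
  have hcard := Finset.card_filter_add_card_filter_not (s := S) (fun i => 2 ∣ pos i)
  by_cases hle : S.card ≤ 2 * (S.filter fun i => 2 ∣ pos i).card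
  · refine ⟨_, Finset.filter_subset _ _, hle, fun i hi j hj => ?_⟩
    rw [Finset.mem_filter] at hi hj
    exact key (fun a => 2 ∣ a) (fun a b => by omega) i hi.1 j hj.1 hi.2 hj.2
  · refine ⟨S.filter fun i => ¬ 2 ∣ pos i, Finset.filter_subset _ _, by omega,
      fun i hi j hj => ?_⟩
    rw [Finset.mem_filter] at hi hj
    exact key (fun a => ¬ 2 ∣ a) (fun a b => by omega) i hi.1 j hj.1 hi.2 hj.2

end Group

lemma exists_minimal_subset {ι : Type*} [DecidableEq ι] (P : Finset ι → Prop) (S : Finset ι)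
    (hS : P S) : ∃ J ⊆ S, P J ∧ ∀ j ∈ J, ¬ P (J.erase j) := by
  induction S using Finset.strongInduction with
  | H S ih =>
    by_cases h : ∃ j ∈ S, P (S.erase j)
    · obtain ⟨j, hj, hP⟩ := h
      obtain ⟨J, hJ, h1, h2⟩ := ih _ (Finset.erase_ssubset hj) hP
      exact ⟨J, hJ.trans (Finset.erase_subset _ _), h1, h2⟩
    · push Not at h
      exact ⟨S, subset_rfl, hS, h⟩

section Orbits

variable {α : Type*}

/-- The orbit equivalence relation of a permutation group. -/
def orb (H : Subgroup (Perm α)) : Setoid α where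
  r x y := ∃ h ∈ H, h x = y
  iseqv :=
    { refl := fun x => ⟨1, one_mem H, rfl⟩
      symm := by
        rintro x y ⟨h, hh, rfl⟩
        exact ⟨h⁻¹, inv_mem hh, by simp⟩
      trans := by
        rintro x y z ⟨h, hh, rfl⟩ ⟨k, hk, rfl⟩
        exact ⟨k * h, mul_mem hk hh, rfl⟩ }

/-- The number of classes of an equivalence relation. -/
noncomputable def nc (s : Setoid α) : ℕ := Nat.card (Quotient s)

/-- The equivalence relation `s` is invariant under the group `H`. -/
def Inv (H : Subgroup (Perm α)) (s : Setoid α) : Prop :=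
  ∀ h ∈ H, ∀ x y, s x y → s (h x) (h y)

variable {H K : Subgroup (Perm α)} {s t : Setoid α}

lemma orb_apply {x y : α} : orb H x y ↔ ∃ h ∈ H, h x = y := Iff.rfl

lemma orb_le : orb H ≤ s ↔ ∀ h ∈ H, ∀ x, s x (h x) :=
  ⟨fun h g hg x => h ⟨g, hg, rfl⟩, by rintro h x _ ⟨g, hg, rfl⟩; exact h g hg x⟩

lemma orb_mono (h : H ≤ K) : orb H ≤ orb K := by
  rintro x y ⟨g, hg, e⟩; exact ⟨g, h hg, e⟩

/-- The permutations preserving every class of `s`. -/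
def fixer (s : Setoid α) : Subgroup (Perm α) where
  carrier := {g | ∀ x, s x (g x)}
  one_mem' x := s.refl x
  mul_mem' {a b} ha hb x := s.trans (hb x) (ha (b x))
  inv_mem' {a} ha x := s.symm (by simpa using ha (a⁻¹ x))

lemma orb_le_iff_le_fixer : orb H ≤ s ↔ H ≤ fixer s := orb_le

lemma orb_gen_le {ι : Type*} {ρ : ι → Perm α} {S : Finset ι} :
    orb (gen ρ S) ≤ s ↔ ∀ i ∈ S, ∀ x, s x (ρ i x) := by
  rw [orb_le_iff_le_fixer, gen_le]
  rfl

lemma orb_sup : orb (H ⊔ K) = orb H ⊔ orb K := by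
  apply le_antisymm
  · rw [orb_le_iff_le_fixer, sup_le_iff, ← orb_le_iff_le_fixer, ← orb_le_iff_le_fixer]
    exact ⟨le_sup_left, le_sup_right⟩
  · exact sup_le (orb_mono le_sup_left) (orb_mono le_sup_right)

lemma eq_top_iff_rel : s = ⊤ ↔ ∀ x y, s x y :=
  ⟨fun h x y => by rw [h]; trivial, fun h => top_unique fun x y _ => h x y⟩

lemma inv_orb_self : Inv H (orb H) := by
  rintro h hh x _ ⟨g, hg, rfl⟩
  exact ⟨h * g * h⁻¹, mul_mem (mul_mem hh hg) (inv_mem hh), by simp⟩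

lemma inv_orb_of_commute (hc : ∀ h ∈ H, ∀ k ∈ K, Commute h k) : Inv H (orb K) := by
  rintro h hh x _ ⟨g, hg, rfl⟩
  refine ⟨g, hg, ?_⟩
  rw [← mul_apply, ← mul_apply, (hc h hh g hg).eq]

lemma Inv.iff (hs : Inv H s) {h : Perm α} (hh : h ∈ H) {x y : α} : s (h x) (h y) ↔ s x y :=
  ⟨fun e => by simpa using hs h⁻¹ (inv_mem hh) _ _ e, hs h hh x y⟩

lemma Inv.inf (hs : Inv H s) (ht : Inv H t) : Inv H (s ⊓ t) :=
  fun h hh x y e => ⟨hs h hh x y e.1, ht h hh x y e.2⟩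

lemma Inv.sup (hs : Inv H s) (hs' : Inv K s) : Inv (H ⊔ K) s := by
  let N : Subgroup (Perm α) :=
    { carrier := {g | ∀ x y, s (g x) (g y) ↔ s x y}
      one_mem' := fun x y => Iff.rfl
      mul_mem' := fun {a b} ha hb x y => (ha _ _).trans (hb x y)
      inv_mem' := fun {a} ha x y => by simpa using (ha (a⁻¹ x) (a⁻¹ y)).symm }
  have : H ⊔ K ≤ N := sup_le (fun h hh x y => hs.iff hh) (fun h hh x y => hs'.iff hh)
  exact fun g hg x y => (this hg x y).2

lemma Inv.mono (hs : Inv K s) (h : H ≤ K) : Inv H s := fun g hg => hs g (h hg)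

lemma inv_gen {ι : Type*} {ρ : ι → Perm α} {S : Finset ι}
    (h2 : ∀ i ∈ S, ρ i * ρ i = 1) (h : ∀ i ∈ S, ∀ x y, s x y → s (ρ i x) (ρ i y)) :
    Inv (gen ρ S) s := by
  let N : Subgroup (Perm α) :=
    { carrier := {g | ∀ x y, s (g x) (g y) ↔ s x y}
      one_mem' := fun x y => Iff.rfl
      mul_mem' := fun {a b} ha hb x y => (ha _ _).trans (hb x y)
      inv_mem' := fun {a} ha x y => by simpa using (ha (a⁻¹ x) (a⁻¹ y)).symm }
  have : gen ρ S ≤ N := by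
    rw [gen_le]
    refine fun i hi x y => ⟨fun e => ?_, h i hi x y⟩
    have := h i hi _ _ e
    rwa [← mul_apply, ← mul_apply, h2 i hi] at this
  exact fun g hg x y => (this hg x y).2

/-- Joining an invariant relation with the orbit relation. -/
lemma sup_orb_rel (hs : Inv H s) {x y : α} : (s ⊔ orb H) x y ↔ ∃ h ∈ H, s (h x) y := by
  let u : Setoid α :=
    { r := fun x y => ∃ h ∈ H, s (h x) y
      iseqv :=
        { refl := fun x => ⟨1, one_mem H, s.refl _⟩
          symm := by
            rintro x y ⟨h, hh, e⟩
            exact ⟨h⁻¹, inv_mem hh, s.symm (by simpa using hs h⁻¹ (inv_mem hh) _ _ e)⟩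
          trans := by
            rintro x y z ⟨h, hh, e⟩ ⟨k, hk, e'⟩
            exact ⟨k * h, mul_mem hk hh, s.trans (hs k hk _ _ e) e'⟩ } }
  constructor
  · intro e
    have : s ⊔ orb H ≤ u := by
      refine sup_le (fun x y e => ⟨1, one_mem H, e⟩) ?_
      rintro x _ ⟨h, hh, rfl⟩
      exact ⟨h, hh, s.refl _⟩
    exact this e
  · rintro ⟨h, hh, e⟩
    have h1 : (s ⊔ orb H) x (h x) := (le_sup_right : orb H ≤ s ⊔ orb H) ⟨h, hh, rfl⟩
    have h2 : (s ⊔ orb H) (h x) y := (le_sup_left : s ≤ s ⊔ orb H) e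
    exact (s ⊔ orb H).trans h1 h2

section Count

variable [Finite α]

lemma nc_lt (h : s < t) : nc t < nc s := by
  have : Fintype (Quotient s) := Fintype.ofFinite _
  have : Fintype (Quotient t) := Fintype.ofFinite _
  rw [nc, nc, Nat.card_eq_fintype_card, Nat.card_eq_fintype_card]
  let f : Quotient s → Quotient t := Quotient.map' id (fun x y e => h.le e)
  refine Fintype.card_lt_of_surjective_not_injective f ?_ ?_
  · intro q
    induction q using Quotient.inductionOn with
    | h x => exact ⟨Quotient.mk _ x, rfl⟩
  · intro hinj
    refine h.not_ge fun x y e => ?_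
    have : f (Quotient.mk _ x) = f (Quotient.mk _ y) := Quotient.sound e
    exact Quotient.exact (hinj this)

lemma eq_of_le_of_nc_le (h : s ≤ t) (h' : nc s ≤ nc t) : s = t := by
  by_contra hne
  exact (nc_lt (lt_of_le_of_ne h hne)).not_ge h'

lemma nc_pos [Nonempty α] : 0 < nc s :=
  haveI : Nonempty (Quotient s) := ⟨Quotient.mk _ (Classical.arbitrary α)⟩
  Nat.card_pos

lemma nc_bot : nc (⊥ : Setoid α) = Nat.card α :=
  Nat.card_congr
    { toFun := fun q => Quotient.lift id (fun _ _ e => e) q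
      invFun := fun x => Quotient.mk _ x
      left_inv := fun q => by induction q using Quotient.inductionOn with | h x => rfl
      right_inv := fun x => rfl }

lemma nc_top [Nonempty α] : nc (⊤ : Setoid α) = 1 := by
  have : Subsingleton (Quotient (⊤ : Setoid α)) := ⟨by
    intro a b
    induction a using Quotient.inductionOn
    induction b using Quotient.inductionOn
    exact Quotient.sound trivial⟩
  have : Nonempty (Quotient (⊤ : Setoid α)) := ⟨Quotient.mk _ (Classical.arbitrary α)⟩
  exact Nat.card_unique

lemma nc_eq_one [Nonempty α] : nc s = 1 ↔ s = ⊤ :=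
  ⟨fun h => eq_of_le_of_nc_le le_top (by rw [h, nc_top]), fun h => by rw [h, nc_top]⟩

lemma nc_inf (h : ∀ x y, ∃ z, s x z ∧ t z y) : nc (s ⊓ t) = nc s * nc t := by
  rw [nc, nc, nc, ← Nat.card_prod]
  let f : Quotient (s ⊓ t) → Quotient s × Quotient t := fun q =>
    (Quotient.map' (s₁ := s ⊓ t) (s₂ := s) id (fun _ _ e => e.1) q,
      Quotient.map' (s₁ := s ⊓ t) (s₂ := t) id (fun _ _ e => e.2) q)
  refine Nat.card_congr (Equiv.ofBijective f ⟨?_, ?_⟩)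
  · intro a b
    induction a using Quotient.inductionOn
    induction b using Quotient.inductionOn
    intro e
    obtain ⟨e1, e2⟩ := Prod.mk.inj e
    exact Quotient.sound ⟨Quotient.exact e1, Quotient.exact e2⟩
  · rintro ⟨a, b⟩
    induction a using Quotient.inductionOn with | h x
    induction b using Quotient.inductionOn with | h y
    obtain ⟨z, h1, h2⟩ := h x y
    exact ⟨Quotient.mk _ z, Prod.ext (Quotient.sound (s.symm h1)) (Quotient.sound h2)⟩

end Count

section Classes

variable [Fintype α]

open Classical in
/-- The class of a point. -/
noncomputable def cls (s : Setoid α) (x : α) : Finset α := Finset.univ.filter (s x)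

@[simp] lemma mem_cls {x y : α} : y ∈ cls s x ↔ s x y := by simp [cls]

lemma card_cls_mul_nc (hH : orb H = ⊤) (hs : Inv H s) (x : α) :
    (cls s x).card * nc s = Fintype.card α := by
  classical
  have hconst : ∀ y, (cls s y).card = (cls s x).card := by
    intro y
    obtain ⟨h, hh, rfl⟩ := eq_top_iff_rel.1 hH x y
    symm
    refine Finset.card_bij (fun a _ => h a) ?_ ?_ ?_
    · intro a ha
      rw [mem_cls] at ha ⊢
      exact hs h hh _ _ ha
    · intro a _ b _ e
      exact h.injective e
    · intro b hb
      refine ⟨h⁻¹ b, ?_, by simp⟩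
      rw [mem_cls] at hb ⊢
      simpa using hs h⁻¹ (inv_mem hh) _ _ hb
  have : Fintype (Quotient s) := Fintype.ofFinite _
  have hsum := Finset.card_eq_sum_card_fiberwise (s := (Finset.univ : Finset α))
    (f := fun y => (Quotient.mk s y)) (t := Finset.univ) (by simp)
  rw [Finset.sum_const_nat (m := (cls s x).card), Finset.card_univ, Finset.card_univ] at hsum
  · rw [nc, Nat.card_eq_fintype_card, hsum, mul_comm]
  intro q _
  induction q using Quotient.inductionOn with | h y
  rw [← hconst y]
  congr 1
  ext z
  simp only [Finset.mem_filter, Finset.mem_univ, true_and, mem_cls]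
  exact ⟨fun e => s.symm (Quotient.exact e), fun e => Quotient.sound (s.symm e)⟩

end Classes

end Orbits

section MinimalFamilies

variable {ι α : Type*} [DecidableEq ι] [Finite α] {ρ : ι → Perm α} {b : Setoid α}
  {J S : Finset ι}

/-- The family on `J` is minimal subject to merging all classes of `b`. -/
def MinTrans (ρ : ι → Perm α) (b : Setoid α) (J : Finset ι) : Prop :=
  b ⊔ orb (gen ρ J) = ⊤ ∧ ∀ j ∈ J, b ⊔ orb (gen ρ (J.erase j)) ≠ ⊤

lemma exists_minTrans (h : b ⊔ orb (gen ρ S) = ⊤) : ∃ J ⊆ S, MinTrans ρ b J :=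
  exists_minimal_subset (fun J => b ⊔ orb (gen ρ J) = ⊤) S h

lemma MinTrans.lt_insert (h : MinTrans ρ b J) (hS : S ⊆ J) {i : ι} (hi : i ∈ J) (hiS : i ∉ S) :
    b ⊔ orb (gen ρ S) < b ⊔ orb (gen ρ (insert i S)) := by
  refine lt_of_le_of_ne (sup_le_sup_left (orb_mono (gen_mono (Finset.subset_insert _ _))) _) ?_
  intro e
  refine h.2 i hi ?_
  have hle : orb (gen ρ {i}) ≤ b ⊔ orb (gen ρ (J.erase i)) := by
    calc orb (gen ρ {i}) ≤ b ⊔ orb (gen ρ (insert i S)) :=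
          le_sup_of_le_right (orb_mono (gen_mono (by simp)))
      _ = b ⊔ orb (gen ρ S) := e.symm
      _ ≤ _ := sup_le_sup_left (orb_mono (gen_mono fun j hj =>
          Finset.mem_erase.2 ⟨by rintro rfl; exact hiS hj, hS hj⟩)) _
  rw [← h.1, ← Finset.insert_erase hi, gen_insert, orb_sup, Finset.erase_insert_eq_erase,
    Finset.erase_idem]
  exact le_antisymm (sup_le le_sup_left le_sup_right |>.trans
    (sup_le_sup_left le_sup_right _)) (sup_le le_sup_left (sup_le hle le_sup_right))

lemma MinTrans.nc_sup_add_card_le (h : MinTrans ρ b J) {S T : Finset ι} (hT : T ⊆ J)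
    (hST : S ⊆ T) :
    nc (b ⊔ orb (gen ρ T)) + T.card ≤ nc (b ⊔ orb (gen ρ S)) + S.card := by
  obtain ⟨k, hk⟩ : ∃ k, k = (T \ S).card := ⟨_, rfl⟩
  induction k generalizing S with
  | zero =>
    have : S = T := hST.antisymm (Finset.sdiff_eq_empty_iff_subset.1 (Finset.card_eq_zero.1 hk.symm))
    rw [this]
  | succ k ih =>
    obtain ⟨i, hi⟩ : (T \ S).Nonempty := Finset.card_pos.1 (by omega)
    rw [Finset.mem_sdiff] at hi
    have h1 := nc_lt (h.lt_insert (hST.trans hT) (hT hi.1) hi.2)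
    have h2 := ih (S := insert i S) (Finset.insert_subset hi.1 hST) (by
      rw [Finset.sdiff_insert, Finset.card_erase_of_mem (Finset.mem_sdiff.2 hi)]
      omega)
    rw [Finset.card_insert_of_notMem hi.2] at h2
    omega

lemma gen_empty : gen ρ ∅ = ⊥ := by simp [gen]

lemma orb_bot : orb (⊥ : Subgroup (Perm α)) = ⊥ := by
  refine bot_unique ?_
  rintro x _ ⟨h, hh, rfl⟩
  rw [mem_bot.1 hh]
  rfl

lemma MinTrans.card_lt [Nonempty α] (h : MinTrans ρ b J) : J.card + 1 ≤ nc b := by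
  have := h.nc_sup_add_card_le subset_rfl (Finset.empty_subset J)
  rw [h.1, nc_top, gen_empty, orb_bot, sup_bot_eq, Finset.card_empty] at this
  omega

end MinimalFamilies

section Counting

variable {α : Type*} [Fintype α] {H K E : Subgroup (Perm α)}

lemma card_eq_card_cls_mul (E : Subgroup (Perm α)) (x : α) :
    Nat.card E = (cls (orb E) x).card * Nat.card ↥(E ⊓ MulAction.stabilizer (Perm α) x) := by
  rw [← Nat.card_congr (MulAction.orbitProdStabilizerEquivGroup E x), Nat.card_prod]
  congr 1
  · have : MulAction.orbit E x = (cls (orb E) x : Set α) := by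
      ext y
      simp only [Finset.mem_coe, mem_cls, orb_apply, MulAction.mem_orbit_iff, Subtype.exists]
      exact ⟨fun ⟨g, hg, e⟩ => ⟨g, hg, e⟩, fun ⟨g, hg, e⟩ => ⟨g, hg, e⟩⟩
    rw [this]
    exact Nat.subtype_card _ fun _ => Iff.rfl
  · refine Nat.card_congr
      { toFun := fun g => ⟨g.1.1, g.1.2, g.2⟩
        invFun := fun g => ⟨⟨g.1, g.2.1⟩, g.2.2⟩
        left_inv := fun g => rfl
        right_inv := fun g => rfl }

lemma card_dvd_of_semiregular (h : ∀ g ∈ E, ∀ x, g x = x → g = 1) (hK : orb K = ⊤)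
    (hinv : Inv K (orb E)) : Nat.card E * nc (orb E) = Fintype.card α := by
  cases isEmpty_or_nonempty α with
  | inl h0 =>
    have : IsEmpty (Quotient (orb E)) := ⟨fun q => Quotient.inductionOn q fun x => h0.elim x⟩
    simp [nc]
  | inr h0 =>
    obtain ⟨x⟩ := h0
    rw [← card_cls_mul_nc hK hinv x, card_eq_card_cls_mul E x]
    have : E ⊓ MulAction.stabilizer (Perm α) x = ⊥ := by
      rw [eq_bot_iff]
      intro g hg
      exact h g hg.1 x hg.2
    rw [this]
    simp

/-- An elementary abelian `2`-group acting faithfully on `Z` has order at most `2 ^ (|Z| / 2)`. -/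
lemma sq_card_le_of_exponent_two (Z : Finset α) (E : Subgroup (Perm α))
    (h2 : ∀ g ∈ E, g * g = 1)
    (hZ : ∀ g ∈ E, ∀ z ∈ Z, g z ∈ Z) (hf : ∀ g ∈ E, (∀ z ∈ Z, g z = z) → g = 1) :
    Nat.card E ^ 2 ≤ 2 ^ Z.card := by
  classical
  induction Z using Finset.strongInduction generalizing E with
  | H Z ih =>
    rcases Z.eq_empty_or_nonempty with rfl | ⟨x, hx⟩
    · have : E = ⊥ := by
        rw [eq_bot_iff]
        exact fun g hg => hf g hg (by simp)
      rw [this]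
      simp
    · have hcomm : ∀ g ∈ E, ∀ h ∈ E, g * h = h * g := by
        intro g hg h hh
        have hi : ∀ k ∈ E, k⁻¹ = k := fun k hk => inv_eq_of_mul_eq_one_left (h2 k hk)
        rw [← hi _ (mul_mem hg hh), mul_inv_rev, hi g hg, hi h hh]
      have hsub : cls (orb E) x ⊆ Z := by
        intro y hy
        obtain ⟨g, hg, rfl⟩ := mem_cls.1 hy
        exact hZ g hg x hx
      have hxc : x ∈ cls (orb E) x := mem_cls.2 ((orb E).refl x)
      have := ih (Z \ cls (orb E) x)
        (Finset.sdiff_ssubset hsub ⟨x, hxc⟩)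
        (E ⊓ MulAction.stabilizer (Perm α) x) (fun g hg => h2 g hg.1)
        (by
          intro g hg z hz
          rw [Finset.mem_sdiff, mem_cls] at hz ⊢
          refine ⟨hZ g hg.1 z hz.1, fun e => hz.2 ((orb E).trans e ?_)⟩
          exact (orb E).symm ⟨g, hg.1, rfl⟩)
        (by
          intro g hg hfix
          refine hf g hg.1 fun z hz => ?_
          by_cases hzc : z ∈ cls (orb E) x
          · obtain ⟨k, hk, rfl⟩ := mem_cls.1 hzc
            rw [← mul_apply, hcomm g hg.1 k hk, mul_apply, show g x = x from hg.2]
          · exact hfix z (Finset.mem_sdiff.2 ⟨hz, hzc⟩))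
      rw [card_eq_card_cls_mul E x, mul_pow]
      have hp : ∃ k, Nat.card E = 2 ^ k := by
        have : IsPGroup 2 E := by
          intro g
          refine ⟨1, ?_⟩
          ext1
          simpa [pow_succ] using h2 g g.2
        exact IsPGroup.iff_card.1 this
      obtain ⟨k, hk⟩ := hp
      obtain ⟨l, -, hl⟩ := (Nat.dvd_prime_pow Nat.prime_two).1
        (hk ▸ Dvd.intro _ (card_eq_card_cls_mul E x).symm)
      have hlt : l < 2 ^ l := Nat.lt_two_pow_self
      have hsq : (cls (orb E) x).card ^ 2 ≤ 2 ^ (cls (orb E) x).card := by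
        rw [hl, ← pow_mul]
        refine Nat.pow_le_pow_right (by norm_num) ?_
        rcases l with _ | l
        · simp
        · have : l < 2 ^ l := Nat.lt_two_pow_self
          rw [pow_succ]
          omega
      calc _ ≤ 2 ^ (cls (orb E) x).card * 2 ^ (Z \ cls (orb E) x).card := Nat.mul_le_mul hsq this
        _ = 2 ^ Z.card := by
          rw [← pow_add, Finset.card_sdiff_of_subset hsub]
          congr 1
          have := Finset.card_le_card hsub
          omega

end Counting

section Bounds

variable {ι α : Type*} [DecidableEq ι] [Fintype α] {ρ : ι → Perm α} {U V S : Finset ι}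
  {pos : ι → ℤ}

lemma Indep.card_le_of_commute (h : Indep ρ S) (h2 : ∀ i ∈ S, ρ i * ρ i = 1)
    (hc : ∀ i ∈ S, ∀ j ∈ S, Commute (ρ i) (ρ j)) (Z : Finset α)
    (hZ : ∀ g ∈ gen ρ S, ∀ z ∈ Z, g z ∈ Z)
    (hf : ∀ g ∈ gen ρ S, (∀ z ∈ Z, g z = z) → g = 1) : 2 * S.card ≤ Z.card := by
  have h1 := sq_card_le_of_exponent_two Z (gen ρ S) (fun g hg => mul_self_of_mem_gen hc h2 hg) hZ hf
  have h3 : (2 ^ S.card) ^ 2 ≤ 2 ^ Z.card :=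
    (Nat.pow_le_pow_left h.two_pow_card_le 2).trans h1
  rw [← pow_mul, Nat.pow_le_pow_iff_right (by norm_num)] at h3
  omega

/-- A string family `U` acting faithfully on `Z`, with `V` consisting of central members. -/
lemma StrFam.exists_bound (hU : StrFam ρ pos U) (hV : V ⊆ U)
    (hVc : ∀ i ∈ V, ∀ j ∈ U, Commute (ρ i) (ρ j)) (Z : Finset α)
    (hZ : ∀ g ∈ gen ρ U, ∀ z ∈ Z, g z ∈ Z)
    (hf : ∀ g ∈ gen ρ U, (∀ z ∈ Z, g z = z) → g = 1) :
    ∃ f, U.card ≤ V.card + 2 * f ∧ 2 * f + 2 * V.card ≤ Z.card := by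
  obtain ⟨F, hF, hcard, hFc⟩ := (hU.mono (Finset.sdiff_subset : U \ V ⊆ U)).exists_commuting
  have hFU : F ⊆ U := hF.trans Finset.sdiff_subset
  have hd : Disjoint F V := Finset.disjoint_of_subset_left hF Finset.sdiff_disjoint
  have hFV : F ∪ V ⊆ U := Finset.union_subset hFU hV
  have := (hU.indep.mono hFV).card_le_of_commute (fun i hi => hU.invol i (hFV hi)) (by
      intro i hi j hj
      rcases Finset.mem_union.1 hi with hi' | hi'
      · rcases Finset.mem_union.1 hj with hj' | hj'
        · exact hFc i hi' j hj'
        · exact (hVc j hj' i (hFV hi)).symm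
      · exact hVc i hi' j (hFV hj)) Z
    (fun g hg => hZ g (gen_mono hFV hg)) (fun g hg => hf g (gen_mono hFV hg))
  rw [Finset.card_union_of_disjoint hd] at this
  rw [Finset.card_sdiff_of_subset hV] at hcard
  have := Finset.card_le_card hV
  exact ⟨F.card, by omega, by omega⟩

end Bounds

section CommutingPair

variable {α : Type*} [Fintype α] {H K : Subgroup (Perm α)}

/-- Two elementwise commuting groups that together are transitive. -/
structure CommPair (H K : Subgroup (Perm α)) : Prop where
  comm : ∀ h ∈ H, ∀ k ∈ K, Commute h k
  trans : orb H ⊔ orb K = ⊤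

namespace CommPair

lemma symm (P : CommPair H K) : CommPair K H :=
  ⟨fun k hk h hh => (P.comm h hh k hk).symm, by rw [sup_comm, P.trans]⟩

lemma exists_eq (P : CommPair H K) (x y : α) : ∃ h ∈ H, ∃ k ∈ K, h (k x) = y := by
  have hinv : Inv H (orb K) := inv_orb_of_commute P.comm
  have hxy : (orb K ⊔ orb H) x y := by rw [sup_comm, P.trans]; trivial
  obtain ⟨h, hh, k, hk, e⟩ := (sup_orb_rel hinv).1 hxy
  refine ⟨h, hh, k, hk, ?_⟩
  rw [← e, ← mul_apply, (P.comm h hh k hk).eq, mul_apply]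

lemma sup_trans (P : CommPair H K) : orb (H ⊔ K) = ⊤ := by rw [orb_sup, P.trans]

lemma inv_left (P : CommPair H K) : Inv (H ⊔ K) (orb H) :=
  inv_orb_self.sup (inv_orb_of_commute P.symm.comm)

lemma inv_right (P : CommPair H K) : Inv (H ⊔ K) (orb K) :=
  (inv_orb_of_commute P.comm).sup inv_orb_self

lemma nc_inf (P : CommPair H K) : nc (orb H ⊓ orb K) = nc (orb H) * nc (orb K) := by
  refine StringFamily.nc_inf fun x y => ?_
  obtain ⟨h, hh, k, hk, e⟩ := P.symm.exists_eq x y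
  exact ⟨k x, ⟨k, hk, rfl⟩, ⟨h, hh, e⟩⟩

lemma card_inter (P : CommPair H K) (x : α) :
    (cls (orb H ⊓ orb K) x).card * (nc (orb H) * nc (orb K)) = Fintype.card α := by
  rw [← P.nc_inf]
  exact card_cls_mul_nc P.sup_trans (P.inv_left.inf P.inv_right) x

lemma card_cls (P : CommPair H K) (x : α) :
    (cls (orb H) x).card = nc (orb K) * (cls (orb H ⊓ orb K) x).card := by
  have h1 := P.card_inter x
  have h2 := card_cls_mul_nc P.sup_trans P.inv_left x
  have : Nonempty α := ⟨x⟩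
  have h3 : 0 < nc (orb H) := nc_pos
  refine Nat.eq_of_mul_eq_mul_right h3 ?_
  rw [h2, ← h1]
  ring

lemma faithful (P : CommPair H K) {x : α} {h : Perm α} (hh : h ∈ H)
    (hfix : ∀ z ∈ cls (orb H) x, h z = z) : h = 1 := by
  ext y
  obtain ⟨k, hk, h', hh', rfl⟩ := P.symm.exists_eq x y
  rw [← mul_apply, (P.comm h hh k hk).eq, mul_apply, hfix _ (mem_cls.2 ⟨h', hh', rfl⟩)]
  simp

lemma semiregular (P : CommPair H K) (hK : orb K = ⊤) {x : α} {h : Perm α} (hh : h ∈ H)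
    (hfix : h x = x) : h = 1 := by
  ext y
  obtain ⟨k, hk, rfl⟩ := eq_top_iff_rel.1 hK x y
  rw [← mul_apply, (P.comm h hh k hk).eq, mul_apply, hfix]
  simp

lemma card_mul_nc (P : CommPair H K) (hK : orb K = ⊤) :
    Nat.card H * nc (orb H) = Fintype.card α :=
  card_dvd_of_semiregular (fun _ hg _ => P.semiregular hK hg) P.sup_trans P.inv_left

lemma card_le_of_nc_eq_two (P : CommPair H K) (hK : nc (orb K) = 2) (x : α) :
    Nat.card H ≤ 2 * (cls (orb H ⊓ orb K) x).card ^ 2 := by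
  classical
  set t := (cls (orb H ⊓ orb K) x).card with ht
  have hz : (cls (orb H) x).card = 2 * t := by rw [P.card_cls, hK]
  obtain ⟨w, hw⟩ : ∃ w, ¬ orb K x w := by
    by_contra! hcon
    have : orb K = ⊤ := eq_top_iff_rel.2 fun a b => (orb K).trans ((orb K).symm (hcon a)) (hcon b)
    have hne : Nonempty α := ⟨x⟩
    rw [this, nc_top] at hK
    omega
  obtain ⟨h0, hh0, k0, hk0, e0⟩ := P.symm.exists_eq x w
  set y := k0 x with hy
  have hyx : orb H x y := ⟨k0, hk0, rfl⟩
  have hxy : ¬ orb K x y := fun e => hw ((orb K).trans e ⟨h0, hh0, e0⟩)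
  have hcover : ∀ v, orb K x v ∨ orb K y v := by
    intro v
    by_contra! hcon
    have : Fintype (Quotient (orb K)) := Fintype.ofFinite _
    rw [nc, Nat.card_eq_fintype_card] at hK
    have h3 : ({Quotient.mk (orb K) x, Quotient.mk (orb K) y, Quotient.mk (orb K) v} :
        Finset (Quotient (orb K))).card = 3 := by
      rw [Finset.card_eq_three]
      exact ⟨_, _, _, fun e => hxy (Quotient.exact e), fun e => hcon.1 (Quotient.exact e),
        fun e => hcon.2 (Quotient.exact e), rfl⟩
    have := Finset.card_le_univ ({Quotient.mk (orb K) x, Quotient.mk (orb K) y,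
      Quotient.mk (orb K) v} : Finset (Quotient (orb K)))
    omega
  let Y : Finset (α × α) := (cls (orb H) x ×ˢ cls (orb H) x).filter (fun p => ¬ orb K p.1 p.2)
  have hY : Y.card ≤ 2 * t ^ 2 := by
    have h1 : Y.card + ((cls (orb H) x ×ˢ cls (orb H) x).filter (fun p => orb K p.1 p.2)).card
        = (2 * t) * (2 * t) := by
      rw [← hz, ← Finset.card_product, add_comm]
      exact Finset.card_filter_add_card_filter_not _
    have h2 : ((cls (orb H) x ×ˢ cls (orb H) x).filter (fun p => orb K p.1 p.2)).card
        = ∑ p ∈ cls (orb H) x, t := by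
      rw [Finset.card_filter, Finset.sum_product]
      refine Finset.sum_congr rfl fun a ha => ?_
      rw [← Finset.card_filter]
      have h4 := P.card_inter a
      rw [← P.card_inter x] at h4
      have hne : Nonempty α := ⟨x⟩
      have h5 := Nat.eq_of_mul_eq_mul_right (Nat.mul_pos nc_pos nc_pos) h4
      rw [ht, ← h5]
      congr 1
      ext c
      simp only [Finset.mem_filter, mem_cls] at ha ⊢
      exact ⟨fun e => ⟨(orb H).trans ((orb H).symm ha) e.1, e.2⟩,
        fun e => ⟨(orb H).trans ha e.1, e.2⟩⟩
    rw [h2, Finset.sum_const, hz, smul_eq_mul] at h1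
    nlinarith
  refine le_trans ?_ hY
  rw [Nat.card_eq_fintype_card, ← Finset.card_univ]
  refine Finset.card_le_card_of_injOn (fun h => (h.1 x, h.1 y)) ?_ ?_
  · intro h _
    simp only [Y, Finset.coe_filter, Finset.mem_product, mem_cls, Set.mem_ofPred_eq]
    refine ⟨⟨⟨h.1, h.2, rfl⟩, (orb H).trans hyx ⟨h.1, h.2, rfl⟩⟩, ?_⟩
    rw [(inv_orb_of_commute P.comm).iff h.2]
    exact hxy
  · intro g _ h _ e
    obtain ⟨e1, e2⟩ := Prod.mk.inj e
    have hgh : h.1⁻¹ * g.1 ∈ H := mul_mem (inv_mem h.2) g.2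
    have f1 : (h.1⁻¹ * g.1) x = x := by rw [mul_apply, e1]; simp
    have f2 : (h.1⁻¹ * g.1) y = y := by rw [mul_apply, e2]; simp
    have : h.1⁻¹ * g.1 = 1 := by
      ext v
      have key : ∀ u, (h.1⁻¹ * g.1) u = u → orb K u v → (h.1⁻¹ * g.1) v = v := by
        rintro u hu ⟨k, hk, rfl⟩
        rw [← mul_apply, (P.comm _ hgh k hk).eq, mul_apply, hu]
      rcases hcover v with hv | hv
      · simpa using key x f1 hv
      · simpa using key y f2 hv
    exact Subtype.ext (inv_mul_eq_one.1 this).symm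

end CommPair

end CommutingPair

section FourPoints

variable {ι α : Type*} [DecidableEq ι] [Fintype α] {ρ : ι → Perm α} {S : Finset ι}
  {pos : ι → ℤ}

/-- A group acting faithfully on four points with a nontrivial central element has order at
most eight. -/
lemma card_le_eight {H : Subgroup (Perm α)} {Z : Finset α} (hZ4 : Z.card = 4)
    (hZ : ∀ g ∈ H, ∀ z ∈ Z, g z ∈ Z) (hf : ∀ g ∈ H, (∀ z ∈ Z, g z = z) → g = 1)
    {a : Perm α} (ha : a ∈ H) (ha1 : a ≠ 1) (hac : ∀ g ∈ H, Commute g a) :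
    Nat.card H ≤ 8 := by
  classical
  obtain ⟨x, hx, hax⟩ : ∃ x ∈ Z, a x ≠ x := by
    by_contra! h
    exact ha1 (hf a ha h)
  have hpair : ({x, a x} : Finset α) ⊆ Z := by
    intro y hy
    rw [Finset.mem_insert, Finset.mem_singleton] at hy
    rcases hy with rfl | rfl
    exacts [hx, hZ a ha x hx]
  have hW : (Z \ {x, a x}).card = 2 := by
    rw [Finset.card_sdiff_of_subset hpair, hZ4, Finset.card_pair hax.symm]
  obtain ⟨z, w, hzw, hWe⟩ := Finset.card_eq_two.1 hW
  have hmem : ∀ y ∈ Z, y = x ∨ y = a x ∨ y = z ∨ y = w := by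
    intro y hy
    by_cases h : y ∈ ({x, a x} : Finset α)
    · rw [Finset.mem_insert, Finset.mem_singleton] at h
      tauto
    · have : y ∈ Z \ {x, a x} := Finset.mem_sdiff.2 ⟨hy, h⟩
      rw [hWe, Finset.mem_insert, Finset.mem_singleton] at this
      tauto
  have hzW : z ∈ Z \ {x, a x} := by rw [hWe]; simp
  have hwW : w ∈ Z \ {x, a x} := by rw [hWe]; simp
  rw [Finset.mem_sdiff, Finset.mem_insert, Finset.mem_singleton, not_or] at hzW hwW
  set H' := H ⊓ MulAction.stabilizer (Perm α) x with hH'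
  have hfixx : ∀ g ∈ H', g x = x := fun g hg => hg.2
  have hfixa : ∀ g ∈ H', g (a x) = a x := by
    intro g hg
    rw [← mul_apply, (hac g hg.1).eq, mul_apply, hfixx g hg]
  have h1 := card_eq_card_cls_mul H x
  have h2 := card_eq_card_cls_mul H' z
  have h3 : H' ⊓ MulAction.stabilizer (Perm α) z = ⊥ := by
    rw [eq_bot_iff]
    intro g hg
    refine hf g hg.1.1 fun y hy => ?_
    have hgz : g z = z := hg.2
    rcases hmem y hy with rfl | rfl | rfl | rfl
    · exact hfixx g hg.1
    · exact hfixa g hg.1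
    · exact hgz
    · rcases hmem (g y) (hZ g hg.1.1 _ hwW.1) with e | e | e | e
      · exact absurd (g.injective (e.trans (hfixx g hg.1).symm)) hwW.2.1
      · exact absurd (g.injective (e.trans (hfixa g hg.1).symm)) hwW.2.2
      · exact absurd (g.injective (e.trans hgz.symm)) hzw.symm
      · exact e
  have h4 : (cls (orb H) x).card ≤ 4 := by
    rw [← hZ4]
    refine Finset.card_le_card fun y hy => ?_
    obtain ⟨g, hg, rfl⟩ := mem_cls.1 hy
    exact hZ g hg x hx
  have h5 : (cls (orb H') z).card ≤ 2 := by
    rw [← hW]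
    refine Finset.card_le_card fun y hy => ?_
    obtain ⟨g, hg, rfl⟩ := mem_cls.1 hy
    rw [Finset.mem_sdiff, Finset.mem_insert, Finset.mem_singleton, not_or]
    exact ⟨hZ g hg.1 z hzW.1, fun e => hzW.2.1 (g.injective (e.trans (hfixx g hg).symm)),
      fun e => hzW.2.2 (g.injective (e.trans (hfixa g hg).symm))⟩
  rw [h3] at h2
  simp only [card_bot, mul_one] at h2
  rw [h1, h2]
  exact (Nat.mul_le_mul h4 h5).trans (by norm_num)

lemma Indep.card_le_two_of_card_le_eight (h : Indep ρ S) (h2 : ∀ i ∈ S, ρ i * ρ i = 1)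
    {Z : Finset α} (hZ4 : Z.card = 4) (hZ : ∀ g ∈ gen ρ S, ∀ z ∈ Z, g z ∈ Z)
    (hf : ∀ g ∈ gen ρ S, (∀ z ∈ Z, g z = z) → g = 1) (h8 : Nat.card (gen ρ S) ≤ 8) :
    S.card ≤ 2 := by
  by_contra! h3
  have hpow : 2 ^ 3 ≤ 2 ^ S.card := Nat.pow_le_pow_right (by norm_num) h3
  have := h.card_le_of_commute h2 (h.commute_of_card_lt h2 (by omega)) Z hZ hf
  omega

lemma Indep.card_le_two_of_central (h : Indep ρ S) (h2 : ∀ i ∈ S, ρ i * ρ i = 1)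
    {Z : Finset α} (hZ4 : Z.card = 4) (hZ : ∀ g ∈ gen ρ S, ∀ z ∈ Z, g z ∈ Z)
    (hf : ∀ g ∈ gen ρ S, (∀ z ∈ Z, g z = z) → g = 1) {a : ι} (ha : a ∈ S)
    (hac : ∀ i ∈ S, Commute (ρ i) (ρ a)) : S.card ≤ 2 :=
  h.card_le_two_of_card_le_eight h2 hZ4 hZ hf (card_le_eight hZ4 hZ hf (mem_gen ha)
    (h.ne_one ha) (fun _ hg => commute_of_mem_gen hac hg))

lemma StrFam.card_le_three (h : StrFam ρ pos S) {Z : Finset α} (hZ4 : Z.card = 4)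
    (hZ : ∀ g ∈ gen ρ S, ∀ z ∈ Z, g z ∈ Z) (hf : ∀ g ∈ gen ρ S, (∀ z ∈ Z, g z = z) → g = 1) :
    S.card ≤ 3 := by
  rcases S.eq_empty_or_nonempty with rfl | hne
  · simp
  obtain ⟨a, ha, hmin⟩ := S.exists_min_image pos hne
  let B := S.filter (fun i => pos i = pos a + 1)
  have hB : B.card ≤ 1 := by
    rw [Finset.card_le_one]
    intro i hi j hj
    simp only [B, Finset.mem_filter] at hi hj
    exact h.inj i hi.1 j hj.1 (hi.2.trans hj.2.symm)
  have hsub : S \ B ⊆ S := Finset.sdiff_subset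
  have h1 := (h.mono hsub).indep.card_le_two_of_central (fun i hi => h.invol i (hsub hi)) hZ4
    (fun g hg => hZ g (gen_mono hsub hg)) (fun g hg => hf g (gen_mono hsub hg)) (a := a)
    (Finset.mem_sdiff.2 ⟨ha, by simp [B]⟩) (by
      intro i hi
      simp only [B, Finset.mem_sdiff, Finset.mem_filter, not_and] at hi
      by_cases hia : i = a
      · rw [hia]
      · have := hmin i hi.1
        have hne : pos i ≠ pos a := fun e => hia (h.inj i hi.1 a ha e)
        have := hi.2 hi.1
        exact h.comm i hi.1 a ha (by rw [abs_of_nonneg] <;> omega))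
  have h2 : S.card ≤ (S \ B).card + B.card := by
    rw [Finset.card_sdiff_add_card]
    exact Finset.card_le_card Finset.subset_union_left
  omega

end FourPoints

section TwoIntransitive

variable {ι α : Type*} [DecidableEq ι] [Fintype α] {ρ : ι → Perm α} {A B V : Finset ι}
  {pos : ι → ℤ}

lemma cls_orb_invariant {H : Subgroup (Perm α)} (x : α) :
    ∀ g ∈ H, ∀ z ∈ cls (orb H) x, g z ∈ cls (orb H) x := by
  intro g hg z hz
  rw [mem_cls] at hz ⊢
  exact (orb H).trans hz ⟨g, hg, rfl⟩

lemma CommPair.exists_bound {K : Subgroup (Perm α)} (P : CommPair (gen ρ A) K)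
    (hA : StrFam ρ pos A) (hV : V ⊆ A) (hVc : ∀ i ∈ V, ∀ j ∈ A, Commute (ρ i) (ρ j)) (x : α) :
    ∃ f, A.card ≤ V.card + 2 * f ∧
      2 * f + 2 * V.card ≤ nc (orb K) * (cls (orb (gen ρ A) ⊓ orb K) x).card := by
  rw [← P.card_cls]
  exact hA.exists_bound hV hVc _ (cls_orb_invariant x) (fun g hg hfix => P.faithful hg hfix)

lemma CommPair.two_pow_le {K : Subgroup (Perm α)} (P : CommPair (gen ρ A) K)
    (hA : Indep ρ A) (hK : nc (orb K) = 2) (x : α) :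
    2 ^ A.card ≤ 2 * (cls (orb (gen ρ A) ⊓ orb K) x).card ^ 2 :=
  hA.two_pow_card_le.trans (P.card_le_of_nc_eq_two hK x)

lemma CommPair.card_le_two {K : Subgroup (Perm α)} (P : CommPair (gen ρ A) K)
    (hA : StrFam ρ pos A) (hK : nc (orb K) = 2) {x : α}
    (ht : (cls (orb (gen ρ A) ⊓ orb K) x).card = 2) : A.card ≤ 2 := by
  refine hA.indep.card_le_two_of_card_le_eight hA.invol (Z := cls (orb (gen ρ A)) x) ?_
    (cls_orb_invariant x) (fun g hg hfix => P.faithful hg hfix) ?_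
  · rw [P.card_cls, hK, ht]
  · have := P.card_le_of_nc_eq_two hK x
    rwa [ht] at this

lemma CommPair.card_le_three {K : Subgroup (Perm α)} (P : CommPair (gen ρ A) K)
    (hA : StrFam ρ pos A) {x : α}
    (ht : nc (orb K) * (cls (orb (gen ρ A) ⊓ orb K) x).card = 4) : A.card ≤ 3 := by
  refine hA.card_le_three (Z := cls (orb (gen ρ A)) x) ?_
    (cls_orb_invariant x) (fun g hg hfix => P.faithful hg hfix)
  rw [P.card_cls, ht]

lemma two_mul_sq_lt_two_pow {t : ℕ} (ht : 3 ≤ t) : 2 * t ^ 2 < 2 ^ (2 * t - 1) := by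
  obtain ⟨k, rfl⟩ := Nat.exists_eq_add_of_le ht
  have : 2 * (3 + k) - 1 = 2 * k + 5 := by omega
  rw [this]
  induction k with
  | zero => norm_num
  | succ k ih =>
    have e : 2 ^ (2 * (k + 1) + 5) = 4 * 2 ^ (2 * k + 5) := by ring
    have := ih (by omega) (by omega)
    nlinarith

/-- Numerical part of the case where one of the two commuting families has two orbits. -/
lemma add_four_le_of_two {p q b t m : ℕ} (hb : 3 ≤ b) (hm : 7 ≤ m) (hmt : m = 2 * b * t)
    (hp : p ≤ 2 * t) (hq : q ≤ b * t) (hpow : 2 ^ p ≤ 2 * t ^ 2) (hp2 : t = 2 → p ≤ 2)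
    (hq3 : b * t = 4 → q ≤ 3) : p + q + 4 ≤ m := by
  subst hmt
  by_cases hlarge : 4 ≤ t * (b - 2)
  · obtain ⟨c, rfl⟩ := Nat.exists_eq_add_of_le hb
    have : 3 + c - 2 = c + 1 := by omega
    rw [this] at hlarge
    nlinarith
  · have ht : t ≤ 3 := by
      by_contra! h
      exact hlarge (le_trans (by omega) (Nat.le_mul_of_pos_right t (by omega : 0 < b - 2)))
    have hpt : ∀ k, 2 * t ^ 2 < 2 ^ k → p < k := by
      intro k hk
      exact (Nat.pow_lt_pow_iff_right (by norm_num)).1 (hpow.trans_lt hk)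
    interval_cases t
    · omega
    · have hp1 := hpt 2 (by norm_num)
      have : b ≤ 5 := by omega
      interval_cases b <;> omega
    · have := hp2 rfl
      have : b = 3 := by omega
      subst this
      omega
    · have := hpt 5 (by norm_num)
      have : b = 3 := by omega
      subst this
      omega

lemma card_add_four_le_of_intransitive (P : CommPair (gen ρ A) (gen ρ B))
    (hA : StrFam ρ pos A) (hB : StrFam ρ pos B) (hnA : orb (gen ρ A) ≠ ⊤)
    (hnB : orb (gen ρ B) ≠ ⊤) (hm : 7 ≤ Fintype.card α) :
    A.card + B.card + 4 ≤ Fintype.card α := by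
  have hne : Nonempty α := Fintype.card_pos_iff.1 (by omega)
  obtain ⟨x⟩ := hne
  have hne : Nonempty α := ⟨x⟩
  have hb2 : 2 ≤ nc (orb (gen ρ A)) := by
    have h0 : 0 < nc (orb (gen ρ A)) := nc_pos
    have h1 : nc (orb (gen ρ A)) ≠ 1 := fun e => hnA (nc_eq_one.1 e)
    omega
  have ha2 : 2 ≤ nc (orb (gen ρ B)) := by
    have h0 : 0 < nc (orb (gen ρ B)) := nc_pos
    have h1 : nc (orb (gen ρ B)) ≠ 1 := fun e => hnB (nc_eq_one.1 e)
    omega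
  have hm' := P.card_inter x
  obtain ⟨f, hf1, hf2⟩ := P.exists_bound hA (Finset.empty_subset A) (by simp) x
  obtain ⟨g, hg1, hg2⟩ := P.symm.exists_bound hB (Finset.empty_subset B) (by simp) x
  have hpA := fun e => P.two_pow_le hA.indep e x
  have hpB := fun e => P.symm.two_pow_le hB.indep e x
  have htA := P.card_le_two hA (x := x)
  have htB := P.symm.card_le_two hB (x := x)
  have hcA := P.card_le_three hA (x := x)
  have hcB := P.symm.card_le_three hB (x := x)
  rw [inf_comm] at hg2 hpB htB hcB
  simp only [Finset.card_empty, mul_zero, add_zero, zero_add] at hf1 hf2 hg1 hg2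
  generalize (cls (orb (gen ρ A) ⊓ orb (gen ρ B)) x).card = t at *
  generalize nc (orb (gen ρ A)) = b at *
  generalize nc (orb (gen ρ B)) = a at *
  generalize Fintype.card α = m at *
  generalize A.card = p at *
  generalize B.card = q at *
  by_cases ha : a = 2
  · by_cases hb : b = 2
    · subst ha hb
      have h1 := hpA rfl
      have h2 := hpB rfl
      by_cases ht : t = 2
      · have := htA rfl ht
        have := htB rfl ht
        omega
      · have ht3 : 3 ≤ t := by omega
        have h3 := two_mul_sq_lt_two_pow ht3
        have h4 := (Nat.pow_lt_pow_iff_right (by norm_num)).1 (h1.trans_lt h3)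
        have h5 := (Nat.pow_lt_pow_iff_right (by norm_num)).1 (h2.trans_lt h3)
        omega
    · subst ha
      exact add_four_le_of_two (b := b) (t := t) (by omega) hm (by rw [← hm']; ring)
        (by omega) (by omega) (hpA rfl) (htA rfl) hcB
  · by_cases hb : b = 2
    · subst hb
      rw [add_comm p q]
      exact add_four_le_of_two (b := a) (t := t) (by omega) hm (by rw [← hm']; ring)
        (by omega) (by omega) (hpB rfl) (htB rfl) hcA
    · obtain ⟨c, rfl⟩ := Nat.exists_eq_add_of_le (by omega : 3 ≤ a)
      obtain ⟨d, rfl⟩ := Nat.exists_eq_add_of_le (by omega : 3 ≤ b)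
      rcases t with _ | t
      · omega
      · by_cases h0 : c = 0 ∧ d = 0 ∧ t = 0
        · obtain ⟨rfl, rfl, rfl⟩ := h0
          omega
        · have hp : p ≤ (3 + c) * (t + 1) := by omega
          have hq : q ≤ (3 + d) * (t + 1) := by omega
          have h1 : 1 ≤ c + d + t := by omega
          have : 4 ≤ (t + 1) * (3 + 2 * c + 2 * d + c * d) := by
            nlinarith [Nat.zero_le (c * d), Nat.zero_le (t * c), Nat.zero_le (t * d),
              Nat.zero_le (t * (c * d))]
          nlinarith

end TwoIntransitive

lemma two_mul_sq_lt_two_pow' {t : ℕ} (ht : 4 ≤ t) : 2 * t ^ 2 < 2 ^ (2 * t - 2) := by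
  obtain ⟨k, rfl⟩ := Nat.exists_eq_add_of_le ht
  have : 2 * (4 + k) - 2 = 2 * k + 6 := by omega
  rw [this]
  induction k with
  | zero => norm_num
  | succ k ih =>
    have e : 2 ^ (2 * (k + 1) + 6) = 4 * 2 ^ (2 * k + 6) := by ring
    have := ih (by omega) (by omega)
    nlinarith

/-- The required margin, depending on the degree. -/
def margin (m : ℕ) : ℕ := if 14 ≤ m then 4 else 3

lemma margin_le (m : ℕ) : margin m ≤ 4 := by unfold margin; split_ifs <;> omega

lemma margin_eq {m : ℕ} (h : m < 14) : margin m = 3 := by unfold margin; rw [if_neg (by omega)]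

section Central

variable {ι α : Type*} [DecidableEq ι] [Fintype α] {ρ : ι → Perm α} {U V : Finset ι}
  {pos : ι → ℤ}

lemma central_bound_of_small_gap {κ v m u : ℕ} (hm : 12 ≤ m) (hκ : κ * 2 ^ v ≤ m) (hv : 1 ≤ v)
    (hκ0 : 0 < κ) (hu : u ≤ κ + 1 + 2 * v) (hu' : κ = 1 → u ≤ 2 * v) : u + margin m ≤ m := by
  have hmar := margin_le m
  by_cases h1 : κ = 1
  · have := hu' h1
    subst h1
    rw [one_mul] at hκ
    by_cases h4 : v ≤ 4
    · interval_cases v <;> omega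
    · have : 2 * v + 4 ≤ 2 ^ v := by
        obtain ⟨k, rfl⟩ := Nat.exists_eq_add_of_le (by omega : 4 ≤ v)
        have : k < 2 ^ k := Nat.lt_two_pow_self
        rw [pow_add]
        omega
      omega
  · rcases Nat.lt_or_ge v 3 with h | h
    · interval_cases v
      · by_cases hm14 : 14 ≤ m
        · omega
        · rw [margin_eq (by omega)]
          omega
      · omega
    · obtain ⟨k, rfl⟩ := Nat.exists_eq_add_of_le h
      have hk : k < 2 ^ k := Nat.lt_two_pow_self
      obtain ⟨c, rfl⟩ := Nat.exists_eq_add_of_le (by omega : 2 ≤ κ)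
      rw [pow_add] at hκ
      nlinarith [Nat.zero_le (c * 2 ^ k)]

lemma central_bound_of_gap {p q v a b t m : ℕ} (hm : 12 ≤ m) (hmt : t * (a * b) = m)
    (ha : 2 ≤ a) (hb : 2 ≤ b) (hv : 1 ≤ v) (hp : p + 2 * v ≤ b * t) (hq : q + 2 * v ≤ a * t)
    (hp' : b = 2 → 2 ^ (p + v) ≤ 2 * t ^ 2) (hq' : a = 2 → 2 ^ (q + v) ≤ 2 * t ^ 2) :
    p + q + 1 + 2 * v + margin m ≤ m := by
  have hmar := margin_le m
  by_cases h22 : a = 2 ∧ b = 2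
  · obtain ⟨rfl, rfl⟩ := h22
    have h1 := hp' rfl
    have h2 := hq' rfl
    by_cases ht : t = 3
    · subst ht
      have h3 := (Nat.pow_lt_pow_iff_right (by norm_num : 1 < 2)).1
        (h1.trans_lt (by norm_num : 2 * 3 ^ 2 < 2 ^ 5))
      have h4 := (Nat.pow_lt_pow_iff_right (by norm_num : 1 < 2)).1
        (h2.trans_lt (by norm_num : 2 * 3 ^ 2 < 2 ^ 5))
      rw [margin_eq (by omega)]
      omega
    · have h3 := two_mul_sq_lt_two_pow' (by omega : 4 ≤ t)
      have h4 := (Nat.pow_lt_pow_iff_right (by norm_num)).1 (h1.trans_lt h3)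
      have h5 := (Nat.pow_lt_pow_iff_right (by norm_num)).1 (h2.trans_lt h3)
      omega
  · obtain ⟨c, rfl⟩ := Nat.exists_eq_add_of_le ha
    obtain ⟨d, rfl⟩ := Nat.exists_eq_add_of_le hb
    have h1 : 1 ≤ c + d := by omega
    have e : m = (2 + d) * t + (2 + c) * t + (c + d + c * d) * t := by rw [← hmt]; ring
    by_cases h3 : 3 ≤ (c + d + c * d) * t
    · omega
    · have ht0 : 1 ≤ t := by
        rcases t with _ | t
        · simp at hmt; omega
        · omega
      have hcd : c + d + c * d ≤ 2 :=
        le_trans (Nat.le_mul_of_pos_right _ ht0) (by omega)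
      have hc2 : c ≤ 2 := by omega
      have hd2 : d ≤ 2 := by omega
      interval_cases c <;> interval_cases d <;> first | omega | (
        have : t ≤ 2 := by omega
        interval_cases t <;> first | omega | (rw [margin_eq (by omega)]; omega))

/-- A transitive string family `U` with a nonempty set `V` of central members is small. -/
theorem StrFam.card_add_card_add_margin_le (hm : 12 ≤ Fintype.card α) (hU : StrFam ρ pos U)
    (hV : V ⊆ U) (hne : V.Nonempty) (hVc : ∀ i ∈ V, ∀ j ∈ U, Commute (ρ i) (ρ j))
    (htr : orb (gen ρ U) = ⊤) :
    U.card + V.card + margin (Fintype.card α) ≤ Fintype.card α := by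
  obtain ⟨k, hk⟩ : ∃ k, (U \ V).card = k := ⟨_, rfl⟩
  induction k using Nat.strong_induction_on generalizing U V with
  | _ k ih =>
  have hα : Nonempty α := Fintype.card_pos_iff.1 (by omega)
  obtain ⟨x⟩ := hα
  have hα : Nonempty α := ⟨x⟩
  have hUV : U.card = (U \ V).card + V.card := by
    rw [Finset.card_sdiff_of_subset hV]
    have := Finset.card_le_card hV
    omega
  have hv1 : 1 ≤ V.card := Finset.card_pos.2 hne
  have hPV : CommPair (gen ρ V) (gen ρ U) :=
    ⟨fun g hg h hh => commute_gen hVc hg hh, by rw [htr, sup_top_eq]⟩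
  have hκ : nc (orb (gen ρ V)) * 2 ^ V.card ≤ Fintype.card α := by
    rw [← hPV.card_mul_nc htr, mul_comm]
    exact Nat.mul_le_mul_right _ (hU.indep.mono hV).two_pow_card_le
  -- removing the neighbour of an end node makes that node central
  have step : ∀ a ∈ U \ V, ∀ N ⊆ U \ V, a ∉ N → N.card ≤ 1 →
      (∀ i ∈ U \ N, Commute (ρ a) (ρ i)) → orb (gen ρ (U \ N)) = ⊤ →
      U.card + V.card + margin (Fintype.card α) ≤ Fintype.card α := by
    intro a ha N hN haN hN1 hcomm htr'
    rw [Finset.mem_sdiff] at ha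
    have hsub : insert a V ⊆ U \ N := by
      intro i hi
      rcases Finset.mem_insert.1 hi with rfl | hi
      · exact Finset.mem_sdiff.2 ⟨ha.1, haN⟩
      · exact Finset.mem_sdiff.2 ⟨hV hi, fun h => (Finset.mem_sdiff.1 (hN h)).2 hi⟩
    have hcardV : (insert a V).card = V.card + 1 := Finset.card_insert_of_notMem ha.2
    have hcardU : (U \ N).card = U.card - N.card :=
      Finset.card_sdiff_of_subset (hN.trans Finset.sdiff_subset)
    have hle := Finset.card_le_card hsub
    have hcard : ((U \ N) \ insert a V).card = (U \ N).card - (insert a V).card :=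
      Finset.card_sdiff_of_subset hsub
    have := ih ((U \ N) \ insert a V).card (by omega) (hU.mono Finset.sdiff_subset) hsub
      (Finset.insert_nonempty _ _) (by
        intro i hi j hj
        rcases Finset.mem_insert.1 hi with rfl | hi
        · exact hcomm j hj
        · exact hVc i hi j (Finset.mem_sdiff.1 hj).1) htr' rfl
    omega
  rcases (U \ V).eq_empty_or_nonempty with hS | hS
  · have hUV' : U = V := (Finset.sdiff_eq_empty_iff_subset.1 hS).antisymm hV
    have hk1 : nc (orb (gen ρ V)) = 1 := by rw [← hUV', htr, nc_top]
    have h0 : (U \ V).card = 0 := by rw [hS]; rfl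
    exact central_bound_of_small_gap hm hκ hv1 nc_pos (by omega) (by omega)
  obtain ⟨a, ha, hmin⟩ := (U \ V).exists_min_image pos hS
  obtain ⟨b, hb, hmax⟩ := (U \ V).exists_max_image pos hS
  have hSU : ∀ i ∈ U \ V, i ∈ U := fun i hi => (Finset.mem_sdiff.1 hi).1
  have hcardN : ∀ c : ℤ, ((U \ V).filter (fun i => pos i = c)).card ≤ 1 := by
    intro c
    rw [Finset.card_le_one]
    intro i hi j hj
    rw [Finset.mem_filter] at hi hj
    exact hU.inj i (hSU i hi.1) j (hSU j hj.1) (hi.2.trans hj.2.symm)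
  by_cases htra : orb (gen ρ (U \ (U \ V).filter (fun i => pos i = pos a + 1))) = ⊤
  · refine step a ha _ (Finset.filter_subset _ _) (by simp) (hcardN _) ?_ htra
    intro i hi
    rw [Finset.mem_sdiff, Finset.mem_filter, not_and] at hi
    by_cases hiV : i ∈ V
    · exact (hVc i hiV a (hSU a ha)).symm
    · have hiS : i ∈ U \ V := Finset.mem_sdiff.2 ⟨hi.1, hiV⟩
      by_cases hia : i = a
      · rw [hia]
      · have h1 := hmin i hiS
        have h2 : pos i ≠ pos a := fun e => hia (hU.inj i hi.1 a (hSU a ha) e)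
        have h3 := hi.2 hiS
        exact hU.comm a (hSU a ha) i hi.1 (by rw [abs_of_nonpos] <;> omega)
  by_cases htrb : orb (gen ρ (U \ (U \ V).filter (fun i => pos i = pos b - 1))) = ⊤
  · refine step b hb _ (Finset.filter_subset _ _) (by rw [Finset.mem_filter]; omega) (hcardN _) ?_ htrb
    intro i hi
    rw [Finset.mem_sdiff, Finset.mem_filter, not_and] at hi
    by_cases hiV : i ∈ V
    · exact (hVc i hiV b (hSU b hb)).symm
    · have hiS : i ∈ U \ V := Finset.mem_sdiff.2 ⟨hi.1, hiV⟩
      by_cases hib : i = b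
      · rw [hib]
      · have h1 := hmax i hiS
        have h2 : pos i ≠ pos b := fun e => hib (hU.inj i hi.1 b (hSU b hb) e)
        have h3 := hi.2 hiS
        exact hU.comm b (hSU b hb) i hi.1 (by rw [abs_of_nonneg] <;> omega)
  have htrS : orb (gen ρ V) ⊔ orb (gen ρ (U \ V)) = ⊤ := by
    rw [← orb_sup, ← gen_union, Finset.union_sdiff_of_subset hV, htr]
  obtain ⟨J, hJS, hJ⟩ := exists_minTrans htrS
  have hJmeets : ∀ c : ℤ, orb (gen ρ (U \ (U \ V).filter (fun i => pos i = c))) ≠ ⊤ →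
      ∃ i ∈ J, pos i = c := by
    intro c hc
    by_contra! hno
    refine hc (top_unique ?_)
    rw [← hJ.1, ← orb_sup, ← gen_union]
    refine orb_mono (gen_mono ?_)
    intro i hi
    rw [Finset.mem_sdiff, Finset.mem_filter]
    rcases Finset.mem_union.1 hi with hi | hi
    · exact ⟨hV hi, fun h => (Finset.mem_sdiff.1 h.1).2 hi⟩
    · exact ⟨hSU i (hJS hi), fun h => hno i hi h.2⟩
  obtain ⟨a2, ha2, hpa2⟩ := hJmeets _ htra
  obtain ⟨b2, hb2, hpb2⟩ := hJmeets _ htrb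
  by_cases hgap : ∃ s ∈ U \ V, s ∉ J ∧ pos a2 < pos s ∧ pos s < pos b2
  · obtain ⟨s, hs, hsJ, has, hsb⟩ := hgap
    set A := (U \ V).filter (fun i => pos i < pos s) with hA
    set B := (U \ V).filter (fun i => pos s < pos i) with hB
    have hAV : A ∪ V ⊆ U := Finset.union_subset
      ((Finset.filter_subset _ _).trans Finset.sdiff_subset) hV
    have hBV : B ∪ V ⊆ U := Finset.union_subset
      ((Finset.filter_subset _ _).trans Finset.sdiff_subset) hV
    have hcomm : ∀ i ∈ A ∪ V, ∀ j ∈ B ∪ V, Commute (ρ i) (ρ j) := by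
      intro i hi j hj
      rcases Finset.mem_union.1 hi with hi' | hi'
      · rcases Finset.mem_union.1 hj with hj' | hj'
        · rw [Finset.mem_filter] at hi' hj'
          exact hU.comm i (hAV hi) j (hBV hj) (by rw [abs_of_nonpos] <;> omega)
        · exact (hVc j hj' i (hAV hi)).symm
      · exact hVc i hi' j (hBV hj)
    have P : CommPair (gen ρ (A ∪ V)) (gen ρ (B ∪ V)) := by
      refine ⟨fun g hg h hh => commute_gen hcomm hg hh, top_unique ?_⟩
      rw [← hJ.1, ← orb_sup, ← orb_sup, ← gen_union, ← gen_union]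
      refine orb_mono (gen_mono fun i hi => ?_)
      rcases Finset.mem_union.1 hi with hi | hi
      · simp [hi]
      · have hne : pos i ≠ pos s := fun e => hsJ
          (hU.inj i (hSU i (hJS hi)) s (hSU s hs) e ▸ hi)
        rcases lt_or_gt_of_ne hne with h | h
        · exact Finset.mem_union_left _ (Finset.mem_union_left _ (Finset.mem_filter.2 ⟨hJS hi, h⟩))
        · exact Finset.mem_union_right _ (Finset.mem_union_left _ (Finset.mem_filter.2 ⟨hJS hi, h⟩))
    have hnA : 2 ≤ nc (orb (gen ρ (A ∪ V))) := by
      have h0 : 0 < nc (orb (gen ρ (A ∪ V))) := nc_pos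
      have h1 : nc (orb (gen ρ (A ∪ V))) ≠ 1 := by
        intro e
        refine htrb (top_unique ?_)
        rw [← nc_eq_one.1 e]
        refine orb_mono (gen_mono fun i hi => ?_)
        rw [Finset.mem_sdiff, Finset.mem_filter]
        refine ⟨hAV hi, fun h => ?_⟩
        rcases Finset.mem_union.1 hi with hi | hi
        · have := (Finset.mem_filter.1 hi).2
          omega
        · exact (Finset.mem_sdiff.1 h.1).2 hi
      omega
    have hnB : 2 ≤ nc (orb (gen ρ (B ∪ V))) := by
      have h0 : 0 < nc (orb (gen ρ (B ∪ V))) := nc_pos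
      have h1 : nc (orb (gen ρ (B ∪ V))) ≠ 1 := by
        intro e
        refine htra (top_unique ?_)
        rw [← nc_eq_one.1 e]
        refine orb_mono (gen_mono fun i hi => ?_)
        rw [Finset.mem_sdiff, Finset.mem_filter]
        refine ⟨hBV hi, fun h => ?_⟩
        rcases Finset.mem_union.1 hi with hi | hi
        · have := (Finset.mem_filter.1 hi).2
          omega
        · exact (Finset.mem_sdiff.1 h.1).2 hi
      omega
    have hcA : (A ∪ V).card = A.card + V.card := Finset.card_union_of_disjoint
      (Finset.disjoint_of_subset_left (Finset.filter_subset _ _) Finset.sdiff_disjoint)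
    have hcB : (B ∪ V).card = B.card + V.card := Finset.card_union_of_disjoint
      (Finset.disjoint_of_subset_left (Finset.filter_subset _ _) Finset.sdiff_disjoint)
    obtain ⟨f, hf1, hf2⟩ := P.exists_bound (hU.mono hAV) Finset.subset_union_right
      (fun i hi j hj => hVc i hi j (hAV hj)) x
    obtain ⟨g, hg1, hg2⟩ := P.symm.exists_bound (hU.mono hBV) Finset.subset_union_right
      (fun i hi j hj => hVc i hi j (hBV hj)) x
    have hpA := fun e => P.two_pow_le (hU.mono hAV).indep e x
    have hpB := fun e => P.symm.two_pow_le (hU.mono hBV).indep e x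
    rw [inf_comm] at hg2 hpB
    rw [hcA] at hf1 hpA
    rw [hcB] at hg1 hpB
    have hSc : (U \ V).card ≤ A.card + B.card + 1 := by
      have : U \ V ⊆ insert s (A ∪ B) := by
        intro i hi
        rw [Finset.mem_insert, Finset.mem_union, Finset.mem_filter, Finset.mem_filter]
        by_cases his : i = s
        · exact Or.inl his
        · have hne : pos i ≠ pos s := fun e => his (hU.inj i (hSU i hi) s (hSU s hs) e)
          rcases lt_or_gt_of_ne hne with h | h
          · exact Or.inr (Or.inl ⟨hi, h⟩)
          · exact Or.inr (Or.inr ⟨hi, h⟩)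
      have h1 := Finset.card_le_card this
      have h2 := Finset.card_insert_le s (A ∪ B)
      have h3 := Finset.card_union_le A B
      omega
    have := central_bound_of_gap (p := A.card) (q := B.card) hm (P.card_inter x) hnA hnB hv1
      (by omega) (by omega) hpA hpB
    omega
  · push Not at hgap
    have hSc : U \ V ⊆ insert a (insert b J) := by
      intro i hi
      rw [Finset.mem_insert, Finset.mem_insert]
      by_contra! hno
      have heq : ∀ j ∈ U \ V, pos i = pos j → i = j := fun j hj =>
        hU.inj i (hSU i hi) j (hSU j hj)
      have h1 := hmin i hi
      have h2 := hmax i hi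
      have h3 : pos i ≠ pos a := fun e => hno.1 (heq a ha e)
      have h4 : pos i ≠ pos b := fun e => hno.2.1 (heq b hb e)
      have h5 : pos i ≠ pos a2 := fun e => hno.2.2 (heq a2 (hJS ha2) e ▸ ha2)
      have h6 : pos i ≠ pos b2 := fun e => hno.2.2 (heq b2 (hJS hb2) e ▸ hb2)
      have := hgap i hi hno.2.2 (by omega)
      omega
    have h1 := Finset.card_le_card hSc
    have h2 := Finset.card_insert_le a (insert b J)
    have h3 := Finset.card_insert_le b J
    have h4 := hJ.card_lt
    have h5 : 1 ≤ J.card := Finset.card_pos.2 ⟨a2, ha2⟩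
    exact central_bound_of_small_gap hm hκ hv1 nc_pos (by omega) (by omega)

end Central

section Transport

variable {ι α β : Type*} {f : α → β} {ρ : ι → Perm α} {ρ' : ι → Perm β} {S : Finset ι}

lemma exists_map_gen (hf : ∀ i ∈ S, ∀ x, f (ρ i x) = ρ' i (f x)) {g : Perm α}
    (hg : g ∈ gen ρ S) : ∃ g' ∈ gen ρ' S, ∀ x, f (g x) = g' (f x) := by
  unfold gen at hg
  induction hg using closure_induction with
  | mem x hx => obtain ⟨i, hi, rfl⟩ := hx; exact ⟨ρ' i, mem_gen hi, hf i hi⟩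
  | one => exact ⟨1, one_mem _, fun x => rfl⟩
  | mul x y hx hy ihx ihy =>
    obtain ⟨x', hx', h1⟩ := ihx
    obtain ⟨y', hy', h2⟩ := ihy
    exact ⟨x' * y', mul_mem hx' hy', fun z => by rw [mul_apply, mul_apply, h1, h2]⟩
  | inv x hx ih =>
    obtain ⟨x', hx', h1⟩ := ih
    refine ⟨x'⁻¹, inv_mem hx', fun z => ?_⟩
    rw [Perm.eq_inv_iff_eq, ← h1]
    simp

lemma exists_lift_gen (hf : ∀ i ∈ S, ∀ x, f (ρ i x) = ρ' i (f x)) {g' : Perm β}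
    (hg : g' ∈ gen ρ' S) : ∃ g ∈ gen ρ S, ∀ x, f (g x) = g' (f x) := by
  unfold gen at hg
  induction hg using closure_induction with
  | mem x hx => obtain ⟨i, hi, rfl⟩ := hx; exact ⟨ρ i, mem_gen hi, hf i hi⟩
  | one => exact ⟨1, one_mem _, fun x => rfl⟩
  | mul x y hx hy ihx ihy =>
    obtain ⟨x', hx', h1⟩ := ihx
    obtain ⟨y', hy', h2⟩ := ihy
    exact ⟨x' * y', mul_mem hx' hy', fun z => by rw [mul_apply, mul_apply, h1, h2]⟩
  | inv x hx ih =>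
    obtain ⟨x', hx', h1⟩ := ih
    refine ⟨x'⁻¹, inv_mem hx', fun z => ?_⟩
    rw [Perm.eq_inv_iff_eq, ← h1]
    simp

lemma exists_quotient_family (hsurj : Function.Surjective f) (h2 : ∀ i ∈ S, ρ i * ρ i = 1)
    (hinv : ∀ i ∈ S, ∀ x y, f x = f y → f (ρ i x) = f (ρ i y)) :
    ∃ ρ' : ι → Perm β, ∀ i ∈ S, ∀ x, f (ρ i x) = ρ' i (f x) := by
  classical
  have key : ∀ i, ∃ g : Perm β, i ∈ S → ∀ x, f (ρ i x) = g (f x) := by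
    intro i
    by_cases hi : i ∈ S
    · have h : ∀ x, f (ρ i x) = f (ρ i (Function.surjInv hsurj (f x))) := fun x =>
        hinv i hi _ _ (Function.surjInv_eq hsurj (f x)).symm
      have hinvol : Function.Involutive fun y => f (ρ i (Function.surjInv hsurj y)) := by
        intro y
        obtain ⟨x, rfl⟩ := hsurj y
        change f (ρ i (Function.surjInv hsurj (f (ρ i (Function.surjInv hsurj (f x)))))) = f x
        rw [← h x, ← h (ρ i x), ← mul_apply, h2 i hi, one_apply]
      exact ⟨hinvol.toPerm _, fun _ x => h x⟩
    · exact ⟨1, fun h => absurd h hi⟩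
  choose g hg using key
  exact ⟨g, fun i hi => hg i hi⟩

lemma orb_transport (hsurj : Function.Surjective f) (hf : ∀ i ∈ S, ∀ x, f (ρ i x) = ρ' i (f x))
    (h : ∀ x y, ∃ g ∈ gen ρ S, f (g x) = f y) : orb (gen ρ' S) = ⊤ := by
  refine eq_top_iff_rel.2 fun a b => ?_
  obtain ⟨x, rfl⟩ := hsurj a
  obtain ⟨y, rfl⟩ := hsurj b
  obtain ⟨g, hg, e⟩ := h x y
  obtain ⟨g', hg', h1⟩ := exists_map_gen hf hg
  exact ⟨g', hg', by rw [← h1, e]⟩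

lemma transport_invol (hsurj : Function.Surjective f)
    (hf : ∀ i ∈ S, ∀ x, f (ρ i x) = ρ' i (f x)) {i : ι} (hi : i ∈ S) (h : ρ i * ρ i = 1) :
    ρ' i * ρ' i = 1 := by
  ext y
  obtain ⟨x, rfl⟩ := hsurj y
  rw [mul_apply, ← hf i hi, ← hf i hi, ← mul_apply, h]
  rfl

lemma transport_commute (hsurj : Function.Surjective f)
    (hf : ∀ i ∈ S, ∀ x, f (ρ i x) = ρ' i (f x)) {i j : ι} (hi : i ∈ S) (hj : j ∈ S)
    (h : Commute (ρ i) (ρ j)) : Commute (ρ' i) (ρ' j) := by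
  ext y
  obtain ⟨x, rfl⟩ := hsurj y
  rw [mul_apply, mul_apply, ← hf i hi, ← hf j hj, ← hf i hi, ← hf j hj, ← mul_apply, h.eq]
  rfl

end Transport

section PGroup

lemma sylow_transitive {G X : Type*} [Group G] [Finite G] [MulAction G X] [Finite X] {p k : ℕ}
    [Fact p.Prime] (htr : MulAction.IsPretransitive G X) (hX : Nat.card X = p ^ k)
    (P : Sylow p G) (x y : X) : ∃ g ∈ P, g • x = y := by
  have h1 : (MulAction.stabilizer G x).index = p ^ k := by
    rw [MulAction.index_stabilizer_of_transitive, hX]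
  have h2 : (MulAction.stabilizer P x).index = (MulAction.orbit P x).ncard :=
    MulAction.index_stabilizer P x
  have h3 : MulAction.stabilizer P x = (MulAction.stabilizer G x).subgroupOf P := by
    ext g
    rfl
  have h4 : p ^ k ∣ (MulAction.orbit P x).ncard := by
    rw [← h2, h3]
    refine Nat.Coprime.dvd_of_dvd_mul_right (n := P.index) ?_ ?_
    · exact Nat.Coprime.pow_left _ ((Nat.Prime.coprime_iff_not_dvd Fact.out).2 P.not_dvd_index)
    · rw [← h1]
      change _ ∣ ((MulAction.stabilizer G x).relIndex (P : Subgroup G)) * _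
      rw [← Subgroup.inf_relIndex_right, Subgroup.relIndex_mul_index inf_le_right]
      exact Subgroup.index_dvd_of_le inf_le_left
  have h5 : MulAction.orbit P x = Set.univ := by
    refine Set.eq_of_subset_of_ncard_le (Set.subset_univ _) ?_ (Set.toFinite _)
    rw [Set.ncard_univ, hX]
    exact Nat.le_of_dvd ((Set.ncard_pos (Set.toFinite _)).2 ⟨x, MulAction.mem_orbit_self x⟩) h4
  obtain ⟨g, hg⟩ : y ∈ MulAction.orbit P x := h5 ▸ Set.mem_univ y
  exact ⟨g.1, g.2, hg⟩

/-- Counting the elements of `K` that commute with a `p`-group normalizing `K`. -/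
lemma card_modEq_card_commuting {G : Type*} [Group G] [Finite G] {p : ℕ} [Fact p.Prime]
    {D K : Subgroup G} (hD : IsPGroup p D) (hn : ∀ d ∈ D, ∀ k ∈ K, d * k * d⁻¹ ∈ K) :
    Nat.card K ≡ Set.ncard {k | k ∈ K ∧ ∀ d ∈ D, Commute d k} [MOD p] := by
  let act : MulAction D K :=
    { smul := fun d k => ⟨d.1 * k.1 * d.1⁻¹, hn d.1 d.2 k.1 k.2⟩
      one_smul := fun k => Subtype.ext (by change 1 * k.1 * 1⁻¹ = k.1; simp)
      mul_smul := fun d e k => Subtype.ext (by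
        change (d.1 * e.1) * k.1 * (d.1 * e.1)⁻¹ = d.1 * (e.1 * k.1 * e.1⁻¹) * d.1⁻¹
        group) }
  have h := hD.card_modEq_card_fixedPoints K
  have e : Nat.card (MulAction.fixedPoints D K) =
      Set.ncard {k | k ∈ K ∧ ∀ d ∈ D, Commute d k} := by
    refine Nat.card_congr
      { toFun := fun k => ⟨k.1.1, k.1.2, fun d hd => ?_⟩
        invFun := fun k => ⟨⟨k.1, k.2.1⟩, fun d => Subtype.ext ?_⟩
        left_inv := fun k => rfl
        right_inv := fun k => rfl }
    · have : d * k.1.1 * d⁻¹ = k.1.1 := congrArg Subtype.val (k.2 ⟨d, hd⟩)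
      exact mul_inv_eq_iff_eq_mul.1 this
    · change d.1 * k.1 * d.1⁻¹ = k.1
      exact mul_inv_eq_iff_eq_mul.2 (k.2.2 d.1 d.2)
  rwa [e] at h

end PGroup

section Pairs

variable {α : Type*} [Fintype α] {u : Perm α} {H : Subgroup (Perm α)}

/-- The orbits of an involution. -/
def pairs (u : Perm α) (hu : u * u = 1) : Setoid α where
  r x y := y = x ∨ y = u x
  iseqv :=
    { refl := fun x => Or.inl rfl
      symm := by
        rintro x y (rfl | rfl)
        · exact Or.inl rfl
        · exact Or.inr (by rw [← mul_apply, hu]; rfl)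
      trans := by
        rintro x y z (rfl | rfl) (rfl | rfl)
        · exact Or.inl rfl
        · exact Or.inr rfl
        · exact Or.inr rfl
        · exact Or.inl (by rw [← mul_apply, hu]; rfl) }

lemma inv_pairs (hu : u * u = 1) (hc : ∀ h ∈ H, Commute h u) : Inv H (pairs u hu) := by
  rintro h hh x y (rfl | rfl)
  · exact Or.inl rfl
  · exact Or.inr (by rw [← mul_apply, (hc h hh).eq]; rfl)

/-- The permutation action on the classes of an invariant relation. -/
abbrev quotientAction {s : Setoid α} (hs : Inv H s) : MulAction H (Quotient s) where
  smul h := Quotient.map' h.1 (hs h.1 h.2)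
  one_smul q := by induction q using Quotient.inductionOn; rfl
  mul_smul g h q := by induction q using Quotient.inductionOn; rfl

lemma nc_pairs (hu : u * u = 1) (hfpf : ∀ x, u x ≠ x) :
    2 * nc (pairs u hu) = Fintype.card α := by
  classical
  have : Fintype (Quotient (pairs u hu)) := Fintype.ofFinite _
  have hsum := Finset.card_eq_sum_card_fiberwise (s := (Finset.univ : Finset α))
    (f := fun y => (Quotient.mk (pairs u hu) y)) (t := Finset.univ) (by simp)
  rw [Finset.sum_const_nat (m := 2), Finset.card_univ, Finset.card_univ] at hsum
  · rw [nc, Nat.card_eq_fintype_card, hsum, mul_comm]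
  intro q _
  induction q using Quotient.inductionOn with | h x
  rw [← Finset.card_pair (hfpf x).symm]
  congr 1
  ext y
  simp only [Finset.mem_filter, Finset.mem_univ, true_and, Finset.mem_insert,
    Finset.mem_singleton]
  exact ⟨fun e => (pairs u hu).symm (Quotient.exact e),
    fun e => Quotient.sound ((pairs u hu).symm e)⟩

lemma mul_self_of_mem_fixer (hu : u * u = 1) {g : Perm α} (hg : g ∈ fixer (pairs u hu))
    (hc : Commute g u) : g * g = 1 := by
  ext x
  rw [mul_apply, one_apply]
  rcases hg x with e | e
  · rw [e, e]
  · rw [e, ← mul_apply, hc.eq, mul_apply, e, ← mul_apply, hu]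
    rfl

lemma conj_mem_fixer {s : Setoid α} (hs : Inv H s) {h k : Perm α} (hh : h ∈ H)
    (hk : k ∈ fixer s) : h * k * h⁻¹ ∈ fixer s := by
  intro x
  simpa using hs h hh _ _ (hk (h⁻¹ x))

/-- If `H` centralizes a fixed point free involution outside `H`, and is transitive on its
orbits whose number is a power of `p`, then the kernel on these orbits has order `1` modulo
`p`. -/
lemma card_kernel_modEq_one {p k : ℕ} [Fact p.Prime] (hu : u * u = 1)
    (hc : ∀ h ∈ H, Commute h u) (huH : u ∉ H)
    (htr : ∀ x y, ∃ h ∈ H, pairs u hu (h x) y) (hnc : nc (pairs u hu) = p ^ k) :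
    Nat.card ↥(H ⊓ fixer (pairs u hu)) ≡ 1 [MOD p] := by
  have hs := inv_pairs hu hc
  let act := quotientAction hs
  have htr' : MulAction.IsPretransitive H (Quotient (pairs u hu)) := ⟨by
    intro a b
    induction a using Quotient.inductionOn with | h x
    induction b using Quotient.inductionOn with | h y
    obtain ⟨h, hh, e⟩ := htr x y
    exact ⟨⟨h, hh⟩, Quotient.sound e⟩⟩
  obtain ⟨P⟩ : Nonempty (Sylow p H) := inferInstance
  have hPtr := sylow_transitive htr' hnc P
  let D : Subgroup (Perm α) := (P : Subgroup H).map H.subtype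
  have hDH : D ≤ H := by
    rintro _ ⟨g, -, rfl⟩
    exact g.2
  have hD : IsPGroup p D := P.isPGroup'.map _
  have hDtr : ∀ x y, ∃ d ∈ D, pairs u hu (d x) y := by
    intro x y
    obtain ⟨g, hg, e⟩ := hPtr (Quotient.mk _ x) (Quotient.mk _ y)
    exact ⟨g.1, ⟨g, hg, rfl⟩, Quotient.exact e⟩
  have h := card_modEq_card_commuting (K := H ⊓ fixer (pairs u hu)) hD (fun d hd k hk =>
    ⟨H.mul_mem (H.mul_mem (hDH hd) hk.1) (H.inv_mem (hDH hd)), conj_mem_fixer hs (hDH hd) hk.2⟩)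
  suffices hset : {k | k ∈ H ⊓ fixer (pairs u hu) ∧ ∀ d ∈ D, Commute d k} = {1} by
    rwa [hset, Set.ncard_singleton] at h
  ext k
  simp only [Set.mem_ofPred_eq, Set.mem_singleton_iff]
  refine ⟨?_, ?_⟩
  · rintro ⟨⟨hkH, hkf⟩, hkD⟩
    have hku := hc k hkH
    by_cases hfix : ∃ x, k x = x
    · obtain ⟨x, hx⟩ := hfix
      ext y
      obtain ⟨d, hd, e⟩ := hDtr x y
      have hdx : k (d x) = d x := by rw [← mul_apply, ← (hkD d hd).eq, mul_apply, hx]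
      rcases e with rfl | rfl
      · exact hdx
      · rw [← mul_apply, hku.eq, mul_apply, hdx]
        rfl
    · push Not at hfix
      refine absurd ?_ huH
      have : k = u := by
        ext x
        rcases hkf x with e | e
        · exact absurd e (hfix x)
        · exact e
      exact this ▸ hkH
  · rintro rfl
    exact ⟨one_mem _, fun d _ => Commute.one_right d⟩

lemma exists_card_kernel (hu : u * u = 1) (hc : ∀ h ∈ H, Commute h u) :
    ∃ e, Nat.card ↥(H ⊓ fixer (pairs u hu)) = 2 ^ e ∧ 2 * e ≤ Fintype.card α := by
  have h2 : ∀ g ∈ H ⊓ fixer (pairs u hu), g * g = 1 := fun g hg =>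
    mul_self_of_mem_fixer hu hg.2 (hc g hg.1)
  have hp : IsPGroup 2 ↥(H ⊓ fixer (pairs u hu)) := by
    intro g
    refine ⟨1, ?_⟩
    ext1
    simpa [pow_succ] using h2 g g.2
  obtain ⟨e, he⟩ := IsPGroup.iff_card.1 hp
  refine ⟨e, he, ?_⟩
  have := sq_card_le_of_exponent_two Finset.univ _ h2 (by simp)
    (fun g _ h => Perm.ext fun x => h x (Finset.mem_univ x))
  rw [he, ← pow_mul, Nat.pow_le_pow_iff_right (by norm_num), Finset.card_univ] at this
  omega

end Pairs

section CentralInvolution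

variable {ι α : Type*} [DecidableEq ι] [Fintype α] {ρ : ι → Perm α} {A B S L : Finset ι}
  {pos : ι → ℤ} {u : Perm α}

lemma transport_strFam {β : Type*} {f : α → β} {ρ' : ι → Perm β} (hsurj : Function.Surjective f)
    (hf : ∀ i ∈ S, ∀ x, f (ρ i x) = ρ' i (f x)) (h : StrFam ρ pos S) (hi : Indep ρ' S) :
    StrFam ρ' pos S where
  invol i hi := transport_invol hsurj hf hi (h.invol i hi)
  comm i hi j hj hij := transport_commute hsurj hf hi hj (h.comm i hi j hj hij)
  inj := h.inj
  indep := hi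

/-- The family induced on the orbits of a centralizing involution. -/
lemma exists_pairs_family (hA : StrFam ρ pos A) (hu : u * u = 1)
    (hc : ∀ i ∈ A, Commute (ρ i) u) :
    ∃ ρ' : ι → Perm (Quotient (pairs u hu)), ∀ i ∈ A, ∀ x,
      Quotient.mk (pairs u hu) (ρ i x) = ρ' i (Quotient.mk _ x) := by
  refine exists_quotient_family Quotient.mk_surjective hA.invol fun i hi x y e => ?_
  exact Quotient.sound (inv_pairs hu (H := gen ρ A) (fun h hh => commute_of_mem_gen hc hh) _
    (mem_gen hi) _ _ (Quotient.exact e))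

lemma exists_mem_kernel {s : Setoid α} {ρ' : ι → Perm (Quotient s)} {i : ι} (hS : S ⊆ A)
    (hi : i ∈ A) (hf : ∀ i ∈ A, ∀ x, Quotient.mk s (ρ i x) = ρ' i (Quotient.mk _ x))
    (hmem : ρ' i ∈ gen ρ' S) : ∃ g ∈ gen ρ S, ρ i * g⁻¹ ∈ fixer s := by
  obtain ⟨g, hg, e⟩ := exists_lift_gen (fun j hj => hf j (hS hj)) hmem
  refine ⟨g, hg, fun x => ?_⟩
  have h : s (g (g⁻¹ x)) (ρ i (g⁻¹ x)) :=
    Quotient.exact ((e _).trans (hf i hi _).symm)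
  simpa using h

lemma ne_of_transitive (hu1 : u ≠ 1) (hc : ∀ i ∈ A, Commute (ρ i) u)
    (htr : orb (gen ρ A) = ⊤) (x : α) : u x ≠ x := by
  intro e
  refine hu1 (Perm.ext fun y => ?_)
  obtain ⟨g, hg, rfl⟩ := eq_top_iff_rel.1 htr x y
  rw [← mul_apply, ← (commute_of_mem_gen hc hg).eq, mul_apply, e]
  rfl

lemma card_le_three_of_card_eq_eight (hA : StrFam ρ pos A) (hu : u * u = 1) (hu1 : u ≠ 1)
    (hc : ∀ i ∈ A, Commute (ρ i) u) (huA : u ∉ gen ρ A) (htr : orb (gen ρ A) = ⊤)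
    (hm : Fintype.card α = 8) : A.card ≤ 3 := by
  have hfpf := ne_of_transitive hu1 hc htr
  have hnc : nc (pairs u hu) = 2 ^ 2 := by have := nc_pairs hu hfpf; omega
  have hcH : ∀ h ∈ gen ρ A, Commute h u := fun h hh => commute_of_mem_gen hc hh
  have : Fact (Nat.Prime 2) := ⟨Nat.prime_two⟩
  have hmod := card_kernel_modEq_one hu hcH huA (fun x y => by
    obtain ⟨g, hg, e⟩ := eq_top_iff_rel.1 htr x y
    exact ⟨g, hg, Or.inl e.symm⟩) hnc
  obtain ⟨e, he, -⟩ := exists_card_kernel hu hcH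
  have he0 : e = 0 := by
    rcases Nat.eq_zero_or_pos e with h | h
    · exact h
    · obtain ⟨k, rfl⟩ : ∃ k, e = k + 1 := ⟨e - 1, by omega⟩
      rw [he, pow_succ, Nat.ModEq] at hmod
      omega
  rw [he0, pow_zero, Subgroup.card_eq_one] at he
  obtain ⟨ρ', hρ'⟩ := exists_pairs_family hA hu hc
  have hind : Indep ρ' A := by
    intro i hi hmem
    obtain ⟨g, hg, hk⟩ := exists_mem_kernel (Finset.erase_subset i A) hi hρ' hmem
    have hgA := gen_mono (Finset.erase_subset i A) hg
    have : ρ i * g⁻¹ ∈ gen ρ A ⊓ fixer (pairs u hu) :=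
      ⟨(gen ρ A).mul_mem (mem_gen hi) ((gen ρ A).inv_mem hgA), hk⟩
    rw [he, Subgroup.mem_bot, mul_inv_eq_one] at this
    exact hA.indep i hi (this ▸ hg)
  have hfin : Fintype (Quotient (pairs u hu)) := Fintype.ofFinite _
  refine (transport_strFam Quotient.mk_surjective hρ' hA hind).card_le_three
    (Z := Finset.univ) ?_ (by simp) (fun g _ h => Perm.ext fun x => h x (Finset.mem_univ x))
  rw [Finset.card_univ, ← Nat.card_eq_fintype_card]
  exact hnc

lemma card_le_five_of_card_eq_ten (hA : StrFam ρ pos A) (hu : u * u = 1) (hu1 : u ≠ 1)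
    (hc : ∀ i ∈ A, Commute (ρ i) u) (huA : u ∉ gen ρ A) (htr : orb (gen ρ A) = ⊤)
    (hm : Fintype.card α = 10) : A.card ≤ 5 := by
  have hfpf := ne_of_transitive hu1 hc htr
  have hnc : nc (pairs u hu) = 5 ^ 1 := by have := nc_pairs hu hfpf; omega
  have : Fact (Nat.Prime 5) := ⟨by norm_num⟩
  have hfin : Fintype (Quotient (pairs u hu)) := Fintype.ofFinite _
  obtain ⟨ρ', hρ'⟩ := exists_pairs_family hA hu hc
  obtain ⟨L, hLA, hL, hmin⟩ := exists_minimal_subset (fun L => gen ρ' L = gen ρ' A) A rfl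
  have hind : Indep ρ' L := by
    intro i hi hmem
    refine hmin i hi ?_
    rw [← hL]
    refine le_antisymm (gen_mono (Finset.erase_subset _ _)) (gen_le.2 fun j hj => ?_)
    by_cases hji : j = i
    · rwa [hji]
    · exact mem_gen (Finset.mem_erase.2 ⟨hji, hj⟩)
  have hLS := transport_strFam Quotient.mk_surjective (fun i hi => hρ' i (hLA hi))
    (hA.mono hLA) hind
  obtain ⟨f, hf1, hf2⟩ := hLS.exists_bound (V := ∅) (Finset.empty_subset _) (by simp)
    Finset.univ (by simp) (fun g _ h => Perm.ext fun x => h x (Finset.mem_univ x))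
  rw [Finset.card_univ, ← Nat.card_eq_fintype_card] at hf2
  change _ ≤ nc (pairs u hu) at hf2
  rw [Finset.card_empty] at hf1 hf2
  have htr' : orb (gen ρ' A) = ⊤ := orb_transport Quotient.mk_surjective hρ' fun x y => by
    obtain ⟨g, hg, e⟩ := eq_top_iff_rel.1 htr x y
    exact ⟨g, hg, by rw [e]⟩
  have hkey : ∀ S, L ⊆ S → S ⊆ A → ∃ e, Nat.card ↥(gen ρ S ⊓ fixer (pairs u hu)) = 2 ^ e ∧
      (e = 0 ∨ e = 4) := by
    intro S hLS hSA
    have hcH : ∀ h ∈ gen ρ S, Commute h u :=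
      fun h hh => commute_of_mem_gen (fun i hi => hc i (hSA hi)) hh
    have hmod := card_kernel_modEq_one hu hcH (fun h => huA (gen_mono hSA h)) (fun x y => by
      have h1 : gen ρ' S = gen ρ' A :=
        le_antisymm (gen_mono hSA) (hL ▸ gen_mono hLS)
      obtain ⟨g', hg', e'⟩ := eq_top_iff_rel.1 htr' (Quotient.mk _ x) (Quotient.mk _ y)
      obtain ⟨g, hg, e⟩ := exists_lift_gen (fun i hi => hρ' i (hSA hi)) (h1 ▸ hg')
      exact ⟨g, hg, Quotient.exact ((e x).trans e')⟩) hnc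
    obtain ⟨e, he, he2⟩ := exists_card_kernel hu hcH
    refine ⟨e, he, ?_⟩
    rw [he, Nat.ModEq] at hmod
    have : e ≤ 5 := by omega
    interval_cases e <;> simp_all
  have hstrict : ∀ S i, L ⊆ S → insert i S ⊆ A → i ∉ S →
      Nat.card ↥(gen ρ S ⊓ fixer (pairs u hu)) <
        Nat.card ↥(gen ρ (insert i S) ⊓ fixer (pairs u hu)) := by
    intro S i hLS hSA hiS
    have hSA' : S ⊆ A := (Finset.subset_insert i S).trans hSA
    have hiA := hSA (Finset.mem_insert_self i S)
    have hle : gen ρ S ⊓ fixer (pairs u hu) < gen ρ (insert i S) ⊓ fixer (pairs u hu) := by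
      refine lt_of_le_of_ne (inf_le_inf_right _ (gen_mono (Finset.subset_insert i S))) fun he => ?_
      have hmem : ρ' i ∈ gen ρ' S := by
        have : ρ' i ∈ gen ρ' A := mem_gen hiA
        rw [← hL] at this
        exact gen_mono hLS this
      obtain ⟨g, hg, hk⟩ := exists_mem_kernel hSA' hiA hρ' hmem
      have h1 : ρ i * g⁻¹ ∈ gen ρ (insert i S) ⊓ fixer (pairs u hu) :=
        ⟨Subgroup.mul_mem _ (mem_gen (Finset.mem_insert_self i S))
          (Subgroup.inv_mem _ (gen_mono (Finset.subset_insert i S) hg)), hk⟩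
      rw [← he] at h1
      refine hA.indep.notMem hiA hSA' hiS ?_
      simpa using mul_mem h1.1 hg
    have := two_mul_card_le hle
    have h0 : 0 < Nat.card ↥(gen ρ S ⊓ fixer (pairs u hu)) := Nat.card_pos
    omega
  by_contra! hcard
  have h2 : 1 < (A \ L).card := by
    rw [Finset.card_sdiff_of_subset hLA]
    omega
  obtain ⟨i, hi, j, hj, hij⟩ := Finset.one_lt_card.1 h2
  rw [Finset.mem_sdiff] at hi hj
  have hiA : insert i L ⊆ A := Finset.insert_subset hi.1 hLA
  have hjA : insert j (insert i L) ⊆ A := Finset.insert_subset hj.1 hiA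
  obtain ⟨e1, h1, h1'⟩ := hkey L subset_rfl hLA
  obtain ⟨e2, h2, h2'⟩ := hkey _ (Finset.subset_insert i L) hiA
  obtain ⟨e3, h3, h3'⟩ := hkey _ ((Finset.subset_insert i L).trans (Finset.subset_insert j _)) hjA
  have s1 := hstrict L i subset_rfl hiA hi.2
  have s2 := hstrict (insert i L) j (Finset.subset_insert i L) hjA (by
    simp only [Finset.mem_insert, not_or]
    exact ⟨hij.symm, hj.2⟩)
  rw [h1, h2] at s1
  rw [h2, h3] at s2
  rcases h1' with rfl | rfl <;> rcases h2' with rfl | rfl <;> rcases h3' with rfl | rfl <;> omega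

end CentralInvolution

section Klein

variable {ι α : Type*} [DecidableEq ι] [Fintype α] {ρ : ι → Perm α} {A B : Finset ι}
  {pos : ι → ℤ}

lemma mem_gen_pair {Γ : Type*} [Group Γ] {ρ : ι → Γ} {i j : ι} (hi : ρ i * ρ i = 1)
    (hj : ρ j * ρ j = 1) (hc : Commute (ρ i) (ρ j)) {g : Γ} (hg : g ∈ gen ρ {i, j}) :
    g = 1 ∨ g = ρ i ∨ g = ρ j ∨ g = ρ i * ρ j := by
  let K : Subgroup Γ :=
    { carrier := {g | g = 1 ∨ g = ρ i ∨ g = ρ j ∨ g = ρ i * ρ j}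
      one_mem' := Or.inl rfl
      mul_mem' := by
        have hji := hc.eq.symm
        have h1 : ρ i * (ρ i * ρ j) = ρ j := by rw [← mul_assoc, hi, one_mul]
        have h2 : ρ j * (ρ i * ρ j) = ρ i := by rw [← mul_assoc, hji, mul_assoc, hj, mul_one]
        rintro a b (rfl | rfl | rfl | rfl) (rfl | rfl | rfl | rfl) <;>
          simp [mul_assoc, hi, hj, hji, h1, h2]
      inv_mem' := by
        have hi' : (ρ i)⁻¹ = ρ i := inv_eq_of_mul_eq_one_left hi
        have hj' : (ρ j)⁻¹ = ρ j := inv_eq_of_mul_eq_one_left hj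
        rintro a (rfl | rfl | rfl | rfl) <;> simp [hi', hj', hc.eq] }
  have : gen ρ {i, j} ≤ K := gen_le.2 (by
    intro k hk
    rcases Finset.mem_insert.1 hk with rfl | hk
    · exact Or.inr (Or.inl rfl)
    · rw [Finset.mem_singleton.1 hk]
      exact Or.inr (Or.inr (Or.inl rfl)))
  exact this hg

lemma CommPair.false_of_klein (P : CommPair (gen ρ A) (gen ρ B)) (h : StrFam ρ pos (A ∪ B))
    (hd : Disjoint A B) (hA : orb (gen ρ A) = ⊤) (hm : Fintype.card α = 8) (hA2 : 2 ≤ A.card)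
    {b b' : ι} (hb : b ∈ B) (hb' : b' ∈ B) (hbb : b ≠ b') (hc : Commute (ρ b) (ρ b')) : False := by
  have hne : Nonempty α := Fintype.card_pos_iff.1 (by omega)
  have hbA : b ∉ A := fun hh => Finset.disjoint_left.1 hd hh hb
  have hbA' : b' ∉ A := fun hh => Finset.disjoint_left.1 hd hh hb'
  have hbU : b ∈ A ∪ B := Finset.mem_union_right _ hb
  have hbU' : b' ∈ A ∪ B := Finset.mem_union_right _ hb'
  set V := gen ρ {b, b'} with hV
  have hsub : ({b, b'} : Finset ι) ⊆ B := Finset.insert_subset hb (by simpa using hb')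
  have hVB : V ≤ gen ρ B := gen_mono hsub
  have hlist : ∀ g ∈ V, g = 1 ∨ g = ρ b ∨ g = ρ b' ∨ g = ρ b * ρ b' := fun g hg =>
    mem_gen_pair (h.invol b hbU) (h.invol b' hbU') hc hg
  have hVA : ∀ g ∈ V, g ∈ gen ρ A → g = 1 := by
    intro g hg hgA
    rcases hlist g hg with rfl | rfl | rfl | rfl
    · rfl
    · exact absurd hgA (h.indep.notMem hbU Finset.subset_union_left hbA)
    · exact absurd hgA (h.indep.notMem hbU' Finset.subset_union_left hbA')
    · refine absurd ?_ (h.indep.notMem (S := insert b' A) hbU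
        (Finset.insert_subset hbU' Finset.subset_union_left) (by simp [hbb, hbA]))
      have h1 := mul_mem (gen_mono (Finset.subset_insert b' A) hgA)
        (mem_gen (ρ := ρ) (Finset.mem_insert_self b' A))
      rwa [mul_assoc, h.invol b' hbU', mul_one] at h1
  have PV : CommPair V (gen ρ A) := ⟨fun v hv a ha => (P.comm a ha v (hVB hv)).symm, by
    rw [hA]; simp⟩
  have hcardV := PV.card_mul_nc hA
  have hV4 : Nat.card V ≤ 4 := by
    classical
    have : (V : Set (Perm α)) ⊆ (({1, ρ b, ρ b', ρ b * ρ b'} : Finset (Perm α)) : Set _) := by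
      intro g hg
      simpa using hlist g hg
    have h1 := Set.ncard_le_ncard this (Finset.finite_toSet _)
    rw [Set.ncard_coe_finset] at h1
    exact h1.trans Finset.card_le_four
  have hV4' : 4 ≤ Nat.card V := by
    have := (h.indep.mono (hsub.trans Finset.subset_union_right)).two_pow_card_le
    rwa [Finset.card_pair hbb] at this
  have hnc : nc (orb V) = 2 := by
    have : Nat.card V = 4 := by omega
    rw [this] at hcardV
    omega
  have htwo : ∀ x y z, ¬ orb V x y → ¬ orb V x z → orb V y z := by
    intro x y z hxy hxz
    by_contra hyz
    have : Fintype (Quotient (orb V)) := Fintype.ofFinite _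
    rw [nc, Nat.card_eq_fintype_card] at hnc
    classical
    have h3 : ({Quotient.mk (orb V) x, Quotient.mk (orb V) y, Quotient.mk (orb V) z} :
        Finset (Quotient (orb V))).card = 3 := by
      rw [Finset.card_eq_three]
      exact ⟨_, _, _, fun e => hxy (Quotient.exact e), fun e => hxz (Quotient.exact e),
        fun e => hyz (Quotient.exact e), rfl⟩
    have := Finset.card_le_univ ({Quotient.mk (orb V) x, Quotient.mk (orb V) y,
      Quotient.mk (orb V) z} : Finset (Quotient (orb V)))
    omega
  have hcomm : ∀ v ∈ V, ∀ a ∈ gen ρ A, ∀ x, v (a x) = a (v x) := by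
    intro v hv a ha x
    rw [← mul_apply, (PV.comm v hv a ha).eq, mul_apply]
  have hinv : Inv (gen ρ A) (orb V) := PV.inv_left.mono le_sup_right
  obtain ⟨a, haA, x, hax⟩ : ∃ a ∈ A, ∃ x, ¬ orb V x (ρ a x) := by
    by_contra! hcon
    have : orb V = ⊤ := top_unique (hA ▸ orb_gen_le.2 hcon)
    rw [this, nc_top] at hnc
    omega
  obtain ⟨a', ha', haa⟩ := Finset.exists_mem_ne (by omega : 1 < A.card) a
  have haU := Finset.mem_union_left B haA
  have haU' := Finset.mem_union_left B ha'
  have haG := mem_gen (ρ := ρ) haA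
  obtain ⟨c, hcA, hc1, hcx⟩ : ∃ c ∈ gen ρ A, c ≠ 1 ∧ orb V x (c x) := by
    by_cases hx : orb V x (ρ a' x)
    · exact ⟨_, mem_gen ha', h.indep.ne_one haU', hx⟩
    · refine ⟨ρ a * ρ a', mul_mem haG (mem_gen ha'), ?_, ?_⟩
      · intro e
        refine h.indep.ne haU' haU haa ?_
        have := h.invol a haU
        exact mul_left_cancel (e.trans this.symm)
      · have h1 := hinv _ haG _ _ (htwo x _ _ hax hx)
        rwa [← mul_apply, h.invol a haU] at h1
  have hcy : orb V (ρ a x) (c (ρ a x)) := by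
    by_contra hcon
    have h1 : orb V x (c (ρ a x)) := by
      by_contra h2
      exact hcon (htwo _ _ _ hax h2)
    have h2 := (hinv.iff hcA).1 ((orb V).trans ((orb V).symm hcx) h1)
    exact hax h2
  obtain ⟨v, hv, hvx⟩ := hcx
  obtain ⟨w, hw, hwy⟩ := hcy
  have hVV : ∀ g ∈ V, ∀ v ∈ V, Commute g v := fun g hg v hv =>
    commute_gen (S := {b, b'}) (T := {b, b'}) (ρ := ρ) (ρ' := ρ) (by
      simp only [Finset.mem_insert, Finset.mem_singleton]
      rintro i (rfl | rfl) j (rfl | rfl)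
      · rfl
      · exact hc
      · exact hc.symm
      · rfl) hg hv
  have hcV : ∀ z, ∀ v ∈ V, v z = c z → ∀ y, orb V z y → c y = v y := by
    rintro z v hv e _ ⟨g, hg, rfl⟩
    rw [← hcomm g hg c hcA, ← e, ← mul_apply, ← mul_apply, (hVV g hg v hv).eq]
  have hcx := hcV x v hv hvx
  have hcy := hcV _ w hw hwy
  have haa : ∀ z, ρ a (ρ a z) = z := fun z => by rw [← mul_apply, h.invol a haU]; rfl
  have hprod : c * (ρ a * c * ρ a) = v * w := by
    ext y
    simp only [mul_apply]
    by_cases hy : orb V x y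
    · rw [hcy _ (hinv _ haG _ _ hy), hcomm w hw _ haG, haa,
        hcx _ ((orb V).trans hy ⟨w, hw, rfl⟩)]
    · have hy' : orb V (ρ a x) y := htwo _ _ _ hax hy
      have hy2 : orb V x (ρ a y) := by simpa [haa] using hinv _ haG _ _ hy'
      rw [hcx _ hy2, hcomm v hv _ haG, haa, hcy _ ((orb V).trans hy' ⟨v, hv, rfl⟩),
        ← mul_apply, ← mul_apply, (hVV v hv w hw).eq]
  have hvw : v * w = 1 := hVA _ (mul_mem hv hw) (by
    rw [← hprod]
    exact mul_mem hcA (mul_mem (mul_mem haG hcA) haG))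
  have hww : w * w = 1 := mul_self_of_mem_gen (fun i hi j hj => hVV _ (mem_gen hi) _ (mem_gen hj))
    (fun i hi => h.invol i (Finset.mem_union_right _ (hsub hi))) hw
  have hvw' : v = w := mul_right_cancel (hvw.trans hww.symm)
  have hcv : c = v := by
    ext y
    by_cases hy : orb V x y
    · exact hcx y hy
    · rw [hvw']
      exact hcy y (htwo _ _ _ hax hy)
  exact hc1 (hVA c (hcv ▸ hv) hcA)

end Klein

section Central

variable {ι α : Type*} [DecidableEq ι] [Fintype α] {ρ : ι → Perm α} {A B : Finset ι}
  {pos : ι → ℤ}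

lemma card_add_four_le_of_transitive (P : CommPair (gen ρ A) (gen ρ B))
    (h : StrFam ρ pos (A ∪ B)) (hd : Disjoint A B) (hA : orb (gen ρ A) = ⊤) (hB : B.Nonempty)
    (hm : 7 ≤ Fintype.card α) : A.card + B.card + 4 ≤ Fintype.card α := by
  have hne : Nonempty α := Fintype.card_pos_iff.1 (by omega)
  have hSA := h.mono (Finset.subset_union_left : A ⊆ A ∪ B)
  have hSB := h.mono (Finset.subset_union_right : B ⊆ A ∪ B)
  have hcAB : ∀ i ∈ A, ∀ j ∈ B, Commute (ρ i) (ρ j) := fun i hi j hj =>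
    P.comm _ (mem_gen hi) _ (mem_gen hj)
  have hcard := P.symm.card_mul_nc hA
  have hncpos : 0 < nc (orb (gen ρ B)) := nc_pos
  have hB2 := hSB.indep.two_pow_card_le
  have hA2 := hSA.indep.two_pow_card_le
  have hBpos : 0 < B.card := Finset.card_pos.2 hB
  have homega : ∀ V ⊆ B, V.Nonempty → (∀ i ∈ V, ∀ j ∈ V, Commute (ρ i) (ρ j)) →
      12 ≤ Fintype.card α →
      A.card + 2 * V.card + margin (Fintype.card α) ≤ Fintype.card α := by
    intro V hV hne hVc h12
    have := (h.mono (Finset.union_subset_union_right hV)).card_add_card_add_margin_le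
      (V := V) h12 Finset.subset_union_right hne (by
        intro i hi j hj
        rcases Finset.mem_union.1 hj with hj | hj
        · exact (hcAB j hj i (hV hi)).symm
        · exact hVc i hi j hj) (top_unique (hA ▸ orb_mono (gen_mono Finset.subset_union_left)))
    rw [Finset.card_union_of_disjoint (hd.mono_right hV)] at this
    omega
  have hBtr : nc (orb (gen ρ B)) = 1 → Nat.card (gen ρ A) ≤ Fintype.card α := by
    intro h1
    have := P.card_mul_nc (nc_eq_one.1 h1)
    rw [hA, nc_top, mul_one] at this
    exact this.le
  have hlt : ∀ {k e : ℕ} (c : ℕ), 2 ^ k ≤ e → e < 2 ^ c → k < c := fun c h1 h2 =>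
    (Nat.pow_lt_pow_iff_right (by norm_num)).1 (h1.trans_lt h2)
  have hBle : Nat.card (gen ρ B) ≤ Fintype.card α := by
    rw [← hcard]
    exact Nat.le_mul_of_pos_right _ hncpos
  obtain ⟨V, hV, hVcard, hVc⟩ := hSB.exists_commuting
  have hVne : V.Nonempty := Finset.card_pos.1 (by omega)
  have hnoncomm : ∀ i ∈ B, ∀ j ∈ B, ¬ Commute (ρ i) (ρ j) → 6 ≤ Nat.card (gen ρ B) :=
    fun i hi j hj hij => six_le_card (mem_gen hi) (mem_gen hj) (hSB.invol i hi)
      (hSB.invol j hj) hij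
  by_cases h14 : 14 ≤ Fintype.card α
  · have := homega V hV hVne hVc (by omega)
    rw [margin, if_pos h14] at this
    omega
  obtain ⟨b, hb⟩ := hB
  have huA : ρ b ∉ gen ρ A := h.indep.notMem (Finset.mem_union_right _ hb)
    Finset.subset_union_left (fun hh => Finset.disjoint_left.1 hd hh hb)
  have heven := nc_pairs (hSB.invol b hb)
    (ne_of_transitive (hSB.indep.ne_one hb) (fun i hi => hcAB i hi b hb) hA)
  have hdvd : 2 ∣ Nat.card (gen ρ B) := by
    have h1 : orderOf (⟨ρ b, mem_gen hb⟩ : gen ρ B) = 2 := by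
      rw [Subgroup.orderOf_mk]
      exact orderOf_eq_prime (by rw [sq, hSB.invol b hb]) (hSB.indep.ne_one hb)
    rw [← h1]
    exact orderOf_dvd_natCard _
  obtain ⟨k, hk⟩ := hdvd
  by_contra! hcon
  have hm3 : Fintype.card α = 8 ∨ Fintype.card α = 10 ∨ Fintype.card α = 12 := by omega
  rcases hm3 with hm | hm | hm
  · rw [hm] at hcon hcard hBle
    have hB3 := hlt 4 hB2 (by omega)
    have hpair : ∀ i ∈ B, ∀ j ∈ B, i ≠ j → 2 ≤ A.card → ¬ Commute (ρ i) (ρ j) :=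
      fun i hi j hj hij h2 hc => P.false_of_klein h hd hA hm h2 hi hj hij hc
    by_cases hB1 : B.card = 1
    · have := card_le_three_of_card_eq_eight hSA (hSB.invol b hb) (hSB.indep.ne_one hb)
        (fun i hi => hcAB i hi b hb) huA hA hm
      omega
    by_cases hB3 : B.card = 3
    · obtain ⟨i, hi, j, hj, hij⟩ := Finset.one_lt_card.1 (by omega : 1 < V.card)
      exact hpair i (hV hi) j (hV hj) hij (by omega) (hVc i hi j hj)
    · obtain ⟨i, hi, j, hj, hij⟩ := Finset.one_lt_card.1 (by omega : 1 < B.card)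
      have h6 := hnoncomm i hi j hj (hpair i hi j hj hij (by omega))
      have hnc1 : nc (orb (gen ρ B)) = 1 := by
        by_contra hne1
        have : 2 ≤ nc (orb (gen ρ B)) := by omega
        nlinarith
      obtain ⟨F, hF, hFcard, hFc⟩ := hSA.exists_commuting
      obtain ⟨i, hi, j, hj, hij⟩ := Finset.one_lt_card.1 (by omega : 1 < F.card)
      exact P.symm.false_of_klein (by rwa [Finset.union_comm]) hd.symm (nc_eq_one.1 hnc1) hm
        (by omega) (hF hi) (hF hj) hij (hFc i hi j hj)
  · rw [hm] at hcon hcard hBle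
    by_cases hB1 : B.card = 1
    · have := card_le_five_of_card_eq_ten hSA (hSB.invol b hb) (hSB.indep.ne_one hb)
        (fun i hi => hcAB i hi b hb) huA hA hm
      omega
    · have h22 : 2 ^ 2 ≤ 2 ^ B.card := Nat.pow_le_pow_right (by norm_num) (by omega)
      have h4 : 4 ≤ Nat.card (gen ρ B) := h22.trans hB2
      have hnc1 : nc (orb (gen ρ B)) = 1 := by
        rw [hk] at hcard h4
        have h5 : k * nc (orb (gen ρ B)) = 5 := by linarith
        have hk5 : k ∣ 5 := ⟨_, h5.symm⟩
        rcases (Nat.dvd_prime (by norm_num)).1 hk5 with rfl | rfl <;> omega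
      have h1 := hlt 4 hB2 (by omega)
      have h2 := hlt 4 hA2 (by have := hBtr hnc1; omega)
      omega
  · have h1 := homega V hV hVne hVc (by omega)
    rw [margin_eq (by omega)] at h1
    rw [hm] at hcon hcard hBle
    have hB4 := hlt 4 hB2 (by omega)
    have hq : B.card = 2 := by omega
    have hp : A.card = 7 := by omega
    rw [hp] at hA2
    have hncm : ∃ i ∈ B, ∃ j ∈ B, ¬ Commute (ρ i) (ρ j) := by
      by_contra! hcomm
      have := homega B subset_rfl ⟨b, hb⟩ hcomm (by omega)
      rw [margin_eq (by omega)] at this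
      omega
    obtain ⟨i, hi, j, hj, hij⟩ := hncm
    have h6 := hnoncomm i hi j hj hij
    by_cases hnc1 : nc (orb (gen ρ B)) = 1
    · have := hBtr hnc1
      omega
    · have hnc2 : nc (orb (gen ρ B)) = 2 := by
        have : nc (orb (gen ρ B)) < 3 := by
          by_contra! h3
          nlinarith
        omega
      obtain ⟨x⟩ := hne
      have h7 := P.card_le_of_nc_eq_two hnc2 x
      have h8 := P.card_inter x
      have : Nonempty α := ⟨x⟩
      rw [hnc2, hA, nc_top, hm] at h8
      have h9 : (cls (orb (gen ρ A) ⊓ orb (gen ρ B)) x).card = 6 := by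
        rw [hA]
        omega
      rw [h9] at h7
      omega

/-- A transitive string family on `m ≥ 7` points that splits into two nonempty commuting parts
has at most `m - 4` members. -/
theorem StrFam.card_add_four_le_of_split (h : StrFam ρ pos (A ∪ B)) (hd : Disjoint A B)
    (hc : ∀ i ∈ A, ∀ j ∈ B, Commute (ρ i) (ρ j)) (hA : A.Nonempty) (hB : B.Nonempty)
    (htr : orb (gen ρ (A ∪ B)) = ⊤) (hm : 7 ≤ Fintype.card α) :
    A.card + B.card + 4 ≤ Fintype.card α := by
  have P : CommPair (gen ρ A) (gen ρ B) :=
    ⟨fun x hx y hy => commute_gen hc hx hy, by rw [← orb_sup, ← gen_union, htr]⟩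
  by_cases h1 : orb (gen ρ A) = ⊤
  · exact card_add_four_le_of_transitive P h hd h1 hB hm
  by_cases h2 : orb (gen ρ B) = ⊤
  · have := card_add_four_le_of_transitive P.symm (by rwa [Finset.union_comm]) hd.symm h2 hA hm
    omega
  exact card_add_four_le_of_intransitive P (h.mono Finset.subset_union_left)
    (h.mono Finset.subset_union_right) h1 h2 hm

end Central

section SmallSets

variable {α : Type*} {f g : Perm α} {Z : Finset α}

lemma exists_apply_eq_of_odd (hf : f * f = 1) (hZ : ∀ z ∈ Z, f z ∈ Z) (hodd : Odd Z.card) :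
    ∃ z ∈ Z, f z = z := by
  by_contra! hcon
  have h : ∑ z ∈ Z, (1 : ZMod 2) = 0 :=
    Finset.sum_involution (fun z _ => f z) (fun _ _ => by decide) (fun z hz _ => hcon z hz) hZ
      (fun z _ => by rw [← mul_apply, hf]; rfl)
  rw [Finset.sum_const, nsmul_one, ZMod.natCast_eq_zero_iff_even] at h
  exact Nat.not_even_iff_odd.2 hodd h

lemma mem_of_card_le {Y : Finset α} (hYZ : Y ⊆ Z) (hcard : Z.card ≤ Y.card) {y : α} (hy : y ∈ Z) :
    y ∈ Y := by
  rwa [Finset.eq_of_subset_of_card_le hYZ hcard]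

lemma apply_comm_of_card_le_two (hf : f * f = 1) (hg : g * g = 1) (hfZ : ∀ z ∈ Z, f z ∈ Z)
    (hgZ : ∀ z ∈ Z, g z ∈ Z) (hcard : Z.card ≤ 2) {z : α} (hz : z ∈ Z) : f (g z) = g (f z) := by
  have hff : ∀ y, f (f y) = y := fun y => by rw [← mul_apply, hf]; rfl
  have hgg : ∀ y, g (g y) = y := fun y => by rw [← mul_apply, hg]; rfl
  have key : ∀ u ∈ Z, ∀ v ∈ Z, ∀ w ∈ Z, u = v ∨ u = w ∨ v = w := by
    intro u hu v hv w hw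
    by_contra! hcon
    exact absurd (Finset.two_lt_card.2 ⟨u, hu, v, hv, w, hw, hcon.1, hcon.2.1, hcon.2.2⟩) (by omega)
  have h1 := key z hz (f z) (hfZ z hz) (g z) (hgZ z hz)
  have h2 := key z hz (f z) (hfZ z hz) (g (f z)) (hgZ _ (hfZ z hz))
  have h3 := key z hz (g z) (hgZ z hz) (f (g z)) (hfZ _ (hgZ z hz))
  grind

lemma apply_comm_of_card_eq_four (hf : f * f = 1) (hg : g * g = 1) (hfZ : ∀ z ∈ Z, f z ∈ Z)
    (hgZ : ∀ z ∈ Z, g z ∈ Z) (hf0 : ∀ z ∈ Z, f z ≠ z) (hg0 : ∀ z ∈ Z, g z ≠ z)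
    (hcard : Z.card = 4) {z : α} (hz : z ∈ Z) : f (g z) = g (f z) := by
  classical
  have hff : ∀ y, f (f y) = y := fun y => by rw [← mul_apply, hf]; rfl
  have hgg : ∀ y, g (g y) = y := fun y => by rw [← mul_apply, hg]; rfl
  have h1 := hf0 z hz
  have h2 := hg0 z hz
  have h3 := hf0 _ (hgZ z hz)
  have h4 := hg0 _ (hfZ z hz)
  by_cases h5 : f z = g z
  · grind
  have h6 : f (g z) ≠ z := by grind
  have h7 : f (g z) ≠ f z := by grind
  have h8 : g (f z) ≠ z := by grind
  have h9 : g (f z) ≠ g z := by grind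
  have hY : ({z, f z, g z, f (g z)} : Finset α) ⊆ Z := by
    intro y hy
    simp only [Finset.mem_insert, Finset.mem_singleton] at hy
    rcases hy with rfl | rfl | rfl | rfl
    exacts [hz, hfZ _ hz, hgZ _ hz, hfZ _ (hgZ _ hz)]
  have hYc : ({z, f z, g z, f (g z)} : Finset α).card = 4 := by
    rw [Finset.card_insert_of_notMem, Finset.card_insert_of_notMem, Finset.card_pair h3.symm]
    · simp [h5, h7.symm]
    · simp [h1.symm, h2.symm, h6.symm]
  have := mem_of_card_le hY (by omega) (hgZ _ (hfZ z hz))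
  simp only [Finset.mem_insert, Finset.mem_singleton] at this
  grind

lemma isThreeCycle_of_square [Fintype α] [DecidableEq α] (h : Perm α) (hne : h * h ≠ 1)
    (hZ : ∀ z, (h * h) z ≠ z → z ∈ Z) (hcard : Z.card ≤ 3) : (h * h).IsThreeCycle := by
  have hsub : (h * h).support ⊆ Z := fun z hz => hZ z (mem_support.1 hz)
  have h3 := (Finset.card_le_card hsub).trans hcard
  have h2 := two_le_card_support_of_ne_one hne
  rw [← card_support_eq_three_iff]
  by_contra hcon
  have hswap : (h * h).IsSwap := card_support_eq_two.1 (by omega)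
  have := hswap.sign_eq
  rw [Perm.sign_mul, Int.units_mul_self] at this
  exact absurd this (by decide)

end SmallSets

section Classes

variable {α : Type*} [Fintype α] {s : Setoid α} {Q : Subgroup (Perm α)} {d e : Perm α}

lemma nc_add_sum_le (T : Finset α) (hT : ∀ x ∈ T, ∀ y ∈ T, s x y → x = y) :
    nc s + ∑ x ∈ T, ((cls s x).card - 1) ≤ Fintype.card α := by
  classical
  have : Fintype (Quotient s) := Fintype.ofFinite _
  let c : Quotient s → ℕ := fun q => (Finset.univ.filter fun y => Quotient.mk s y = q).card
  have hc : ∀ x, c (Quotient.mk s x) = (cls s x).card := by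
    intro x
    change (Finset.univ.filter _).card = _
    congr 1
    ext y
    simp only [Finset.mem_filter, Finset.mem_univ, true_and, mem_cls]
    exact ⟨fun e => s.symm (Quotient.exact e), fun e => Quotient.sound (s.symm e)⟩
  have hc1 : ∀ q, 1 ≤ c q := by
    intro q
    induction q using Quotient.inductionOn with | h x
    rw [hc]
    exact Finset.card_pos.2 ⟨x, mem_cls.2 (s.refl x)⟩
  have h1 : Fintype.card α = ∑ q, c q := by
    rw [← Finset.card_univ]
    exact Finset.card_eq_sum_card_fiberwise (by simp)
  have h2 : ∑ q, c q = nc s + ∑ q, (c q - 1) := by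
    rw [nc, Nat.card_eq_fintype_card, ← Finset.card_univ, Finset.card_eq_sum_ones,
      ← Finset.sum_add_distrib]
    exact Finset.sum_congr rfl fun q _ => by have := hc1 q; omega
  have h3 : ∑ x ∈ T, ((cls s x).card - 1) = ∑ q ∈ T.image (Quotient.mk s), (c q - 1) := by
    rw [Finset.sum_image (fun x hx y hy e => hT x hx y hy (Quotient.exact e))]
    exact Finset.sum_congr rfl fun x _ => by rw [hc]
  rw [h1, h2, h3]
  exact Nat.add_le_add_left (Finset.sum_le_sum_of_subset (Finset.subset_univ _)) _

lemma nc_add_card_cls_le (x : α) : nc s + ((cls s x).card - 1) ≤ Fintype.card α := by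
  simpa using nc_add_sum_le (s := s) {x} (by simp)

lemma nc_add_card_cls_le₂ {x y : α} (hxy : ¬ s x y) :
    nc s + ((cls s x).card - 1) + ((cls s y).card - 1) ≤ Fintype.card α := by
  classical
  have hne : x ≠ y := by rintro rfl; exact hxy (s.refl x)
  have := nc_add_sum_le (s := s) {x, y} (by
    have hyx : ¬ s y x := fun e => hxy (s.symm e)
    simp [hxy, hyx])
  rw [Finset.sum_pair hne] at this
  omega

lemma nc_add_card_cls_le₃ {x y z : α} (hxy : ¬ s x y) (hxz : ¬ s x z) (hyz : ¬ s y z) :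
    nc s + ((cls s x).card - 1) + ((cls s y).card - 1) + ((cls s z).card - 1) ≤
      Fintype.card α := by
  classical
  have h1 : x ≠ y := by rintro rfl; exact hxy (s.refl x)
  have h2 : x ≠ z := by rintro rfl; exact hxz (s.refl x)
  have h3 : y ≠ z := by rintro rfl; exact hyz (s.refl y)
  have := nc_add_sum_le (s := s) {x, y, z} (by
    have hyx : ¬ s y x := fun e => hxy (s.symm e)
    have hzx : ¬ s z x := fun e => hxz (s.symm e)
    have hzy : ¬ s z y := fun e => hyz (s.symm e)
    simp [hxy, hyx, hxz, hzx, hyz, hzy])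
  rw [Finset.sum_insert (by simp [h1, h2]), Finset.sum_pair h3] at this
  omega

lemma eq_of_card_cls_le_one {x y : α} (h : (cls s x).card ≤ 1) (hxy : s x y) : y = x :=
  Finset.card_le_one.1 h y (mem_cls.2 hxy) x (mem_cls.2 (s.refl x))

/-- If joining `d` to `s` lowers the number of classes by at most one, then `d` moves at most two
classes. -/
lemma rel_of_nc_le {t : Setoid α} (hst : s ≤ t) (hd : ∀ x, t x (d x)) (hnc : nc s ≤ nc t + 1)
    {x y : α} (hx : ¬ s x (d x)) (hy : ¬ s y (d y)) (hdd : ∀ z, d (d z) = z)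
    (hinv : ∀ x y, s x y → s (d x) (d y)) : s x y ∨ s (d x) y := by
  classical
  by_contra! hcon
  let f : α → Quotient s := fun u => if s (d x) u then Quotient.mk s x else Quotient.mk s u
  have h1 : s < Setoid.ker f := by
    refine lt_of_le_of_ne (fun u v e => ?_) fun he => ?_
    · change f u = f v
      by_cases h : s (d x) u
      · have h' : s (d x) v := s.trans h e
        simp only [f, h, h', if_true]
      · have h' : ¬ s (d x) v := fun h' => h (s.trans h' (s.symm e))
        simp only [f, h, h', if_false]
        exact Quotient.sound e
    · refine hx ?_
      rw [he]
      change f x = f (d x)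
      have h' : ¬ s (d x) x := fun e => hx (s.symm e)
      simp [f]
  have h2 : Setoid.ker f < t := by
    refine lt_of_le_of_ne (fun u v e => ?_) fun he => ?_
    · change f u = f v at e
      have hxd : t x (d x) := hd x
      by_cases h : s (d x) u <;> by_cases h' : s (d x) v
      · exact hst (s.trans (s.symm h) h')
      · simp only [f, h, h', if_true, if_false] at e
        exact t.trans (hst (s.symm h)) (t.trans (t.symm hxd) (hst (Quotient.exact e)))
      · simp only [f, h, h', if_true, if_false] at e
        exact t.trans (hst (Quotient.exact e)) (t.trans hxd (hst h'))
      · simp only [f, h, h', if_false] at e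
        exact hst (Quotient.exact e)
    · have : (Setoid.ker f) y (d y) := by rw [he]; exact hd y
      change f y = f (d y) at this
      have h' : ¬ s (d x) (d y) := by
        intro e
        have := hinv _ _ e
        rw [hdd, hdd] at this
        exact hcon.1 this
      simp only [f, hcon.2, h', if_false] at this
      exact hy (Quotient.exact this)
  have := nc_lt h1
  have := nc_lt h2
  omega

end Classes

section Primitivity

open scoped Pointwise

section Primitive

variable {ι α : Type*} [Fintype α] [DecidableEq ι] {ρ : ι → Perm α} {J : Finset ι}

lemma nc_orb_le_card_cls {K : Subgroup (Perm α)} {b : Setoid α} (hK : b ⊔ orb K = ⊤)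
    (hb : Inv K b) (x : α) : nc (orb K) ≤ (cls b x).card := by
  classical
  have hsurj : Function.Surjective
      (fun z : cls b x => (Quotient.mk (orb K) (z : α))) := by
    intro q
    induction q using Quotient.inductionOn with | h y
    obtain ⟨h, hh, e⟩ := (sup_orb_rel hb).1 (eq_top_iff_rel.1 hK y x)
    exact ⟨⟨h y, mem_cls.2 (b.symm e)⟩, Quotient.sound ((orb K).symm ⟨h, hh, rfl⟩)⟩
  have := Nat.card_le_card_of_surjective _ hsurj
  rwa [Nat.card_eq_fintype_card (α := cls b x), Fintype.card_coe] at this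

/-- A large minimal transitive family preserves no nontrivial equivalence relation. -/
lemma MinTrans.eq_bot_or_eq_top (h : MinTrans ρ ⊥ J) (hm : 7 ≤ Fintype.card α)
    (hJ : Fintype.card α ≤ J.card + 3) {b : Setoid α} (hb : Inv (gen ρ J) b) :
    b = ⊥ ∨ b = ⊤ := by
  have htr : orb (gen ρ J) = ⊤ := by simpa using h.1
  by_contra! hcon
  have : Nonempty α := Fintype.card_pos_iff.1 (by omega)
  obtain ⟨x⟩ := this
  have : Nonempty α := ⟨x⟩
  obtain ⟨J₀, hJ₀, hmin⟩ := exists_minTrans (ρ := ρ) (b := b) (S := J) (by rw [htr]; simp)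
  have h1 := hmin.card_lt
  have h2 := nc_orb_le_card_cls hmin.1 (hb.mono (gen_mono hJ₀)) x
  have h3 := h.nc_sup_add_card_le subset_rfl hJ₀
  rw [h.1, nc_top, bot_sup_eq] at h3
  have h4 := card_cls_mul_nc htr hb x
  have h5 : nc b ≠ 1 := fun e => hcon.2 (nc_eq_one.1 e)
  have h6 : (cls b x).card ≠ 1 := by
    intro e
    rw [e, one_mul] at h4
    exact hcon.1 (eq_of_le_of_nc_le bot_le (by rw [nc_bot, Nat.card_eq_fintype_card, h4])).symm
  have h7 : 0 < nc b := nc_pos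
  have h8 : 0 < (cls b x).card := Finset.card_pos.2 ⟨x, mem_cls.2 (b.refl x)⟩
  obtain ⟨k, hk⟩ : ∃ k, (cls b x).card = k + 2 := ⟨(cls b x).card - 2, by omega⟩
  obtain ⟨s, hs⟩ : ∃ s, nc b = s + 2 := ⟨nc b - 2, by omega⟩
  rw [hk, hs] at h4
  rw [hk] at h2
  rw [hs] at h1
  nlinarith

lemma MinTrans.isPreprimitive (h : MinTrans ρ ⊥ J) (hm : 7 ≤ Fintype.card α)
    (hJ : Fintype.card α ≤ J.card + 3) : MulAction.IsPreprimitive (gen ρ J) α := by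
  have htr : orb (gen ρ J) = ⊤ := by simpa using h.1
  have hpre : MulAction.IsPretransitive (gen ρ J) α := by
    refine ⟨fun x y => ?_⟩
    obtain ⟨g, hg, e⟩ := eq_top_iff_rel.1 htr x y
    exact ⟨⟨g, hg⟩, e⟩
  refine { hpre with isTrivialBlock_of_isBlock := fun {B} hB => ?_ }
  by_cases hne : B.Subsingleton
  · exact Or.inl hne
  right
  let b : Setoid α :=
    { r := fun x y => ∀ g : gen ρ J, x ∈ g • B ↔ y ∈ g • B
      iseqv := ⟨fun _ _ => Iff.rfl, fun h g => (h g).symm, fun h h' g => (h g).trans (h' g)⟩ }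
  have hinv : Inv (gen ρ J) b := by
    intro k hk x y e g
    have := e ((⟨k, hk⟩ : gen ρ J)⁻¹ * g)
    rw [mul_smul, Set.mem_inv_smul_set_iff, Set.mem_inv_smul_set_iff] at this
    exact this
  have hrel : ∀ x ∈ B, ∀ y ∈ B, b x y := by
    intro x hx y hy g
    have aux : ∀ x ∈ B, x ∈ g • B → g • B = B := by
      intro x hx hxg
      by_contra hc
      have := hB (g₁ := g) (g₂ := 1) (by simpa using hc)
      rw [one_smul] at this
      exact Set.disjoint_left.1 this hxg hx
    constructor
    · intro hg; rw [aux x hx hg]; exact hy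
    · intro hg; rw [aux y hy hg]; exact hx
  rcases h.eq_bot_or_eq_top hm hJ hinv with e | e
  · exact absurd (fun x hx y hy => by have := hrel x hx y hy; rwa [e] at this) hne
  · rw [Set.not_subsingleton_iff] at hne
    obtain ⟨x, hx⟩ := hne.nonempty
    refine Set.eq_univ_of_forall fun y => ?_
    have := eq_top_iff_rel.1 e x y 1
    rw [one_smul] at this
    exact this.1 hx

/-- A large minimal transitive family does not split into two commuting parts. -/
lemma MinTrans.exists_not_commute (h : MinTrans ρ ⊥ J) (hm : 7 ≤ Fintype.card α)
    (hJ : Fintype.card α ≤ J.card + 3) {A : Finset ι} (hA : A ⊆ J) (hne : A.Nonempty)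
    (hAJ : A ≠ J) : ∃ i ∈ A, ∃ j ∈ J \ A, ¬ Commute (ρ i) (ρ j) := by
  by_contra! hcon
  have hle : gen ρ J ≤ gen ρ A ⊔ gen ρ (J \ A) := by
    rw [← gen_union, Finset.union_sdiff_of_subset hA]
  have hinv : Inv (gen ρ J) (orb (gen ρ A)) := by
    refine (inv_orb_self.sup (inv_orb_of_commute fun g hg k hk => ?_)).mono hle
    exact (commute_gen hcon hk hg).symm
  rcases h.eq_bot_or_eq_top hm hJ hinv with e | e
  · obtain ⟨i, hi⟩ := hne
    have := h.lt_insert (Finset.empty_subset J) (hA hi) (Finset.notMem_empty i)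
    have h2 : orb (gen ρ (insert i ∅)) ≤ orb (gen ρ A) := orb_mono (gen_mono (by simpa using hi))
    rw [e] at h2
    rw [bot_sup_eq, bot_sup_eq, gen_empty, orb_bot] at this
    exact absurd (this.trans_le h2) (lt_irrefl _)
  · obtain ⟨i, hi, hiA⟩ := Finset.exists_of_ssubset (hA.ssubset_of_ne hAJ)
    have := h.lt_insert hA hi hiA
    rw [bot_sup_eq, bot_sup_eq, e] at this
    exact not_top_lt this

end Primitive

end Primitivity

section Step

variable {α : Type*} [Fintype α] [DecidableEq α] {Q : Subgroup (Perm α)} {a b d e : Perm α}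

/-- An involution `d` centralizing `Q`, moving at least four points and some orbit of `Q`, such that
joining `d` to `Q` leaves many orbits. -/
structure Far (Q : Subgroup (Perm α)) (d : Perm α) : Prop where
  invol : ∀ z, d (d z) = z
  comm : ∀ q ∈ Q, Commute d q
  four_le : 4 ≤ d.support.card
  move : ∃ z, ¬ orb Q z (d z)
  card_le : ∃ t, orb Q ≤ t ∧ (∀ x, t x (d x)) ∧ Fintype.card α ≤ nc t + 5

lemma Far.fix (h : Far Q d) {x y : α} (hxy : orb Q x y) (hx : d x = x) : d y = y := by
  obtain ⟨q, hq, rfl⟩ := hxy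
  rw [← mul_apply, (h.comm q hq).eq, mul_apply, hx]

lemma Far.inv (h : Far Q d) {x y : α} (hxy : orb Q x y) : orb Q (d x) (d y) := by
  obtain ⟨q, hq, rfl⟩ := hxy
  exact ⟨q, hq, by rw [← mul_apply, ← mul_apply, (h.comm q hq).eq]⟩

lemma Far.inv_iff (h : Far Q d) {x y : α} : orb Q (d x) (d y) ↔ orb Q x y :=
  ⟨fun e => by simpa [h.invol] using h.inv e, h.inv⟩

lemma Far.rel (h : Far Q d) (hnc : nc (orb Q) + 4 ≤ Fintype.card α) {x y : α}
    (hx : ¬ orb Q x (d x)) (hy : ¬ orb Q y (d y)) : orb Q x y ∨ orb Q (d x) y := by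
  obtain ⟨t, h1, h2, h3⟩ := h.card_le
  exact rel_of_nc_le h1 h2 (by omega) hx hy h.invol fun _ _ => h.inv

lemma Far.card_cls (h : Far Q d) (x : α) : (cls (orb Q) (d x)).card = (cls (orb Q) x).card := by
  refine (Finset.card_bij (fun z _ => d z) (fun z hz => ?_) (fun z _ w _ e => d.injective e)
    fun z hz => ⟨d z, ?_, h.invol z⟩).symm
  · exact mem_cls.2 (h.inv (mem_cls.1 hz))
  · have := h.inv (mem_cls.1 hz)
    rw [h.invol] at this
    exact mem_cls.2 this

lemma Far.mul_self (h : Far Q d) : d * d = 1 := by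
  ext z
  simp [h.invol]

/-- If the orbit of `x` has odd size and is preserved by `d`, it is fixed pointwise by `d`. -/
lemma Far.fix_of_odd (h : Far Q d) {x : α} (hx : orb Q x (d x))
    (hodd : Odd (cls (orb Q) x).card) {y : α} (hy : orb Q x y) : d y = y := by
  obtain ⟨z, hz, e⟩ := exists_apply_eq_of_odd h.mul_self (Z := cls (orb Q) x)
    (fun z hz => mem_cls.2 ((orb Q).trans hx (h.inv (mem_cls.1 hz)))) hodd
  exact h.fix ((orb Q).trans ((orb Q).symm (mem_cls.1 hz)) hy) e

/-- Some point moved by `d` lies in a `Q`-orbit that is not a singleton. -/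
lemma Far.exists_apply_ne (h : Far Q d) (hnc : nc (orb Q) + 4 ≤ Fintype.card α) :
    ∃ z, d z ≠ z ∧ 2 ≤ (cls (orb Q) z).card := by
  by_contra! hcon
  have hsing : ∀ z y, d z ≠ z → orb Q z y → y = z := fun z y hz hy =>
    eq_of_card_cls_le_one (by have := hcon z hz; omega) hy
  obtain ⟨u, hu⟩ := h.move
  have hsub : d.support ⊆ {u, d u} := by
    intro z hz
    rw [mem_support] at hz
    have hz' : ¬ orb Q z (d z) := fun e => hz (hsing z _ hz e)
    rcases h.rel hnc hz' hu with e | e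
    · simp [hsing _ _ hz e]
    · have hz2 : d (d z) ≠ d z := by rw [h.invol]; exact hz.symm
      rw [hsing _ _ hz2 e, h.invol]
      simp
  have := Finset.card_le_card hsub
  have := h.four_le
  have : ({u, d u} : Finset α).card ≤ 2 := Finset.card_le_two
  omega

/-- The orbit of a point at which the involutions `a` and `b` do not commute has at
least three elements. -/
lemma three_le_card_cls (ha : a * a = 1) (hb : b * b = 1) (haQ : a ∈ Q) (hbQ : b ∈ Q) {x : α}
    (hx : a (b x) ≠ b (a x)) : 3 ≤ (cls (orb Q) x).card := by
  by_contra hcon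
  exact hx (apply_comm_of_card_le_two ha hb (cls_orb_invariant x a haQ)
    (cls_orb_invariant x b hbQ) (by omega) (mem_cls.2 ((orb Q).refl x)))

lemma commute_of_mul_self_mul (ha : a * a = 1) (hb : b * b = 1) (h : (a * b) * (a * b) = 1) :
    Commute a b := by
  have : a * b = (a * b)⁻¹ := eq_inv_of_mul_eq_one_left h
  rw [mul_inv_rev, inv_eq_of_mul_eq_one_left ha, inv_eq_of_mul_eq_one_left hb] at this
  exact this

lemma isThreeCycle_of_not_commute (ha : a * a = 1) (hb : b * b = 1) (hab : ¬ Commute a b)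
    {Z : Finset α} (hZ : ∀ z ∉ Z, a (b z) = b (a z)) (hcard : Z.card ≤ 3) :
    ((a * b) * (a * b)).IsThreeCycle := by
  refine isThreeCycle_of_square _ (fun e => hab (commute_of_mul_self_mul ha hb e)) (Z := Z)
    (fun z hz => ?_) hcard
  by_contra hcon
  refine hz ?_
  simp only [mul_apply]
  rw [hZ z hcon, ← mul_apply b b, hb, one_apply, ← mul_apply a a, ha, one_apply]

lemma two_le_card_cls {s : Setoid α} {x y : α} (h : s x y) (hne : y ≠ x) :
    2 ≤ (cls s x).card := by
  by_contra hcon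
  exact hne (eq_of_card_cls_le_one (by omega) h)

/-- The case of two orbits of size three. -/
lemma Far.of_two_orbits (hd : Far Q d) (haa : a * a = 1) (haQ : a ∈ Q)
    (hnc : Fintype.card α ≤ nc (orb Q) + 4) {x y : α} (hxy : ¬ orb Q x y)
    (hx : (cls (orb Q) x).card = 3) (hy : 3 ≤ (cls (orb Q) y).card) :
    a.support.card ≤ 4 ∧ 6 ≤ d.support.card ∧
      ∀ e, Far Q e → ∀ z, (orb Q ⊔ orb (zpowers d)) z (e z) := by
  have h2 := nc_add_card_cls_le₂ hxy
  have hy3 : (cls (orb Q) y).card = 3 := by omega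
  have hyx : ¬ orb Q y x := fun e => hxy ((orb Q).symm e)
  have hlarge : ∀ z, 2 ≤ (cls (orb Q) z).card → orb Q x z ∨ orb Q y z := by
    intro z hz
    by_contra! hcon
    have := nc_add_card_cls_le₃ hxy hcon.1 hcon.2
    omega
  have hmap : ∀ e, Far Q e → orb Q y (e x) := by
    intro e he
    obtain ⟨z, hz, hz2⟩ := he.exists_apply_ne (by omega)
    rcases hlarge z hz2 with h | h
    · have hne : ¬ orb Q x (e x) := fun h' => hz (he.fix_of_odd h' (by rw [hx]; decide) h)
      exact (hlarge (e x) (by rw [he.card_cls]; omega)).resolve_left hne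
    · have hne : ¬ orb Q y (e y) := fun h' => hz (he.fix_of_odd h' (by rw [hy3]; decide) h)
      have := (hlarge (e y) (by rw [he.card_cls]; omega)).resolve_right hne
      have := he.inv this
      rw [he.invol] at this
      exact (orb Q).symm this
  refine ⟨?_, ?_, fun e he z => ?_⟩
  · obtain ⟨p, hp, hpe⟩ := exists_apply_eq_of_odd haa (cls_orb_invariant x a haQ)
      (by rw [hx]; decide)
    obtain ⟨p', hp', hpe'⟩ := exists_apply_eq_of_odd haa (cls_orb_invariant y a haQ)
      (by rw [hy3]; decide)
    have hsub : a.support ⊆ (cls (orb Q) x).erase p ∪ (cls (orb Q) y).erase p' := by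
      intro z hz
      rw [mem_support] at hz
      have h1 : z ≠ p := by rintro rfl; exact hz hpe
      have h1' : z ≠ p' := by rintro rfl; exact hz hpe'
      rw [Finset.mem_union, Finset.mem_erase, Finset.mem_erase, mem_cls, mem_cls]
      exact (hlarge z (two_le_card_cls ⟨a, haQ, rfl⟩ hz)).imp (fun e => ⟨h1, e⟩)
        fun e => ⟨h1', e⟩
    have := (Finset.card_le_card hsub).trans (Finset.card_union_le _ _)
    rw [Finset.card_erase_of_mem hp, Finset.card_erase_of_mem hp'] at this
    omega
  · have hsub : cls (orb Q) x ∪ cls (orb Q) y ⊆ d.support := by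
      intro z hz
      rw [mem_support]
      intro hzz
      have h1 := hmap d hd
      rw [Finset.mem_union, mem_cls, mem_cls] at hz
      rcases hz with hz | hz
      · have := hd.inv hz
        rw [hzz] at this
        exact hyx ((orb Q).trans h1 ((orb Q).trans this ((orb Q).symm hz)))
      · have h3 := hd.inv ((orb Q).trans ((orb Q).symm h1) hz)
        rw [hd.invol, hzz] at h3
        exact hxy ((orb Q).trans h3 ((orb Q).symm hz))
    have hdisj : Disjoint (cls (orb Q) x) (cls (orb Q) y) := by
      rw [Finset.disjoint_left]
      intro z hz hz'
      exact hxy ((orb Q).trans (mem_cls.1 hz) ((orb Q).symm (mem_cls.1 hz')))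
    have := Finset.card_le_card hsub
    rw [Finset.card_union_of_disjoint hdisj] at this
    omega
  · set t := orb Q ⊔ orb (zpowers d)
    have hst : orb Q ≤ t := le_sup_left
    have hdt : ∀ z, t z (d z) := fun z =>
      (le_sup_right : orb (zpowers d) ≤ t) ⟨d, mem_zpowers d, rfl⟩
    have htxy : t x y := t.trans (hdt x) (hst ((orb Q).symm (hmap d hd)))
    by_cases hz : orb Q z (e z)
    · exact hst hz
    have hxe : ¬ orb Q x (e x) := fun h' => hxy ((orb Q).trans h' ((orb Q).symm (hmap e he)))
    have hall : ∀ w, ¬ orb Q w (e w) → t x w := by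
      intro w hw
      rcases he.rel (by omega) hxe hw with h | h
      · exact hst h
      · exact t.trans htxy (hst ((orb Q).trans (hmap e he) h))
    refine t.trans (t.symm (hall z hz)) (hall _ ?_)
    rw [he.inv_iff]
    exact hz

lemma Far.apply_comm_of_card_eq_four (hd : Far Q d) (he : Far Q e) {x : α}
    (hx : (cls (orb Q) x).card = 4) (hdx : orb Q x (d x)) (hex : orb Q x (e x)) {z : α}
    (hz : orb Q x z) : d (e z) = e (d z) := by
  have hmem : ∀ {f}, Far Q f → orb Q x (f x) → ∀ z ∈ cls (orb Q) x, f z ∈ cls (orb Q) x :=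
    fun hf hfx z hz => mem_cls.2 ((orb Q).trans hfx (hf.inv (mem_cls.1 hz)))
  have hfix : ∀ {f}, Far Q f → (∃ w ∈ cls (orb Q) x, f w = w) → ∀ z ∈ cls (orb Q) x, f z = z :=
    fun hf ⟨w, hw, hww⟩ z hz =>
      hf.fix ((orb Q).trans ((orb Q).symm (mem_cls.1 hw)) (mem_cls.1 hz)) hww
  have hz' := mem_cls.2 hz
  by_cases h1 : ∃ w ∈ cls (orb Q) x, d w = w
  · rw [hfix hd h1 z hz', hfix hd h1 _ (hmem he hex z hz')]
  by_cases h2 : ∃ w ∈ cls (orb Q) x, e w = w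
  · rw [hfix he h2 z hz', hfix he h2 _ (hmem hd hdx z hz')]
  push Not at h1 h2
  exact StringFamily.apply_comm_of_card_eq_four hd.mul_self he.mul_self (hmem hd hdx)
    (hmem he hex) h1 h2 hx hz'

/-- The case of an orbit of size four and an orbit of size two. -/
lemma Far.of_orbits_four_two (hd : Far Q d) (hnc : Fintype.card α ≤ nc (orb Q) + 4) {x p : α}
    (hxp : ¬ orb Q x p) (hx : (cls (orb Q) x).card = 4) (hp : 2 ≤ (cls (orb Q) p).card) :
    8 ≤ Fintype.card α ∧
      ∀ e, Far Q e → ¬ Commute d e → ((d * e) * (d * e)).IsThreeCycle := by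
  have h2 := nc_add_card_cls_le₂ hxp
  have hp2 : (cls (orb Q) p).card = 2 := by omega
  have hsmall : ∀ z, ¬ orb Q x z → ¬ orb Q p z → (cls (orb Q) z).card ≤ 1 := by
    intro z hz hz'
    have := nc_add_card_cls_le₃ hxp hz hz'
    omega
  have hpx : ¬ orb Q p x := fun e => hxp ((orb Q).symm e)
  have hfx : ∀ {f}, Far Q f → orb Q x (f x) := by
    intro f hf
    by_contra hcon
    have := nc_add_card_cls_le₂ hcon
    rw [hf.card_cls] at this
    omega
  have hfp : ∀ {f}, Far Q f → orb Q p (f p) := by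
    intro f hf
    by_contra hcon
    have h3 : ¬ orb Q x (f p) := by
      intro h3
      have := hf.inv h3
      rw [hf.invol] at this
      exact hxp ((orb Q).trans (hfx hf) this)
    have := hsmall _ h3 hcon
    rw [hf.card_cls] at this
    omega
  have hmove : ∀ {f}, Far Q f → ∀ u, ¬ orb Q u (f u) → ¬ orb Q x u ∧ ¬ orb Q p u := by
    intro f hf u hu
    constructor
    · intro h
      exact hu ((orb Q).trans ((orb Q).symm h) ((orb Q).trans (hfx hf) (hf.inv h)))
    · intro h
      exact hu ((orb Q).trans ((orb Q).symm h) ((orb Q).trans (hfp hf) (hf.inv h)))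
  have hfmove : ∀ {f}, Far Q f → ∀ u, ¬ orb Q u (f u) → ¬ orb Q (f u) (f (f u)) :=
    fun hf u hu => by rwa [hf.inv_iff]
  have hfix : ∀ {f}, Far Q f → ∀ u, ¬ orb Q u (f u) → ∀ z, ¬ orb Q x z → ¬ orb Q p z →
      z ≠ u → z ≠ f u → f z = z := by
    intro f hf u hu z hz hz' h1 h2
    have hs := hsmall z hz hz'
    by_contra hcon
    rcases hf.rel (by omega) hu (fun h => hcon (eq_of_card_cls_le_one hs h)) with h | h
    · exact h1 (eq_of_card_cls_le_one hs ((orb Q).symm h)).symm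
    · exact h2 (eq_of_card_cls_le_one hs ((orb Q).symm h)).symm
  obtain ⟨u, hu⟩ := hd.move
  have hune : d u ≠ u := fun h => hu (by rw [h])
  constructor
  · have hdisj : Disjoint (cls (orb Q) x) (cls (orb Q) p) := by
      rw [Finset.disjoint_left]
      intro z hz hz'
      exact hxp ((orb Q).trans (mem_cls.1 hz) ((orb Q).symm (mem_cls.1 hz')))
    have hdisj' : Disjoint (cls (orb Q) x ∪ cls (orb Q) p) {u, d u} := by
      rw [Finset.disjoint_right]
      intro z hz
      rw [Finset.mem_union, mem_cls, mem_cls, not_or]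
      rw [Finset.mem_insert, Finset.mem_singleton] at hz
      rcases hz with rfl | rfl
      exacts [hmove hd _ hu, hmove hd _ (hfmove hd _ hu)]
    have := Finset.card_le_univ ((cls (orb Q) x ∪ cls (orb Q) p) ∪ {u, d u})
    rw [Finset.card_union_of_disjoint hdisj', Finset.card_union_of_disjoint hdisj,
      Finset.card_pair hune.symm] at this
    omega
  intro e he hde
  obtain ⟨v, hv⟩ := he.move
  have hu' := hmove hd _ hu
  have hdu' := hmove hd _ (hfmove hd _ hu)
  have hv' := hmove he _ hv
  have hev' := hmove he _ (hfmove he _ hv)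
  have hout : ∀ z, z ≠ u → z ≠ d u → z ≠ v → z ≠ e v → d (e z) = e (d z) := by
    intro z z1 z2 z3 z4
    by_cases hzx : orb Q x z
    · exact hd.apply_comm_of_card_eq_four he hx (hfx hd) (hfx he) hzx
    by_cases hzp : orb Q p z
    · exact apply_comm_of_card_le_two hd.mul_self he.mul_self (Z := cls (orb Q) p)
        (fun z hz => mem_cls.2 ((orb Q).trans (hfp hd) (hd.inv (mem_cls.1 hz))))
        (fun z hz => mem_cls.2 ((orb Q).trans (hfp he) (he.inv (mem_cls.1 hz)))) hp2.le
        (mem_cls.2 hzp)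
    · have h3 := hfix hd u hu z hzx hzp z1 z2
      have h4 := hfix he v hv z hzx hzp z3 z4
      rw [h3, h4, h3]
  have hcard : ∀ w : α, ({u, d u, w} : Finset α).card ≤ 3 := fun w => Finset.card_le_three
  have key : ∀ w : α, (∀ z, z ≠ u → z ≠ d u → z ≠ w → d (e z) = e (d z)) →
      ((d * e) * (d * e)).IsThreeCycle := by
    intro w hw
    refine isThreeCycle_of_not_commute hd.mul_self he.mul_self hde (fun z hz => ?_) (hcard w)
    simp only [Finset.mem_insert, Finset.mem_singleton, not_or] at hz
    exact hw z hz.1 hz.2.1 hz.2.2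
  by_cases c1 : v = u ∨ v = d u
  · exact key (e v) fun z h1 h2 h3 => hout z h1 h2 (by rcases c1 with rfl | rfl <;> assumption) h3
  by_cases c2 : e v = u ∨ e v = d u
  · exact key v fun z h1 h2 h3 => hout z h1 h2 h3 (by rcases c2 with h | h <;> rwa [h])
  push Not at c1 c2
  refine absurd ?_ hde
  ext z
  simp only [mul_apply]
  by_cases z1 : z = u
  · subst z1
    rw [hfix he v hv _ hu'.1 hu'.2 c1.1.symm c2.1.symm,
      hfix he v hv _ hdu'.1 hdu'.2 c1.2.symm c2.2.symm]
  by_cases z2 : z = d u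
  · subst z2
    rw [hd.invol, hfix he v hv _ hu'.1 hu'.2 c1.1.symm c2.1.symm,
      hfix he v hv _ hdu'.1 hdu'.2 c1.2.symm c2.2.symm, hd.invol]
  by_cases z3 : z = v
  · subst z3
    rw [hfix hd u hu _ hv'.1 hv'.2 c1.1 c1.2, hfix hd u hu _ hev'.1 hev'.2 c2.1 c2.2]
  by_cases z4 : z = e v
  · subst z4
    rw [he.invol, hfix hd u hu _ hv'.1 hv'.2 c1.1 c1.2, hfix hd u hu _ hev'.1 hev'.2 c2.1 c2.2,
      he.invol]
  exact hout z z1 z2 z3 z4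

/-- Two noncommuting involutions with few orbits, together with involutions centralizing them,
either produce a three-cycle or are tightly constrained. -/
theorem Far.trichotomy (hd : Far Q d) (haa : a * a = 1) (hbb : b * b = 1) (haQ : a ∈ Q)
    (hbQ : b ∈ Q) (hab : ¬ Commute a b) (ha4 : 4 ≤ a.support.card) (hb4 : 4 ≤ b.support.card)
    (hnc : Fintype.card α ≤ nc (orb Q) + 4) :
    (∃ g ∈ Q, g.IsThreeCycle) ∨
    (a.support.card ≤ 4 ∧ 6 ≤ d.support.card ∧
      ∀ e, Far Q e → ∀ z, (orb Q ⊔ orb (zpowers d)) z (e z)) ∨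
    (8 ≤ Fintype.card α ∧
      ∀ e, Far Q e → ¬ Commute d e → ((d * e) * (d * e)).IsThreeCycle) := by
  obtain ⟨x, hx⟩ : ∃ x, a (b x) ≠ b (a x) := by
    by_contra! hcon
    exact hab (Equiv.ext hcon)
  have h3 := three_le_card_cls haa hbb haQ hbQ hx
  have h1 := nc_add_card_cls_le (s := orb Q) x
  have hsupp : ∀ f ∈ Q, ∀ z, f z ≠ z → 2 ≤ (cls (orb Q) z).card := fun f hf z hz =>
    two_le_card_cls ⟨f, hf, rfl⟩ hz
  rcases (by omega : (cls (orb Q) x).card = 3 ∨ (cls (orb Q) x).card = 4 ∨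
    (cls (orb Q) x).card = 5) with hO | hO | hO
  · by_cases hy : ∃ y, ¬ orb Q x y ∧ 3 ≤ (cls (orb Q) y).card
    · obtain ⟨y, hxy, hy⟩ := hy
      exact Or.inr (Or.inl (hd.of_two_orbits haa haQ hnc hxy hO hy))
    · push Not at hy
      refine Or.inl ⟨_, mul_mem (mul_mem haQ hbQ) (mul_mem haQ hbQ),
        isThreeCycle_of_not_commute haa hbb hab (Z := cls (orb Q) x) (fun z hz => ?_) hO.le⟩
      rw [mem_cls] at hz
      by_contra hcon
      exact (hy z hz).not_ge (three_le_card_cls haa hbb haQ hbQ hcon)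
  · by_cases hp : ∃ p, ¬ orb Q x p ∧ 2 ≤ (cls (orb Q) p).card
    · obtain ⟨p, hxp, hp⟩ := hp
      exact Or.inr (Or.inr (hd.of_orbits_four_two hnc hxp hO hp))
    · push Not at hp
      have hfpf : ∀ f ∈ Q, 4 ≤ f.support.card → ∀ z ∈ cls (orb Q) x, f z ≠ z := by
        intro f hf hf4 z hz
        refine mem_support.1 (mem_of_card_le (Y := f.support) (fun w hw => ?_) (by omega) hz)
        rw [mem_support] at hw
        by_contra hcon
        rw [mem_cls] at hcon
        have := hp w hcon
        have := hsupp f hf w hw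
        omega
      exact absurd (StringFamily.apply_comm_of_card_eq_four haa hbb (cls_orb_invariant x a haQ)
        (cls_orb_invariant x b hbQ) (hfpf a haQ ha4) (hfpf b hbQ hb4) hO
        (mem_cls.2 ((orb Q).refl x))) hx
  · obtain ⟨z, hz, hz2⟩ := hd.exists_apply_ne (by omega)
    have hxd : orb Q x (d x) := by
      by_contra hcon
      have := nc_add_card_cls_le₂ hcon
      rw [hd.card_cls] at this
      omega
    have hxz : orb Q x z := by
      by_contra hcon
      have := nc_add_card_cls_le₂ hcon
      omega
    exact absurd (hd.fix_of_odd hxd (by rw [hO]; decide) hxz) hz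

end Step

section Large

variable {ι α : Type*} [Fintype α] [DecidableEq α] [DecidableEq ι] {ρ : ι → Perm α}
  {pos : ι → ℤ} {J : Finset ι}

lemma StrFam.exists_lt (h : StrFam ρ pos J) {S : Finset ι} (hS : S ⊆ J) (hne : S.Nonempty) :
    ∃ j ∈ S, ∀ i ∈ S, i ≠ j → pos j < pos i := by
  obtain ⟨j, hj, hmin⟩ := S.exists_min_image pos hne
  exact ⟨j, hj, fun i hi hij => lt_of_le_of_ne (hmin i hi) fun e =>
    hij (h.inj _ (hS hj) _ (hS hi) e).symm⟩

lemma StrFam.four_le_card_support (h : StrFam ρ pos J) {j : ι} (hj : j ∈ J)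
    (hns : ¬ (ρ j).IsSwap) : 4 ≤ (ρ j).support.card := by
  have h1 := two_le_card_support_of_ne_one (h.indep.ne_one hj)
  have h2 : (ρ j).support.card ≠ 2 := fun e => hns (card_support_eq_two.1 e)
  have h3 : ¬ Odd (ρ j).support.card := by
    intro hodd
    obtain ⟨z, hz, e⟩ := exists_apply_eq_of_odd (h.invol j hj)
      (fun z hz => apply_mem_support.2 hz) hodd
    exact mem_support.1 hz e
  rw [Nat.not_odd_iff_even, Nat.even_iff] at h3
  omega

lemma MinTrans.card_le_nc (h : MinTrans ρ ⊥ J) (hm : 0 < Fintype.card α)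
    (hJ : Fintype.card α ≤ J.card + 3) {S : Finset ι} (hS : S ⊆ J) :
    Fintype.card α ≤ nc (orb (gen ρ S)) + S.card + 2 := by
  have : Nonempty α := Fintype.card_pos_iff.1 hm
  have h1 := h.nc_sup_add_card_le subset_rfl hS
  rw [h.1, nc_top, bot_sup_eq] at h1
  omega

lemma MinTrans.exists_not_rel (h : MinTrans ρ ⊥ J) {S : Finset ι} (hS : S ⊆ J) {i : ι}
    (hi : i ∈ J) (hiS : i ∉ S) : ∃ z, ¬ orb (gen ρ S) z (ρ i z) := by
  by_contra! hcon
  have := h.lt_insert hS hi hiS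
  rw [bot_sup_eq, bot_sup_eq] at this
  refine this.not_ge (orb_gen_le.2 fun j hj x => ?_)
  rcases Finset.mem_insert.1 hj with rfl | hj
  · exact hcon x
  · exact ⟨ρ j, mem_gen hj, rfl⟩

lemma StrFam.far (h : StrFam ρ pos J) (hmin : MinTrans ρ ⊥ J) (hm : 7 ≤ Fintype.card α)
    (hJ : Fintype.card α ≤ J.card + 3) {i j k : ι} (hi : i ∈ J) (hj : j ∈ J) (hk : k ∈ J)
    (hki : 2 ≤ |pos k - pos i|) (hkj : 2 ≤ |pos k - pos j|) (hns : ¬ (ρ k).IsSwap) :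
    Far (gen ρ {i, j}) (ρ k) := by
  have hki' : k ≠ i := by rintro rfl; simp at hki
  have hkj' : k ≠ j := by rintro rfl; simp at hkj
  have hkS : k ∉ ({i, j} : Finset ι) := by simp [hki', hkj']
  have hS : ({i, j} : Finset ι) ⊆ J := by
    intro l hl
    rcases Finset.mem_insert.1 hl with rfl | hl
    · exact hi
    · rwa [Finset.mem_singleton.1 hl]
  refine ⟨fun z => ?_, fun q hq => ?_, h.four_le_card_support hk hns,
    hmin.exists_not_rel hS hk hkS, orb (gen ρ (insert k {i, j})),
    orb_mono (gen_mono (Finset.subset_insert _ _)),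
    fun x => ⟨ρ k, mem_gen (Finset.mem_insert_self _ _), rfl⟩, ?_⟩
  · rw [← mul_apply, h.invol k hk, one_apply]
  · refine (commute_of_mem_gen (fun l hl => ?_) hq).symm
    rcases Finset.mem_insert.1 hl with rfl | hl
    · exact (h.comm k hk _ hi hki).symm
    · rw [Finset.mem_singleton.1 hl]
      exact (h.comm k hk _ hj hkj).symm
  · have h1 := hmin.card_le_nc (by omega) hJ (S := insert k {i, j}) (Finset.insert_subset hk hS)
    have h2 : (insert k {i, j} : Finset ι).card ≤ 3 := Finset.card_le_three
    omega

/-- A large minimal transitive string family generates a group containing the alternating group. -/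
theorem StrFam.alternatingGroup_le (h : StrFam ρ pos J) (hmin : MinTrans ρ ⊥ J)
    (hm : 7 ≤ Fintype.card α) (hJ : Fintype.card α ≤ J.card + 3) :
    alternatingGroup α ≤ gen ρ J := by
  have hprim := hmin.isPreprimitive hm hJ
  by_cases hswap : ∃ j ∈ J, (ρ j).IsSwap
  · obtain ⟨j, hj, hs⟩ := hswap
    rw [subgroup_eq_top_of_isPreprimitive_of_isSwap_mem hprim _ hs (mem_gen hj)]
    exact le_top
  push Not at hswap
  suffices hcyc : ∃ g ∈ gen ρ J, g.IsThreeCycle by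
    obtain ⟨g, hg, h3⟩ := hcyc
    exact alternatingGroup_le_of_isPreprimitive_of_isThreeCycle_mem hprim h3 hg
  obtain ⟨j₁, hj₁, hl₁⟩ := h.exists_lt subset_rfl (Finset.card_pos.1 (by omega))
  have hc₁ := Finset.card_erase_of_mem hj₁
  obtain ⟨j₂, hj₂, hl₂⟩ := h.exists_lt (S := J.erase j₁) (Finset.erase_subset _ _)
    (Finset.card_pos.1 (by omega))
  have hc₂ := Finset.card_erase_of_mem hj₂
  obtain ⟨j₃, hj₃, hl₃⟩ := h.exists_lt (S := (J.erase j₁).erase j₂)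
    ((Finset.erase_subset _ _).trans (Finset.erase_subset _ _)) (Finset.card_pos.1 (by omega))
  have hc₃ := Finset.card_erase_of_mem hj₃
  obtain ⟨j₄, hj₄, hl₄⟩ := h.exists_lt (S := ((J.erase j₁).erase j₂).erase j₃)
    (((Finset.erase_subset _ _).trans (Finset.erase_subset _ _)).trans (Finset.erase_subset _ _))
    (Finset.card_pos.1 (by omega))
  have hc₄ := Finset.card_erase_of_mem hj₄
  simp only [Finset.mem_erase] at hj₂ hj₃ hj₄ hl₂ hl₃ hl₄
  have p12 := hl₁ j₂ hj₂.2 hj₂.1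
  have p23 := hl₂ j₃ hj₃.2 hj₃.1
  have p34 := hl₃ j₄ hj₄.2 hj₄.1
  have hmem₂ := hj₂.2
  have hmem₃ := hj₃.2.2
  have hmem₄ := hj₄.2.2.2
  have habs : ∀ i ∈ J, ∀ j ∈ J, ¬ Commute (ρ i) (ρ j) → |pos i - pos j| < 2 := fun i hi j hj hc =>
    not_le.1 fun e => hc (h.comm i hi j hj e)
  have hfar : ∀ {i j k}, i ∈ J → j ∈ J → k ∈ J → 2 ≤ |pos k - pos i| → 2 ≤ |pos k - pos j| →
      Far (gen ρ {i, j}) (ρ k) := fun hi hj hk h1 h2 =>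
    h.far hmin hm hJ hi hj hk h1 h2 (hswap _ hk)
  have h4 : ∀ {j}, j ∈ J → 4 ≤ (ρ j).support.card := fun hj =>
    h.four_le_card_support hj (hswap _ hj)
  have hsub : ∀ {i j}, i ∈ J → j ∈ J → ({i, j} : Finset ι) ⊆ J := fun hi hj =>
    Finset.insert_subset hi (Finset.singleton_subset_iff.2 hj)
  have hnc : ∀ {i j}, i ∈ J → j ∈ J → Fintype.card α ≤ nc (orb (gen ρ {i, j})) + 4 := by
    intro i j hi hj
    have h1 := hmin.card_le_nc (by omega) hJ (hsub hi hj)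
    have h2 : ({i, j} : Finset ι).card ≤ 2 := Finset.card_le_two
    omega
  have n12 : ¬ Commute (ρ j₁) (ρ j₂) := by
    obtain ⟨i, hi, j, hj, hc⟩ := hmin.exists_not_commute hm hJ (A := {j₁}) (by simpa using hj₁)
      (by simp) (by rintro rfl; simp at hc₁ hm hJ; omega)
    rw [Finset.mem_singleton] at hi
    subst hi
    rw [Finset.mem_sdiff, Finset.mem_singleton] at hj
    have h1 := habs _ hj₁ _ hj.1 hc
    have h2 := hl₁ j hj.1 hj.2
    have : j = j₂ := by
      by_contra hne
      have := hl₂ j ⟨hj.2, hj.1⟩ hne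
      rw [abs_lt] at h1
      omega
    rwa [this] at hc
  have t1 := (hfar hj₁ hmem₂ hmem₄ (by rw [le_abs]; omega) (by rw [le_abs]; omega)).trichotomy
    (h.invol _ hj₁) (h.invol _ hmem₂) (mem_gen (by simp)) (mem_gen (by simp)) n12 (h4 hj₁)
    (h4 hmem₂) (hnc hj₁ hmem₂)
  rcases t1 with ⟨g, hg, h3⟩ | t1
  · exact ⟨g, gen_mono (hsub hj₁ hmem₂) hg, h3⟩
  by_cases hJ5 : 5 ≤ J.card
  · obtain ⟨j₅, hj₅, hl₅⟩ := h.exists_lt (S := (((J.erase j₁).erase j₂).erase j₃).erase j₄)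
      ((((Finset.erase_subset _ _).trans (Finset.erase_subset _ _)).trans
        (Finset.erase_subset _ _)).trans (Finset.erase_subset _ _))
      (Finset.card_pos.1 (by omega))
    simp only [Finset.mem_erase] at hj₅ hl₅
    have p45 := hl₄ j₅ hj₅.2 hj₅.1
    have hmem₅ := hj₅.2.2.2.2
    have hfar₅ := hfar hj₁ hmem₂ hmem₅ (by rw [le_abs]; omega) (by rw [le_abs]; omega)
    rcases t1 with t1 | t1
    · obtain ⟨z, hz⟩ := hmin.exists_not_rel (S := insert j₄ {j₁, j₂}) (i := j₅)
        (Finset.insert_subset hmem₄ (hsub hj₁ hmem₂)) hmem₅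
        (by simp [hj₅.1, hj₅.2.2.1, hj₅.2.2.2.1])
      refine absurd ((?_ : orb _ ⊔ orb _ ≤ orb _) (t1.2.2 _ hfar₅ z)) hz
      refine sup_le (orb_mono (gen_mono (Finset.subset_insert _ _))) (orb_mono ?_)
      rw [zpowers_le]
      exact mem_gen (Finset.mem_insert_self _ _)
    · refine ⟨_, mul_mem (mul_mem (mem_gen hmem₄) (mem_gen hmem₅))
        (mul_mem (mem_gen hmem₄) (mem_gen hmem₅)), t1.2 _ hfar₅ ?_⟩
      obtain ⟨i, hi, j, hj, hc⟩ := hmin.exists_not_commute hm hJ (A := {j₁, j₂, j₃, j₄})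
        (Finset.insert_subset hj₁ (Finset.insert_subset hmem₂ (hsub hmem₃ hmem₄)))
        (by simp) (by
          rintro rfl
          have : ({j₁, j₂, j₃, j₄} : Finset ι).card ≤ 4 := Finset.card_le_four
          omega)
      simp only [Finset.mem_sdiff, Finset.mem_insert, Finset.mem_singleton, not_or] at hi hj
      have hiJ : i ∈ J := by rcases hi with rfl | rfl | rfl | rfl <;> assumption
      have h1 := habs _ hiJ _ hj.1 hc
      rw [abs_lt] at h1
      have h2 := hl₄ j ⟨hj.2.2.2.1, hj.2.2.1, hj.2.1, hj.1⟩ hj.2.2.2.2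
      have hi4 : i = j₄ := by
        rcases hi with rfl | rfl | rfl | rfl
        · omega
        · omega
        · omega
        · rfl
      have hj5 : j = j₅ := by
        by_contra hne
        have := hl₅ j ⟨hj.2.2.2.2, hj.2.2.2.1, hj.2.2.1, hj.2.1, hj.1⟩ hne
        subst hi4
        omega
      rwa [hi4, hj5] at hc
  · rcases t1 with t1 | t1
    · have n43 : ¬ Commute (ρ j₄) (ρ j₃) := by
        obtain ⟨i, hi, j, hj, hc⟩ := hmin.exists_not_commute hm hJ (A := {j₁, j₂, j₃})
          (Finset.insert_subset hj₁ (hsub hmem₂ hmem₃)) (by simp) (by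
            rintro rfl
            have : ({j₁, j₂, j₃} : Finset ι).card ≤ 3 := Finset.card_le_three
            omega)
        simp only [Finset.mem_sdiff, Finset.mem_insert, Finset.mem_singleton, not_or] at hi hj
        have hiJ : i ∈ J := by rcases hi with rfl | rfl | rfl <;> assumption
        have h1 := habs _ hiJ _ hj.1 hc
        rw [abs_lt] at h1
        have h2 := hl₃ j ⟨hj.2.2.1, hj.2.1, hj.1⟩ hj.2.2.2
        have hi3 : i = j₃ := by
          rcases hi with rfl | rfl | rfl
          · omega
          · omega
          · rfl
        have hj4 : j = j₄ := by
          by_contra hne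
          have := hl₄ j ⟨hj.2.2.2, hj.2.2.1, hj.2.1, hj.1⟩ hne
          subst hi3
          omega
        rw [hi3, hj4] at hc
        exact fun e => hc e.symm
      have t2 := (hfar hmem₄ hmem₃ hj₁ (by rw [le_abs]; omega)
        (by rw [le_abs]; omega)).trichotomy (h.invol _ hmem₄) (h.invol _ hmem₃)
        (mem_gen (by simp)) (mem_gen (by simp)) n43 (h4 hmem₄) (h4 hmem₃) (hnc hmem₄ hmem₃)
      rcases t2 with ⟨g, hg, h3⟩ | t2 | t2
      · exact ⟨g, gen_mono (hsub hmem₄ hmem₃) hg, h3⟩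
      · omega
      · omega
    · omega

end Large

section Dihedral

variable {Γ : Type*} [Group Γ] {u v : Γ}

lemma conj_pow_of_invol (hu : u * u = 1) (hv : v * v = 1) (k : ℕ) :
    u * (u * v) ^ k * u⁻¹ = ((u * v) ^ k)⁻¹ := by
  have h : u * (u * v) * u⁻¹ = (u * v)⁻¹ := by
    rw [mul_inv_rev, inv_eq_of_mul_eq_one_left hu, inv_eq_of_mul_eq_one_left hv, ← mul_assoc, hu,
      one_mul]
  rw [← conj_pow, h, inv_pow]

/-- If the product of two involutions has even order, its middle power is a central involution of
the dihedral group they generate. -/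
lemma exists_central_invol [Finite Γ] (hu : u * u = 1) (hv : v * v = 1)
    (heven : Even (orderOf (u * v))) : ∃ σ ∈ closure {u, v}, σ * σ = 1 ∧ σ ≠ 1 ∧ Commute σ u ∧
      Commute σ v := by
  obtain ⟨k, hk⟩ := heven
  have hpos : 0 < orderOf (u * v) := orderOf_pos _
  have h1 : (u * v) ^ k * (u * v) ^ k = 1 := by rw [← pow_add, ← hk, pow_orderOf_eq_one]
  have hcu : Commute ((u * v) ^ k) u := by
    have := conj_pow_of_invol hu hv k
    rw [inv_eq_of_mul_eq_one_left h1, mul_inv_eq_iff_eq_mul] at this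
    exact this.symm
  have hcuv : Commute ((u * v) ^ k) (u * v) := (Commute.refl _).pow_left _
  refine ⟨(u * v) ^ k, pow_mem (mul_mem (subset_closure (by simp)) (subset_closure (by simp))) _,
    h1, fun e => ?_, hcu, ?_⟩
  · have := orderOf_dvd_of_pow_eq_one e
    have := Nat.le_of_dvd (by omega) this
    omega
  · have := (hcu.inv_right).mul_right hcuv
    rwa [inv_mul_cancel_left] at this

end Dihedral

section Blocks

variable {ι X Y : Type*} [Fintype ι] [DecidableEq ι] [Fintype X] [Fintype Y] [DecidableEq Y]

/-- A string C-group with two blocks interchanged by `ρ i₀`, and the projection `κ` onto the orbits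
of `ρ i₀`. -/
structure Blocks (ρ : ι → Perm X) (pos : ι → ℤ) (i₀ : ι) (b : X → Fin 2) (κ : X → Y) :
    Prop where
  invol : ∀ i, ρ i * ρ i = 1
  ne_one : ∀ i, ρ i ≠ 1
  comm : ∀ i j, 2 ≤ |pos i - pos j| → Commute (ρ i) (ρ j)
  inj : Function.Injective pos
  ip : ∀ J K : Finset ι, gen ρ J ⊓ gen ρ K = gen ρ (J ∩ K)
  compat : ∀ g ∈ gen ρ Finset.univ, ∀ x y, b x = b y → b (g x) = b (g y)
  swap : ∀ x, b (ρ i₀ x) ≠ b x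
  surj : Function.Surjective κ
  ker : ∀ x y, κ x = κ y ↔ y = x ∨ y = ρ i₀ x
  card_eq : Fintype.card X = 2 * Fintype.card Y

namespace Blocks

variable {ρ : ι → Perm X} {pos : ι → ℤ} {i₀ : ι} {b : X → Fin 2} {κ : X → Y}
  {C S T : Finset ι}

lemma mem_univ (S : Finset ι) {g : Perm X} (hg : g ∈ gen ρ S) : g ∈ gen ρ Finset.univ :=
  gen_mono (Finset.subset_univ S) hg

lemma fin_two_eq {p q r : Fin 2} (h1 : p ≠ q) (h2 : r ≠ q) : p = r := by omega

lemma compat_iff (h : Blocks ρ pos i₀ b κ) {g : Perm X} (hg : g ∈ gen ρ Finset.univ) {x y : X} :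
    b (g x) = b (g y) ↔ b x = b y :=
  ⟨fun e => by simpa using h.compat g⁻¹ (inv_mem hg) _ _ e, h.compat g hg x y⟩

lemma preserve_iff (h : Blocks ρ pos i₀ b κ) {g : Perm X} (hg : g ∈ gen ρ Finset.univ) (x y : X) :
    b (g x) = b x ↔ b (g y) = b y := by
  have := h.compat_iff hg (x := x) (y := y)
  by_cases e : b x = b y
  · rw [← e, this.2 e]
  · have e' : b (g x) ≠ b (g y) := fun h' => e (this.1 h')
    omega

lemma eq_of (h : Blocks ρ pos i₀ b κ) {x y : X} (h1 : κ x = κ y) (h2 : b x = b y) : x = y := by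
  rcases (h.ker x y).1 h1 with e | e
  · exact e.symm
  · rw [e] at h2
    exact absurd h2.symm (h.swap x)

lemma κ_swap (h : Blocks ρ pos i₀ b κ) (x : X) : κ (ρ i₀ x) = κ x :=
  ((h.ker _ _).2 (Or.inr rfl)).symm

lemma eq_one_or_eq (h : Blocks ρ pos i₀ b κ) {g : Perm X} (hg : g ∈ gen ρ Finset.univ)
    (hκ : ∀ x, κ (g x) = κ x) : g = 1 ∨ g = ρ i₀ := by
  cases isEmpty_or_nonempty X with
  | inl h0 => exact Or.inl (Subsingleton.elim _ _)
  | inr h0 =>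
  obtain ⟨x₀⟩ := h0
  by_cases h0 : b (g x₀) = b x₀
  · left
    ext x
    exact h.eq_of (hκ x) ((h.preserve_iff hg x₀ x).1 h0)
  · right
    ext x
    refine h.eq_of ((hκ x).trans (h.κ_swap x).symm) (fin_two_eq (fun e => ?_) (h.swap x))
    exact h0 ((h.preserve_iff hg x x₀).1 e)

lemma mem_inter (h : Blocks ρ pos i₀ b κ) {g : Perm X} (h1 : g ∈ gen ρ S) (h2 : g ∈ gen ρ T) :
    g ∈ gen ρ (S ∩ T) := by
  rw [← h.ip]
  exact ⟨h1, h2⟩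

lemma eq_one_of_disjoint (h : Blocks ρ pos i₀ b κ) {g : Perm X} (hST : Disjoint S T)
    (h1 : g ∈ gen ρ S) (h2 : g ∈ gen ρ T) : g = 1 := by
  have := h.mem_inter h1 h2
  rwa [Finset.disjoint_iff_inter_eq_empty.1 hST, gen_empty, mem_bot] at this

lemma notMem (h : Blocks ρ pos i₀ b κ) {i : ι} (hi : i ∉ S) : ρ i ∉ gen ρ S := fun hmem =>
  h.ne_one i (h.eq_one_of_disjoint (S := {i}) (by simpa using hi) (mem_gen (by simp)) hmem)

lemma strFam (h : Blocks ρ pos i₀ b κ) (S : Finset ι) : StrFam ρ pos S where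
  invol i _ := h.invol i
  comm i _ j _ := h.comm i j
  inj _ _ _ _ e := h.inj e
  indep _ _ := h.notMem (Finset.notMem_erase _ _)

lemma neg (h : Blocks ρ pos i₀ b κ) : Blocks ρ (fun i => - pos i) i₀ b κ :=
  { h with
    comm := fun i j hij => h.comm i j (by rwa [neg_sub_neg, abs_sub_comm] at hij)
    inj := fun i j e => h.inj (neg_injective e) }

/-- A permutation commuting with `ρ i₀` induces a permutation through `κ`. -/
lemma κ_eq_of_commute (h : Blocks ρ pos i₀ b κ) {g : Perm X} (hg : Commute g (ρ i₀)) {x y : X}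
    (e : κ x = κ y) : κ (g x) = κ (g y) := by
  rcases (h.ker x y).1 e with rfl | rfl
  · rfl
  · rw [← mul_apply, hg.eq, mul_apply, h.κ_swap]

lemma exists_family {ι' : Type*} (h : Blocks ρ pos i₀ b κ) {τ : ι' → Perm X} {S : Finset ι'}
    (h2 : ∀ i ∈ S, τ i * τ i = 1) (hc : ∀ i ∈ S, Commute (τ i) (ρ i₀)) :
    ∃ τ' : ι' → Perm Y, ∀ i ∈ S, ∀ x, κ (τ i x) = τ' i (κ x) :=
  exists_quotient_family h.surj h2 fun i hi _ _ e => h.κ_eq_of_commute (hc i hi) e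

/-- Independence descends along `κ`. -/
lemma mem_of_mem_gen {ι' : Type*} (h : Blocks ρ pos i₀ b κ) {τ : ι' → Perm X} {τ' : ι' → Perm Y}
    {S : Finset ι'} (hf : ∀ i ∈ S, ∀ x, κ (τ i x) = τ' i (κ x)) (hS : gen τ S ≤ gen ρ Finset.univ)
    {g : Perm X} {g' : Perm Y} (hg : g ∈ gen ρ Finset.univ) (hgg : ∀ x, κ (g x) = g' (κ x))
    (hg' : g' ∈ gen τ' S) : g ∈ gen τ S ∨ ρ i₀ * g ∈ gen τ S := by
  obtain ⟨k, hk, e⟩ := exists_lift_gen hf hg'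
  have : ∀ x, κ ((g * k⁻¹) x) = κ x := by
    intro x
    rw [mul_apply, hgg, ← e]
    simp
  rcases h.eq_one_or_eq (mul_mem hg (inv_mem (hS hk))) this with e | e
  · rw [mul_inv_eq_one] at e
    rw [e]
    exact Or.inl hk
  · rw [mul_inv_eq_iff_eq_mul] at e
    rw [e, ← mul_assoc, h.invol, one_mul]
    exact Or.inr hk

lemma strFam_proj (h : Blocks ρ pos i₀ b κ) {ρ' : ι → Perm Y} (hC : i₀ ∉ C)
    (hf : ∀ i ∈ C, ∀ x, κ (ρ i x) = ρ' i (κ x)) : StrFam ρ' pos C := by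
  refine transport_strFam h.surj hf (h.strFam C) fun i hi hmem => ?_
  have hi₀ : i ≠ i₀ := by rintro rfl; exact hC hi
  have := h.mem_of_mem_gen (fun j hj => hf j (Finset.erase_subset _ _ hj))
    (gen_mono (Finset.subset_univ _)) (mem_univ {i} (mem_gen (by simp))) (hf i hi) hmem
  refine h.notMem (S := insert i₀ (C.erase i)) (i := i) (by simp [hi₀]) ?_
  rcases this with e | e
  · exact gen_mono (Finset.subset_insert _ _) e
  · have := mul_mem (mem_gen (ρ := ρ) (Finset.mem_insert_self i₀ (C.erase i)))
      (gen_mono (Finset.subset_insert i₀ _) e)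
    rwa [← mul_assoc, h.invol, one_mul] at this

lemma orb_proj (h : Blocks ρ pos i₀ b κ) {ρ' : ι → Perm Y}
    (hf : ∀ i ∈ C, ∀ x, κ (ρ i x) = ρ' i (κ x)) (htr : orb (gen ρ (insert i₀ C)) = ⊤) :
    orb (gen ρ' C) = ⊤ := by
  have hle : orb (gen ρ (insert i₀ C)) ≤ (orb (gen ρ' C)).comap κ := by
    refine orb_gen_le.2 fun i hi x => ?_
    change orb (gen ρ' C) (κ x) (κ (ρ i x))
    rcases Finset.mem_insert.1 hi with rfl | hi
    · rw [h.κ_swap]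
    · exact ⟨ρ' i, mem_gen hi, (hf i hi x).symm⟩
  refine eq_top_iff_rel.2 fun y z => ?_
  obtain ⟨x, rfl⟩ := h.surj y
  obtain ⟨w, rfl⟩ := h.surj z
  exact hle (eq_top_iff_rel.1 htr x w)

end Blocks

end Blocks

namespace Blocks

variable {ι X Y : Type*} [Fintype ι] [DecidableEq ι] [Fintype X] [Fintype Y] [DecidableEq Y]
  {ρ : ι → Perm X} {pos : ι → ℤ} {i₀ : ι} {b : X → Fin 2} {κ : X → Y} {C : Finset ι} {j : ι}

lemma closure_pair_eq (ρ : ι → Perm X) (i j : ι) : closure {ρ i, ρ j} = gen ρ {i, j} := by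
  simp [gen, Set.image_insert_eq]

/-- A central involution in the group generated by `ρ i₀` and `ρ j` cannot coexist with a large
transitive family centralizing both. -/
lemma card_add_five_le_of_even (h : Blocks ρ pos i₀ b κ) {ρ' : ι → Perm Y}
    (hf : ∀ i ∈ C, ∀ x, κ (ρ i x) = ρ' i (κ x)) (hi₀ : i₀ ∉ C) (hj : j ∉ C)
    (hne : C.Nonempty)
    (hc : ∀ i ∈ C, Commute (ρ i) (ρ i₀)) (hcj : ∀ i ∈ C, Commute (ρ i) (ρ j))
    (hnc : ¬ Commute (ρ i₀) (ρ j)) (htr : orb (gen ρ' C) = ⊤) (hm : 7 ≤ Fintype.card Y)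
    (heven : Even (orderOf (ρ i₀ * ρ j))) : C.card + 5 ≤ Fintype.card Y := by
  obtain ⟨σ, hσ, hσ2, hσ1, hσi, hσj⟩ := exists_central_invol (h.invol i₀) (h.invol j) heven
  rw [closure_pair_eq] at hσ
  have hσC : ∀ i ∈ C, Commute (ρ i) σ := by
    intro i hi
    refine (commute_of_mem_gen (fun k hk => ?_) hσ).symm
    rcases Finset.mem_insert.1 hk with rfl | hk
    · exact (hc i hi).symm
    · rw [Finset.mem_singleton.1 hk]
      exact (hcj i hi).symm
  let τ : Option ι → Perm X := fun o => o.elim σ ρ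
  obtain ⟨M, hM⟩ := Infinite.exists_notMem_finset (C.image pos)
  let q : Option ι → ℤ := fun o => o.elim M pos
  let A : Finset (Option ι) := {none}
  let B : Finset (Option ι) := C.map Function.Embedding.some
  have hmemB : ∀ {o}, o ∈ B ↔ ∃ i ∈ C, some i = o := by intro o; simp [B]
  have hcases : ∀ o ∈ A ∪ B, o = none ∨ ∃ i ∈ C, some i = o := by
    intro o ho
    rcases Finset.mem_union.1 ho with ho | ho
    · exact Or.inl (Finset.mem_singleton.1 ho)
    · exact Or.inr (hmemB.1 ho)
  have hτ2 : ∀ o, τ o * τ o = 1 := by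
    rintro (_ | i)
    · exact hσ2
    · exact h.invol i
  have hτc : ∀ o ∈ A ∪ B, Commute (τ o) (ρ i₀) := by
    intro o ho
    rcases hcases o ho with rfl | ⟨i, hi, rfl⟩
    · exact hσi
    · exact hc i hi
  obtain ⟨τ', hτ'⟩ := h.exists_family (fun o _ => hτ2 o) hτc
  have hgenB : ∀ D : Finset ι, gen τ (D.map Function.Embedding.some) = gen ρ D := by
    intro D
    simp only [gen, Finset.coe_map, ← Set.image_comp]
    rfl
  have hle : ∀ T : Finset (Option ι), ∀ D : Finset ι, (∀ i, some i ∈ T → i ∈ D) → i₀ ∈ D → j ∈ D →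
      gen τ T ≤ gen ρ D := by
    intro T D hD h0 h1
    refine gen_le.2 ?_
    rintro (_ | i) hi
    · exact gen_mono (Finset.insert_subset h0 (Finset.singleton_subset_iff.2 h1)) hσ
    · exact mem_gen (hD i hi)
  have hτu : ∀ T, gen τ T ≤ gen ρ Finset.univ := fun T => hle T _ (by simp) (by simp) (by simp)
  have hstr : StrFam τ' q (A ∪ B) := by
    constructor
    · intro o ho
      exact transport_invol h.surj hτ' ho (hτ2 o)
    · intro o ho o' ho' hoo'
      refine transport_commute h.surj hτ' ho ho' ?_
      rcases hcases o ho with rfl | ⟨i, hi, rfl⟩ <;> rcases hcases o' ho' with rfl | ⟨i', hi', rfl⟩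
      · exact Commute.refl _
      · exact (hσC i' hi').symm
      · exact hσC i hi
      · exact h.comm i i' hoo'
    · intro o ho o' ho' hoo'
      rcases hcases o ho with rfl | ⟨i, hi, rfl⟩ <;> rcases hcases o' ho' with rfl | ⟨i', hi', rfl⟩
      · rfl
      · exact absurd (Finset.mem_image.2 ⟨i', hi', hoo'.symm⟩) hM
      · exact absurd (Finset.mem_image.2 ⟨i, hi, hoo'⟩) hM
      · exact congrArg some (h.inj hoo')
    · intro o ho hmem
      have hlift := h.mem_of_mem_gen (fun o' ho' => hτ' o' (Finset.erase_subset _ _ ho')) (hτu _)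
        (hτu _ (mem_gen (Finset.mem_singleton_self o))) (hτ' o ho) hmem
      rcases hcases o ho with rfl | ⟨i, hi, rfl⟩
      · have herase : (A ∪ B).erase none ⊆ B := by
          intro o' ho'
          rw [Finset.mem_erase] at ho'
          rcases hcases o' ho'.2 with e | e
          · exact absurd e ho'.1
          · exact hmemB.2 e
        have hdisj : Disjoint ({i₀, j} : Finset ι) C := by simp [hi₀, hj]
        have hD : ∀ g ∈ gen ρ {i₀, j}, g ∈ gen τ ((A ∪ B).erase none) → g = 1 := by
          intro g hg hg'
          have := gen_mono herase hg'
          rw [hgenB] at this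
          exact h.eq_one_of_disjoint hdisj hg this
        rcases hlift with e | e
        · exact hσ1 (hD _ hσ e)
        · have := hD _ (mul_mem (mem_gen (by simp)) hσ) e
          have e2 : σ = ρ i₀ := by
            change ρ i₀ * σ = 1 at this
            rw [← one_mul σ, ← h.invol i₀, mul_assoc, this, mul_one]
          rw [e2] at hσj
          exact hnc hσj
      · have hi1 : i ≠ i₀ := by rintro rfl; exact hi₀ hi
        have hi2 : i ≠ j := by rintro rfl; exact hj hi
        have hsub := hle ((A ∪ B).erase (some i)) (Finset.univ.erase i) (fun k hk => by
          rw [Finset.mem_erase] at hk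
          simpa using fun e => hk.1 (congrArg some e)) (by simp [hi1.symm]) (by simp [hi2.symm])
        refine h.notMem (Finset.notMem_erase i Finset.univ) ?_
        rcases hlift with e | e
        · exact hsub e
        · have := mul_mem (mem_gen (ρ := ρ) (i := i₀) (S := Finset.univ.erase i)
            (by simp [hi1.symm])) (hsub e)
          rwa [← mul_assoc, h.invol, one_mul] at this
  have htr' : orb (gen τ' (A ∪ B)) = ⊤ := by
    rw [← top_le_iff, ← htr]
    refine orb_mono (gen_le.2 fun i hi => ?_)
    have hm : some i ∈ A ∪ B := Finset.mem_union_right _ (hmemB.2 ⟨i, hi, rfl⟩)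
    have : ρ' i = τ' (some i) := by
      ext y
      obtain ⟨x, rfl⟩ := h.surj y
      rw [← hf i hi, ← hτ' _ hm]
      rfl
    rw [this]
    exact mem_gen hm
  have hAB : Disjoint A B := by simp [A, B]
  have := hstr.card_add_four_le_of_split hAB (fun o ho o' ho' => by
      refine transport_commute h.surj hτ' (Finset.mem_union_left _ ho)
        (Finset.mem_union_right _ ho') ?_
      obtain ⟨i, hi, rfl⟩ := hmemB.1 ho'
      rw [Finset.mem_singleton.1 ho]
      exact (hσC i hi).symm) (by simp [A]) (by simpa [B] using hne) htr' hm
  simp only [A, B, Finset.card_singleton, Finset.card_map] at this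
  omega

end Blocks

section OddPair

variable {ι X Y : Type*} [Fintype ι] [DecidableEq ι] [Fintype X] [Fintype Y] [DecidableEq Y]
  {ρ : ι → Perm X} {pos : ι → ℤ} {i₀ j : ι} {b : X → Fin 2} {κ : X → Y} {C : Finset ι}

/-- The generators indexed by `C` centralize `ρ i₀` and `ρ j`, whose product has odd order. -/
structure OddPair (ρ : ι → Perm X) (i₀ j : ι) (C : Finset ι) : Prop where
  odd : Odd (orderOf (ρ i₀ * ρ j))
  comm₀ : ∀ i ∈ C, Commute (ρ i) (ρ i₀)
  comm : ∀ i ∈ C, Commute (ρ i) (ρ j)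
  not_comm : ¬ Commute (ρ i₀) (ρ j)
  trans : orb (gen ρ (insert i₀ C)) = ⊤

namespace OddPair

lemma commute_rot (p : OddPair ρ i₀ j C) {i : ι} (hi : i ∈ C) {w : Perm X}
    (hw : w ∈ zpowers (ρ i₀ * ρ j)) : Commute (ρ i) w := by
  obtain ⟨k, rfl⟩ := mem_zpowers_iff.1 hw
  exact ((p.comm₀ i hi).mul_right (p.comm i hi)).zpow_right k

lemma conj_rot (h : Blocks ρ pos i₀ b κ) {w : Perm X}
    (hw : w ∈ zpowers (ρ i₀ * ρ j)) : ρ i₀ * w = w⁻¹ * ρ i₀ := by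
  have h1 : SemiconjBy (ρ i₀) (ρ i₀ * ρ j) (ρ i₀ * ρ j)⁻¹ := by
    rw [SemiconjBy, mul_inv_rev, inv_eq_of_mul_eq_one_left (h.invol i₀),
      inv_eq_of_mul_eq_one_left (h.invol j), ← mul_assoc, h.invol, mul_assoc, h.invol]
    rfl
  obtain ⟨k, rfl⟩ := mem_zpowers_iff.1 hw
  rw [← inv_zpow]
  exact h1.zpow_right k

lemma rot_fix (h : Blocks ρ pos i₀ b κ) (p : OddPair ρ i₀ j C) {w : Perm X}
    (hw : w ∈ zpowers (ρ i₀ * ρ j)) {x : X} (hx : w x = x) : w = 1 := by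
  let s : Setoid X :=
    { r := fun x y => w x = x ↔ w y = y
      iseqv := ⟨fun _ => Iff.rfl, fun h => h.symm, fun h h' => h.trans h'⟩ }
  have hle : orb (gen ρ (insert i₀ C)) ≤ s := by
    refine orb_gen_le.2 fun i hi y => ?_
    change w y = y ↔ w (ρ i y) = ρ i y
    rcases Finset.mem_insert.1 hi with rfl | hi
    · have := conj_rot h (inv_mem hw)
      rw [inv_inv] at this
      rw [← mul_apply w, ← this, mul_apply, (ρ i).apply_eq_iff_eq, Perm.inv_eq_iff_eq, eq_comm]
    · rw [← mul_apply w, ← (p.commute_rot hi hw).eq, mul_apply, (ρ i).apply_eq_iff_eq]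
  ext y
  exact (hle (eq_top_iff_rel.1 p.trans x y)).1 hx

/-- An involution commuting with the rotations fixes every point whose rotation orbit it
preserves. -/
lemma apply_eq (h : Blocks ρ pos i₀ b κ) (p : OddPair ρ i₀ j C) {e w : Perm X} (he : e * e = 1)
    (hw : w ∈ zpowers (ρ i₀ * ρ j)) (hew : Commute e w) {x : X} (hx : e x = w x) : e x = x := by
  have h1 : (w * w) x = x := by
    rw [mul_apply, ← hx, ← mul_apply, ← hew.eq, mul_apply, ← hx, ← mul_apply, he, one_apply]
  have h2 := p.rot_fix h (mul_mem hw hw) h1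
  have h3 : orderOf w ∣ 2 := orderOf_dvd_of_pow_eq_one (by rw [pow_two, h2])
  have h4 : orderOf w ∣ orderOf (ρ i₀ * ρ j) := orderOf_dvd_of_mem_zpowers hw
  have h5 : orderOf w = 1 := by
    rcases (Nat.dvd_prime Nat.prime_two).1 h3 with h5 | h5
    · exact h5
    · rw [h5, ← even_iff_two_dvd] at h4
      exact absurd h4 (Nat.not_even_iff_odd.2 p.odd)
  rw [hx, orderOf_eq_one_iff.1 h5, one_apply]

lemma b_rot (h : Blocks ρ pos i₀ b κ) (hodd : Odd (orderOf (ρ i₀ * ρ j))) {w : Perm X}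
    (hw : w ∈ zpowers (ρ i₀ * ρ j)) (x : X) : b (w x) = b x := by
  have hg : ρ i₀ * ρ j ∈ gen ρ Finset.univ := mul_mem (mem_gen (by simp)) (mem_gen (by simp))
  have hb : ∀ y, b ((ρ i₀ * ρ j) y) = b y := by
    by_contra! hcon
    obtain ⟨y₀, hy₀⟩ := hcon
    have hsw : ∀ y, b ((ρ i₀ * ρ j) y) ≠ b y := fun y e => hy₀ ((h.preserve_iff hg y y₀).1 e)
    have hpow : ∀ k : ℕ, b (((ρ i₀ * ρ j) ^ k) y₀) = b y₀ ↔ Even k := by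
      intro k
      induction k with
      | zero => simp
      | succ k ih =>
        rw [pow_succ', mul_apply, Nat.even_add_one, ← ih]
        have := hsw (((ρ i₀ * ρ j) ^ k) y₀)
        constructor
        · intro e e'
          exact this (e.trans e'.symm)
        · intro e
          exact Blocks.fin_two_eq this (fun e' => e e'.symm)
    have := (hpow (orderOf (ρ i₀ * ρ j))).1 (by rw [pow_orderOf_eq_one, one_apply])
    exact absurd this (Nat.not_even_iff_odd.2 hodd)
  obtain ⟨k, rfl⟩ := mem_powers_iff_mem_zpowers.2 hw
  induction k with
  | zero => rfl
  | succ k ih =>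
    change b (((ρ i₀ * ρ j) ^ (k + 1)) x) = _
    rw [pow_succ', mul_apply, hb]
    exact ih (npow_mem_zpowers _ _)

lemma rot_le : zpowers (ρ i₀ * ρ j) ≤ gen ρ {i₀, j} := by
  rw [zpowers_le]
  exact mul_mem (mem_gen (by simp)) (mem_gen (by simp))

lemma mem_dihedral (h : Blocks ρ pos i₀ b κ) {d : Perm X} (hd : d ∈ gen ρ {i₀, j}) :
    d ∈ zpowers (ρ i₀ * ρ j) ∨ ρ i₀ * d ∈ zpowers (ρ i₀ * ρ j) := by
  have hinv : ∀ {w}, w ∈ zpowers (ρ i₀ * ρ j) → ρ i₀ * w * ρ i₀ ∈ zpowers (ρ i₀ * ρ j) := by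
    intro w hw
    rw [conj_rot h hw, mul_assoc, h.invol, mul_one]
    exact inv_mem hw
  let K : Subgroup (Perm X) :=
    { carrier := {d | d ∈ zpowers (ρ i₀ * ρ j) ∨ ρ i₀ * d ∈ zpowers (ρ i₀ * ρ j)}
      one_mem' := Or.inl (one_mem _)
      mul_mem' := by
        rintro d d' (h1 | h1) (h2 | h2)
        · exact Or.inl (mul_mem h1 h2)
        · right
          have := mul_mem (hinv h1) h2
          rwa [mul_assoc (ρ i₀ * d), ← mul_assoc (ρ i₀) (ρ i₀), h.invol, one_mul,
            mul_assoc] at this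
        · exact Or.inr (by rw [← mul_assoc]; exact mul_mem h1 h2)
        · left
          have := mul_mem (hinv h1) h2
          rwa [← mul_assoc (ρ i₀) (ρ i₀), h.invol, one_mul, mul_assoc, ← mul_assoc (ρ i₀) (ρ i₀),
            h.invol, one_mul] at this
      inv_mem' := by
        rintro d (h1 | h1)
        · exact Or.inl (inv_mem h1)
        · right
          have := hinv (inv_mem h1)
          rwa [mul_inv_rev, inv_eq_of_mul_eq_one_left (h.invol i₀), mul_assoc, mul_assoc, h.invol,
            mul_one] at this }
  refine (gen_le (H := K)).2 (fun i hi => ?_) hd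
  rcases Finset.mem_insert.1 hi with rfl | hi
  · exact Or.inr (by rw [h.invol]; exact one_mem _)
  · rw [Finset.mem_singleton.1 hi]
    exact Or.inr (mem_zpowers _)

lemma card_mul_le (h : Blocks ρ pos i₀ b κ) (p : OddPair ρ i₀ j C) :
    orderOf (ρ i₀ * ρ j) * nc (orb (zpowers (ρ i₀ * ρ j))) = 2 * Fintype.card Y ∧
      C.card ≤ nc (orb (zpowers (ρ i₀ * ρ j))) := by
  set E := zpowers (ρ i₀ * ρ j) with hE
  constructor
  · rw [← Nat.card_zpowers, ← h.card_eq]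
    refine card_dvd_of_semiregular (fun w hw x hx => p.rot_fix h hw hx) p.trans
      (inv_gen (fun i _ => h.invol i) fun i hi x y hxy => ?_)
    obtain ⟨w, hw, rfl⟩ := hxy
    rcases Finset.mem_insert.1 hi with rfl | hi
    · exact ⟨w⁻¹, inv_mem hw, by rw [← mul_apply, ← mul_apply, conj_rot h hw]⟩
    · exact ⟨w, hw, by rw [← mul_apply, ← mul_apply, (p.commute_rot hi hw).eq]⟩
  · obtain ⟨F, hF, hcard, hFc⟩ := (h.strFam C).exists_commuting
    obtain ⟨τ, hτ⟩ := exists_quotient_family (f := Quotient.mk (orb E)) (S := F) (ρ := ρ)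
      Quotient.mk_surjective (fun i _ => h.invol i) fun i hi x y hxy => by
        obtain ⟨w, hw, rfl⟩ := Quotient.exact hxy
        refine Quotient.sound ⟨w, hw, ?_⟩
        rw [← mul_apply, ← mul_apply, (p.commute_rot (hF hi) hw).eq]
    have : Fintype (Quotient (orb E)) := Fintype.ofFinite _
    have hind : Indep τ F := by
      intro i hi hmem
      obtain ⟨k, hk, hkx⟩ := exists_lift_gen
        (fun l hl => hτ l (Finset.erase_subset _ _ hl)) hmem
      have hkF : ρ i * k⁻¹ ∈ gen ρ F :=
        mul_mem (mem_gen hi) (inv_mem (gen_mono (Finset.erase_subset _ _) hk))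
      refine (h.strFam F).indep i hi ?_
      suffices ρ i * k⁻¹ = 1 by rwa [← mul_inv_eq_one.1 this] at hk
      ext x
      have hrel : orb E x ((ρ i * k⁻¹) x) := by
        have := Quotient.exact ((hkx (k⁻¹ x)).trans (hτ i hi (k⁻¹ x)).symm)
        simpa using this
      obtain ⟨w, hw, e⟩ := hrel
      exact p.apply_eq h (mul_self_of_mem_gen hFc (fun i _ => h.invol i) hkF) hw
        (commute_of_mem_gen (fun l hl => p.commute_rot (hF hl) hw) hkF) e.symm
    have := hind.card_le_of_commute (fun i hi => transport_invol Quotient.mk_surjective hτ hi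
        (h.invol i)) (fun i hi k hk => transport_commute Quotient.mk_surjective hτ hi hk
        (hFc i hi k hk)) Finset.univ (by simp) (fun g _ hg => Perm.ext fun z => hg z (by simp))
    rw [Finset.card_univ, ← Nat.card_eq_fintype_card] at this
    exact hcard.trans this

/-- Counting leaves only a product of order three and nine orbits of `ρ i₀`. -/
lemma card_eq_nine (h : Blocks ρ pos i₀ b κ) (p : OddPair ρ i₀ j C) (hm : 7 ≤ Fintype.card Y)
    (hC : Fintype.card Y ≤ C.card + 3) :
    orderOf (ρ i₀ * ρ j) = 3 ∧ Fintype.card Y = 9 ∧ 6 ≤ C.card := by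
  obtain ⟨h1, h2⟩ := p.card_mul_le h
  have h3 : orderOf (ρ i₀ * ρ j) ≠ 1 := by
    intro e
    rw [orderOf_eq_one_iff, mul_eq_one_iff_eq_inv,
      inv_eq_of_mul_eq_one_left (h.invol j)] at e
    exact p.not_comm (by rw [e])
  obtain ⟨k, hk⟩ := p.odd
  set N := orderOf (ρ i₀ * ρ j)
  set q := nc (orb (zpowers (ρ i₀ * ρ j)))
  have h4 : N < 5 := by
    by_contra hcon
    nlinarith
  have h5 : N = 3 := by omega
  rw [h5] at h1
  omega

end OddPair

end OddPair

section PermThree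

lemma perm_fin_three : ∀ p q : Perm (Fin 3), p * p = 1 → q * q = 1 → p ≠ 1 → q ≠ 1 → p ≠ q →
    p * q ≠ q * p ∧ ∀ x y, y = x ∨ y = p x ∨ y = q x ∨ y = p (q x) ∨ y = q (p x) := by
  decide

/-- Two distinct involutions of three points. -/
lemma perm_of_card_three {Z : Type*} [Fintype Z] (hZ : Fintype.card Z = 3) {p q : Perm Z}
    (hp : p * p = 1) (hq : q * q = 1) (hp1 : p ≠ 1) (hq1 : q ≠ 1) (hpq : p ≠ q) :
    ¬ Commute p q ∧ ∀ x y, y = x ∨ y = p x ∨ y = q x ∨ y = p (q x) ∨ y = q (p x) := by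
  have e := Fintype.equivFinOfCardEq hZ
  let φ := e.permCongrHom
  have hφ : ∀ (g : Perm Z) x, φ g (e x) = e (g x) := by intro g x; simp [φ]
  obtain ⟨h1, h2⟩ := perm_fin_three (φ p) (φ q) (by rw [← map_mul, hp, map_one])
    (by rw [← map_mul, hq, map_one]) (by simpa using hp1) (by simpa using hq1) (by simpa using hpq)
  refine ⟨fun hc => h1 (by rw [← map_mul, ← map_mul, hc.eq]), fun x y => ?_⟩
  have := h2 (e x) (e y)
  simpa only [hφ, e.apply_eq_iff_eq] using this

end PermThree

namespace OddPair

variable {ι X Y : Type*} [Fintype ι] [DecidableEq ι] [Fintype X] [Fintype Y] [DecidableEq Y]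
  {ρ : ι → Perm X} {pos : ι → ℤ} {i₀ j : ι} {b : X → Fin 2} {κ : X → Y} {C : Finset ι}

lemma b_ne (h : Blocks ρ pos i₀ b κ) (p : OddPair ρ i₀ j C) {d : Perm X}
    (hd : ρ i₀ * d ∈ zpowers (ρ i₀ * ρ j)) (x : X) : b (d x) ≠ b x := by
  have := b_rot h p.odd hd x
  rw [mul_apply] at this
  exact fun e => h.swap (d x) (this.trans e.symm)

lemma dihedral_fix (h : Blocks ρ pos i₀ b κ) (p : OddPair ρ i₀ j C) {d : Perm X}
    (hd : d ∈ gen ρ {i₀, j}) {x : X} (hx : d x = x) : d = 1 := by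
  rcases mem_dihedral h hd with hd | hd
  · exact p.rot_fix h hd hx
  · exact absurd (congrArg b hx) (p.b_ne h hd x)

lemma commute_dihedral (p : OddPair ρ i₀ j C) {i : ι} (hi : i ∈ C) {d : Perm X}
    (hd : d ∈ gen ρ {i₀, j}) : Commute (ρ i) d := by
  refine (commute_of_mem_gen (fun k hk => ?_) hd).symm
  rcases Finset.mem_insert.1 hk with rfl | hk
  · exact (p.comm₀ i hi).symm
  · rw [Finset.mem_singleton.1 hk]
    exact (p.comm i hi).symm

lemma card_dihedral (h : Blocks ρ pos i₀ b κ) (p : OddPair ρ i₀ j C) [Nonempty X] :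
    Nat.card (gen ρ {i₀, j}) = 2 * orderOf (ρ i₀ * ρ j) := by
  have hlt : zpowers (ρ i₀ * ρ j) < gen ρ {i₀, j} := by
    refine lt_of_le_of_ne rot_le fun e => ?_
    have h0 : ρ i₀ ∈ zpowers (ρ i₀ * ρ j) := by rw [e]; exact mem_gen (by simp)
    obtain ⟨x⟩ := ‹Nonempty X›
    exact h.swap x (b_rot h p.odd h0 x)
  have h1 := two_mul_card_le hlt
  rw [Nat.card_zpowers] at h1
  refine le_antisymm ?_ h1
  let f : Bool × zpowers (ρ i₀ * ρ j) → gen ρ {i₀, j} := fun q =>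
    ⟨(if q.1 then ρ i₀ else 1) * q.2, mul_mem
      (by split_ifs; exacts [mem_gen (by simp), one_mem _]) (rot_le q.2.2)⟩
  have hf : Function.Surjective f := by
    rintro ⟨d, hd⟩
    rcases mem_dihedral h hd with hd | hd
    · exact ⟨(false, ⟨d, hd⟩), by simp [f]⟩
    · exact ⟨(true, ⟨_, hd⟩), by simp [f, ← mul_assoc, h.invol]⟩
  have := Nat.card_le_card_of_surjective f hf
  rwa [Nat.card_prod, Nat.card_zpowers, Nat.card_eq_fintype_card (α := Bool), Fintype.card_bool] at this

lemma nc_dihedral (h : Blocks ρ pos i₀ b κ) (p : OddPair ρ i₀ j C) [Nonempty X] :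
    orderOf (ρ i₀ * ρ j) * nc (orb (gen ρ {i₀, j})) = Fintype.card Y := by
  have := card_dvd_of_semiregular (fun d hd x hx => p.dihedral_fix h hd hx) p.trans
    (inv_gen (fun i _ => h.invol i) fun i hi x y hxy => by
      obtain ⟨d, hd, rfl⟩ := hxy
      rcases Finset.mem_insert.1 hi with rfl | hi
      · have hi : ρ i ∈ gen ρ {i, j} := mem_gen (by simp)
        exact ⟨ρ i * d * (ρ i)⁻¹, mul_mem (mul_mem hi hd) (inv_mem hi), by simp⟩
      · exact ⟨d, hd, by rw [← mul_apply, ← mul_apply, (p.commute_dihedral hi hd).eq]⟩)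
  rw [p.card_dihedral h, h.card_eq, mul_assoc] at this
  omega

/-- Involutions centralizing the dihedral group and preserving its orbits. -/
structure Vertical (ρ : ι → Perm X) (i₀ j : ι) (e : Perm X) : Prop where
  mem : e ∈ gen ρ Finset.univ
  invol : e * e = 1
  comm : ∀ d ∈ gen ρ {i₀, j}, Commute e d
  rel : ∀ x, orb (gen ρ {i₀, j}) x (e x)

lemma Vertical.mul {e f : Perm X} (he : Vertical ρ i₀ j e) (hf : Vertical ρ i₀ j f)
    (hc : Commute e f) : Vertical ρ i₀ j (e * f) where
  mem := mul_mem he.mem hf.mem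
  invol := by rw [hc.symm.mul_mul_mul_comm, he.invol, hf.invol, one_mul]
  comm d hd := (he.comm d hd).mul_left (hf.comm d hd)
  rel x := Setoid.trans' _ (hf.rel x) (he.rel (f x))

lemma Vertical.apply_eq_iff (h : Blocks ρ pos i₀ b κ) (p : OddPair ρ i₀ j C) {e : Perm X}
    (he : Vertical ρ i₀ j e) (x : X) : e x = x ↔ b (e x) = b x := by
  refine ⟨congrArg b, fun hb => ?_⟩
  obtain ⟨d, hd, e1⟩ := he.rel x
  rcases mem_dihedral h hd with hd' | hd'
  · exact p.apply_eq h he.invol hd' (he.comm d hd) e1.symm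
  · rw [← e1] at hb
    exact absurd hb (p.b_ne h hd' x)

lemma Vertical.apply_eq_apply (h : Blocks ρ pos i₀ b κ) (p : OddPair ρ i₀ j C) {e f : Perm X}
    (he : Vertical ρ i₀ j e) (hf : Vertical ρ i₀ j f) (hc : Commute e f) {x : X} (hex : e x ≠ x)
    (hfx : f x ≠ x) : e x = f x := by
  have h1 : b (f x) ≠ b x := fun e1 => hfx ((hf.apply_eq_iff h p x).2 e1)
  have h2 : b (e (f x)) ≠ b (f x) := fun e1 =>
    hex ((he.apply_eq_iff h p x).2 ((h.preserve_iff he.mem _ _).1 e1))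
  have h3 : (e * f) x = x := ((he.mul hf hc).apply_eq_iff h p x).2
    (Blocks.fin_two_eq h2 h1.symm)
  have h4 : e (e (f x)) = e x := congrArg e h3
  rw [← mul_apply e e, he.invol, one_apply] at h4
  exact h4.symm

section Nine

variable {Z : Type*} [Fintype Z] {f : X → Z} {ν : ι → Perm Z}

lemma vertical_of_eq_one (h : Blocks ρ pos i₀ b κ) (p : OddPair ρ i₀ j C)
    (hker : ∀ x y, f x = f y → orb (gen ρ {i₀, j}) x y)
    (hf : ∀ i ∈ C, ∀ x, f (ρ i x) = ν i (f x)) {i : ι} (hi : i ∈ C) (h1 : ν i = 1) :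
    Vertical ρ i₀ j (ρ i) where
  mem := mem_gen (by simp)
  invol := h.invol i
  comm _ hd := p.commute_dihedral hi hd
  rel x := hker _ _ (by rw [hf i hi, h1, one_apply])

lemma vertical_mul (h : Blocks ρ pos i₀ b κ) (p : OddPair ρ i₀ j C)
    (hker : ∀ x y, f x = f y → orb (gen ρ {i₀, j}) x y)
    (hf : ∀ i ∈ C, ∀ x, f (ρ i x) = ν i (f x)) {i k : ι} (hi : i ∈ C) (hk : k ∈ C)
    (hik : ν i = ν k) (h2 : ν k * ν k = 1) (hc : Commute (ρ i) (ρ k)) :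
    Vertical ρ i₀ j (ρ i * ρ k) where
  mem := mul_mem (mem_gen (by simp)) (mem_gen (by simp))
  invol := by rw [hc.symm.mul_mul_mul_comm, h.invol, h.invol, one_mul]
  comm _ hd := (p.commute_dihedral hi hd).mul_left (p.commute_dihedral hk hd)
  rel x := hker _ _ (by
    rw [mul_apply, hf i hi, hf k hk, hik, ← mul_apply, h2, one_apply])

lemma false_of_vertical (h : Blocks ρ pos i₀ b κ) (p : OddPair ρ i₀ j C)
    (hker : ∀ x y, f x = f y → orb (gen ρ {i₀, j}) x y) (hsurj : Function.Surjective f)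
    (hf : ∀ i ∈ C, ∀ x, f (ρ i x) = ν i (f x)) (hZ : Fintype.card Z = 3) {K : Finset ι}
    (htr : orb (gen ρ K) = ⊤) {w w' z c : ι} (hw : w ∈ C) (hw' : w' ∈ C) (hz : z ∈ C) (hc : c ∈ C)
    (hww : w ≠ w') (hzc : z ≠ c) (hνw : ν w = 1) (hνw' : ν w' = 1) (hνc : ν c ≠ 1)
    (hKw : ∀ i ∈ K, Commute (ρ i) (ρ w)) (hKw' : ∀ i ∈ K, Commute (ρ i) (ρ w'))
    (c1 : Commute (ρ z) (ρ w)) (c2 : Commute (ρ z) (ρ w')) (c3 : Commute (ρ c) (ρ w))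
    (c4 : Commute (ρ c) (ρ w')) (c5 : Commute (ρ z) (ρ c)) : False := by
  have hν2 : ∀ i ∈ C, ν i * ν i = 1 := fun i hi => transport_invol hsurj hf hi (h.invol i)
  have hne : ∀ {i k : ι}, i ≠ k → ρ i ≠ ρ k := fun {i k} hik e =>
    h.notMem (S := {k}) (i := i) (by simpa using hik) (by rw [e]; exact mem_gen (by simp))
  obtain ⟨e, he, he1, hew, hew'⟩ : ∃ e, Vertical ρ i₀ j e ∧ e ≠ 1 ∧ Commute e (ρ w) ∧
      Commute e (ρ w') := by
    by_cases h1 : ν z = 1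
    · exact ⟨ρ z, vertical_of_eq_one h p hker hf hz h1, h.ne_one z, c1, c2⟩
    · have h2 : ν z = ν c := by
        by_contra h2
        exact (perm_of_card_three hZ (hν2 z hz) (hν2 c hc) h1 hνc h2).1
          (transport_commute hsurj hf hz hc c5)
      refine ⟨ρ z * ρ c, vertical_mul h p hker hf hz hc h2 (hν2 c hc) c5, fun e => ?_,
        c1.mul_left c3, c2.mul_left c4⟩
      rw [mul_eq_one_iff_eq_inv, inv_eq_of_mul_eq_one_left (h.invol c)] at e
      exact hne hzc e
  obtain ⟨x, hx⟩ : ∃ x, e x ≠ x := by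
    by_contra! hcon
    exact he1 (Perm.ext hcon)
  have h1 := he.apply_eq_apply h p (vertical_of_eq_one h p hker hf hw hνw) hew hx
    (ne_of_transitive (h.ne_one w) hKw htr x)
  have h2 := he.apply_eq_apply h p (vertical_of_eq_one h p hker hf hw' hνw') hew' hx
    (ne_of_transitive (h.ne_one w') hKw' htr x)
  refine ne_of_transitive (u := (ρ w)⁻¹ * ρ w') (fun e => ?_)
    (fun i hi => (hKw i hi).inv_right.mul_right (hKw' i hi)) htr x ?_
  · rw [inv_mul_eq_one] at e
    exact hne hww e
  · rw [mul_apply, Perm.inv_eq_iff_eq, ← h2, h1]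

lemma false_of_consecutive (h : Blocks ρ pos i₀ b κ) (p : OddPair ρ i₀ j C)
    (hker : ∀ x y, f x = f y → orb (gen ρ {i₀, j}) x y) (hsurj : Function.Surjective f)
    (hf : ∀ i ∈ C, ∀ x, f (ρ i x) = ν i (f x)) (hZ : Fintype.card Z = 3) (hC : 6 ≤ C.card)
    {c c' : ι} (hc : c ∈ C) (hc' : c' ∈ C) (hpos : pos c' = pos c + 1) (hν : ν c ≠ 1)
    (hν' : ν c' ≠ 1) (hcc : ν c ≠ ν c') : False := by
  have hν2 : ∀ i ∈ C, ν i * ν i = 1 := fun i hi => transport_invol hsurj hf hi (h.invol i)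
  have hne : ∀ {i k : ι}, i ≠ k → ρ i ≠ ρ k := fun {i k} hik e =>
    h.notMem (S := {k}) (i := i) (by simpa using hik) (by rw [e]; exact mem_gen (by simp))
  let K : Finset ι := {i₀, j, c, c'}
  have htr : orb (gen ρ K) = ⊤ := by
    have hD : orb (gen ρ {i₀, j}) ≤ orb (gen ρ K) := orb_mono (gen_mono (by
      intro i hi
      simp only [Finset.mem_insert, Finset.mem_singleton, K] at hi ⊢
      tauto))
    have hcK : ∀ x, orb (gen ρ K) x (ρ c x) := fun x => ⟨ρ c, mem_gen (by simp [K]), rfl⟩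
    have hcK' : ∀ x, orb (gen ρ K) x (ρ c' x) := fun x => ⟨ρ c', mem_gen (by simp [K]), rfl⟩
    refine eq_top_iff_rel.2 fun x y => ?_
    rcases (perm_of_card_three hZ (hν2 c hc) (hν2 c' hc') hν hν' hcc).2 (f x) (f y) with
      e | e | e | e | e
    · exact hD (hker _ _ e.symm)
    · rw [← hf c hc] at e
      exact Setoid.trans' _ (hcK x) (hD (hker _ _ e.symm))
    · rw [← hf c' hc'] at e
      exact Setoid.trans' _ (hcK' x) (hD (hker _ _ e.symm))
    · rw [← hf c' hc', ← hf c hc] at e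
      exact Setoid.trans' _ (Setoid.trans' _ (hcK' x) (hcK _)) (hD (hker _ _ e.symm))
    · rw [← hf c hc, ← hf c' hc'] at e
      exact Setoid.trans' _ (Setoid.trans' _ (hcK x) (hcK' _)) (hD (hker _ _ e.symm))
  let W := C.filter fun w => pos w ≤ pos c - 2 ∨ pos c + 3 ≤ pos w
  have hWc : ∀ w ∈ W, w ∈ C ∧ Commute (ρ c) (ρ w) ∧ Commute (ρ c') (ρ w) := by
    intro w hw
    obtain ⟨hwC, hw⟩ := Finset.mem_filter.1 hw
    refine ⟨hwC, h.comm _ _ ?_, h.comm _ _ ?_⟩ <;> rw [le_abs] <;> omega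
  have hWν : ∀ w ∈ W, ν w = 1 := by
    intro w hw
    obtain ⟨hwC, h1, h2⟩ := hWc w hw
    by_contra hw1
    have e1 : ν c = ν w := by
      by_contra e
      exact (perm_of_card_three hZ (hν2 c hc) (hν2 w hwC) hν hw1 e).1
        (transport_commute hsurj hf hc hwC h1)
    have e2 : ν c' = ν w := by
      by_contra e
      exact (perm_of_card_three hZ (hν2 c' hc') (hν2 w hwC) hν' hw1 e).1
        (transport_commute hsurj hf hc' hwC h2)
    exact hcc (e1.trans e2.symm)
  have hWK : ∀ w ∈ W, ∀ i ∈ K, Commute (ρ i) (ρ w) := by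
    intro w hw i hi
    obtain ⟨hwC, h1, h2⟩ := hWc w hw
    simp only [K, Finset.mem_insert, Finset.mem_singleton] at hi
    rcases hi with rfl | rfl | rfl | rfl
    exacts [(p.comm₀ w hwC).symm, (p.comm w hwC).symm, h1, h2]
  have hWpos : ∀ w ∈ W, ∀ w' ∈ W, w ≠ w' → pos w = pos w' + 1 ∨ pos w' = pos w + 1 := by
    intro w hw w' hw' hww
    have hlt : |pos w - pos w'| < 2 := by
      by_contra hge
      refine hne hww (Perm.ext fun x => ?_)
      exact (vertical_of_eq_one h p hker hf (hWc w hw).1 (hWν w hw)).apply_eq_apply h p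
        (vertical_of_eq_one h p hker hf (hWc w' hw').1 (hWν w' hw'))
        (h.comm w w' (not_lt.1 hge)) (ne_of_transitive (h.ne_one w) (hWK w hw) htr x)
        (ne_of_transitive (h.ne_one w') (hWK w' hw') htr x)
    have hpne : pos w ≠ pos w' := fun e => hww (h.inj e)
    rw [abs_lt] at hlt
    omega
  let I : Finset ℤ := {pos c - 1, pos c, pos c + 1, pos c + 2}
  have hI : I.card ≤ 4 := Finset.card_le_four
  have hsub : (C \ W).image pos ⊆ I := by
    intro z hz
    obtain ⟨i, hi, rfl⟩ := Finset.mem_image.1 hz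
    simp only [W, Finset.mem_sdiff, Finset.mem_filter, not_and, not_or] at hi
    have := hi.2 hi.1
    simp only [I, Finset.mem_insert, Finset.mem_singleton]
    omega
  have hcard1 : ((C \ W).image pos).card = (C \ W).card := Finset.card_image_of_injective _ h.inj
  have hcard2 : (C \ W).card + W.card = C.card :=
    Finset.card_sdiff_add_card_eq_card (Finset.filter_subset _ _)
  have hcard3 := Finset.card_le_card hsub
  obtain ⟨w, hw, w', hw', hww⟩ := Finset.one_lt_card.1 (show 1 < W.card by omega)
  have hW2 : W.card ≤ 2 := by
    refine (Finset.card_le_card (t := {w, w'}) fun v hv => ?_).trans Finset.card_le_two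
    by_contra hcon
    simp only [Finset.mem_insert, Finset.mem_singleton, not_or] at hcon
    have := hWpos w hw w' hw' hww
    have := hWpos v hv w hw hcon.1
    have := hWpos v hv w' hw' hcon.2
    omega
  have himg : (C \ W).image pos = I := Finset.eq_of_subset_of_card_le hsub (by omega)
  have hz : ∀ t ∈ I, ∃ z ∈ C, pos z = t := by
    intro t ht
    rw [← himg] at ht
    obtain ⟨z, hz, e⟩ := Finset.mem_image.1 ht
    exact ⟨z, (Finset.mem_sdiff.1 hz).1, e⟩
  have hwp := (Finset.mem_filter.1 hw).2
  have hwp' := (Finset.mem_filter.1 hw').2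
  have hadj := hWpos w hw w' hw' hww
  have hcm : ∀ {i k : ι}, pos i + 2 ≤ pos k ∨ pos k + 2 ≤ pos i → Commute (ρ i) (ρ k) := by
    intro i k hik
    refine h.comm i k ?_
    rw [le_abs]
    omega
  rcases hwp with hwp | hwp
  · obtain ⟨z, hzC, hzp⟩ := hz (pos c + 2) (by simp [I])
    exact false_of_vertical h p hker hsurj hf hZ htr (hWc w hw).1 (hWc w' hw').1 hzC hc hww
      (by rintro rfl; omega) (hWν w hw) (hWν w' hw') hν (hWK w hw) (hWK w' hw')
      (hcm (by omega)) (hcm (by omega)) (hcm (by omega)) (hcm (by omega)) (hcm (by omega))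
  · obtain ⟨z, hzC, hzp⟩ := hz (pos c - 1) (by simp [I])
    exact false_of_vertical h p hker hsurj hf hZ htr (hWc w hw).1 (hWc w' hw').1 hzC hc' hww
      (by rintro rfl; omega) (hWν w hw) (hWν w' hw') hν' (hWK w hw) (hWK w' hw')
      (hcm (by omega)) (hcm (by omega)) (hcm (by omega)) (hcm (by omega)) (hcm (by omega))

end Nine

lemma false_of_card (h : Blocks ρ pos i₀ b κ) (p : OddPair ρ i₀ j C) (hm : 7 ≤ Fintype.card Y)
    (hC : Fintype.card Y ≤ C.card + 3) : False := by
  classical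
  obtain ⟨hN, hY, hC6⟩ := p.card_eq_nine h hm hC
  have hX : Nonempty X := Fintype.card_pos_iff.1 (by rw [h.card_eq]; omega)
  have hnc := p.nc_dihedral h
  rw [hN, hY] at hnc
  have hft : Fintype (Quotient (orb (gen ρ {i₀, j}))) := Fintype.ofFinite _
  have hZ : Fintype.card (Quotient (orb (gen ρ {i₀, j}))) = 3 := by
    rw [← Nat.card_eq_fintype_card]
    change nc _ = 3
    omega
  let f : X → Quotient (orb (gen ρ {i₀, j})) := Quotient.mk _
  have hsurj : Function.Surjective f := Quotient.mk_surjective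
  have hker : ∀ x y, f x = f y → orb (gen ρ {i₀, j}) x y := fun x y e => Quotient.exact e
  obtain ⟨ν, hf⟩ := exists_quotient_family (S := C) (ρ := ρ) hsurj (fun i _ => h.invol i)
    fun i hi x y e => by
      obtain ⟨d, hd, rfl⟩ := hker x y e
      refine Quotient.sound ⟨d, hd, ?_⟩
      rw [← mul_apply, ← mul_apply, (p.commute_dihedral hi hd).eq]
  have hν2 : ∀ i ∈ C, ν i * ν i = 1 := fun i hi => transport_invol hsurj hf hi (h.invol i)
  obtain ⟨c, hc, c', hc', h1, h2, h3⟩ : ∃ c ∈ C, ∃ c' ∈ C, ν c ≠ 1 ∧ ν c' ≠ 1 ∧ ν c ≠ ν c' := by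
    by_contra! hcon
    obtain ⟨q, hq, hqC⟩ : ∃ q : Perm (Quotient (orb (gen ρ {i₀, j}))), q * q = 1 ∧
        ∀ i ∈ C, ν i = 1 ∨ ν i = q := by
      by_cases hex : ∃ c ∈ C, ν c ≠ 1
      · obtain ⟨c, hc, hc1⟩ := hex
        refine ⟨ν c, hν2 c hc, fun i hi => or_iff_not_imp_left.2 fun hi1 => ?_⟩
        exact (hcon c hc i hi hc1 hi1).symm
      · push Not at hex
        exact ⟨1, one_mul 1, fun i hi => Or.inl (hex i hi)⟩
    obtain ⟨z, hz⟩ : ∃ z, q z = z := by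
      by_contra! hcon'
      have := nc_pairs hq hcon'
      omega
    have hle : orb (gen ρ (insert i₀ C)) ≤
        (⟨fun x y => f x = z ↔ f y = z, ⟨fun _ => Iff.rfl, fun h => h.symm,
          fun h h' => h.trans h'⟩⟩ : Setoid X) := by
      refine orb_gen_le.2 fun i hi x => ?_
      change f x = z ↔ f (ρ i x) = z
      rcases Finset.mem_insert.1 hi with rfl | hi
      · have : f x = f (ρ i x) := Quotient.sound ⟨ρ i, mem_gen (by simp), rfl⟩
        rw [this]
      · rw [hf i hi]
        rcases hqC i hi with e | e
        · rw [e, one_apply]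
        · rw [e]
          nth_rw 2 [← hz]
          rw [q.apply_eq_iff_eq]
    obtain ⟨x, rfl⟩ := hsurj z
    have hsub : ∀ y, y = f x := by
      intro y
      obtain ⟨y, rfl⟩ := hsurj y
      exact (hle (eq_top_iff_rel.1 p.trans x y)).1 rfl
    have := Fintype.card_le_one_iff.2 fun y y' => (hsub y).trans (hsub y').symm
    omega
  have hnc := (perm_of_card_three hZ (hν2 c hc) (hν2 c' hc') h1 h2 h3).1
  have hlt : |pos c - pos c'| < 2 := by
    by_contra hge
    exact hnc (transport_commute hsurj hf hc hc' (h.comm c c' (not_lt.1 hge)))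
  have hpne : pos c ≠ pos c' := fun e => h3 (by rw [h.inj e])
  rw [abs_lt] at hlt
  rcases (by omega : pos c' = pos c + 1 ∨ pos c = pos c' + 1) with e | e
  · exact false_of_consecutive h p hker hsurj hf hZ hC6 hc hc' e h1 h2 h3
  · exact false_of_consecutive h p hker hsurj hf hZ hC6 hc' hc e h2 h1 h3.symm

end OddPair

namespace Blocks

variable {ι X Y : Type*} [Fintype ι] [DecidableEq ι] [Fintype X] [Fintype Y] [DecidableEq Y]
  {ρ : ι → Perm X} {pos : ι → ℤ} {i₀ : ι} {b : X → Fin 2} {κ : X → Y} {C : Finset ι} {j : ι}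

/-- Transitivity modulo `ρ i₀` lifts. -/
lemma orb_insert (h : Blocks ρ pos i₀ b κ) {ρ' : ι → Perm Y}
    (hf : ∀ i ∈ C, ∀ x, κ (ρ i x) = ρ' i (κ x)) (htr : orb (gen ρ' C) = ⊤) :
    orb (gen ρ (insert i₀ C)) = ⊤ := by
  refine eq_top_iff_rel.2 fun x y => ?_
  obtain ⟨g', hg', e⟩ := eq_top_iff_rel.1 htr (κ x) (κ y)
  obtain ⟨g, hg, hgg⟩ := exists_lift_gen hf hg'
  rw [← hgg] at e
  have hg1 := gen_mono (Finset.subset_insert i₀ C) hg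
  rcases (h.ker _ _).1 e with e | e
  · exact ⟨g, hg1, e.symm⟩
  · exact ⟨ρ i₀ * g, mul_mem (mem_gen (by simp)) hg1, e.symm⟩

/-- A family of nearly maximal size that is transitive modulo `ρ i₀` cannot centralize two
non-commuting generators. -/
theorem card_add_four_le_of_centralize (h : Blocks ρ pos i₀ b κ) {ρ' : ι → Perm Y}
    (hf : ∀ i ∈ C, ∀ x, κ (ρ i x) = ρ' i (κ x)) (hi₀ : i₀ ∉ C) (hj : j ∉ C)
    (hc : ∀ i ∈ C, Commute (ρ i) (ρ i₀)) (hcj : ∀ i ∈ C, Commute (ρ i) (ρ j))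
    (hnc : ¬ Commute (ρ i₀) (ρ j)) (htr : orb (gen ρ' C) = ⊤) (hm : 7 ≤ Fintype.card Y) :
    C.card + 4 ≤ Fintype.card Y := by
  by_contra hlt
  have hne : C.Nonempty := Finset.card_pos.1 (by omega)
  rcases Nat.even_or_odd (orderOf (ρ i₀ * ρ j)) with hev | hodd
  · have := h.card_add_five_le_of_even hf hi₀ hj hne hc hcj hnc htr hm hev
    omega
  · exact OddPair.false_of_card h ⟨hodd, hc, hcj, hnc, h.orb_insert hf htr⟩ hm (by omega)

end Blocks

section Alternating

variable {Y : Type*} [Fintype Y] [DecidableEq Y]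

/-- The alternating group has trivial centralizer. -/
lemma eq_one_of_commute_alternating (hY : 4 ≤ Fintype.card Y) {σ : Perm Y}
    (hσ : ∀ π ∈ alternatingGroup Y, Commute σ π) : σ = 1 := by
  by_contra hne
  obtain ⟨y, hy⟩ : ∃ y, σ y ≠ y := by
    by_contra! hcon
    exact hne (Perm.ext hcon)
  have hcard : 1 < (({y, σ y} : Finset Y)ᶜ).card := by
    rw [Finset.card_compl]
    have := Finset.card_le_two (a := y) (b := σ y)
    omega
  obtain ⟨a, ha, c, hc, hac⟩ := Finset.one_lt_card.1 hcard
  simp only [Finset.mem_compl, Finset.mem_insert, Finset.mem_singleton, not_or] at ha hc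
  have ht : swap y a * swap y c ∈ alternatingGroup Y := by
    rw [mem_alternatingGroup, Perm.sign_mul, sign_swap (Ne.symm ha.1), sign_swap (Ne.symm hc.1)]
    rfl
  have h1 : (σ * (swap y a * swap y c)) y = ((swap y a * swap y c) * σ) y := by rw [(hσ _ ht).eq]
  simp only [mul_apply] at h1
  rw [swap_apply_left, swap_apply_of_ne_of_ne hy (Ne.symm hc.2),
    swap_apply_of_ne_of_ne hc.1 hac.symm, swap_apply_of_ne_of_ne hy (Ne.symm ha.2),
    σ.apply_eq_iff_eq] at h1
  exact hc.1 h1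

lemma mem_alternatingGroup_of_odd {α : Perm Y} (hα : Odd (orderOf α)) :
    α ∈ alternatingGroup Y := by
  obtain ⟨k, hk⟩ := hα
  have h1 : α ^ (2 * k + 1) = 1 := by rw [← hk, pow_orderOf_eq_one]
  rw [mem_alternatingGroup]
  have h2 := congrArg sign h1
  rw [map_pow, map_one, pow_succ, pow_mul] at h2
  rcases Int.units_eq_one_or (sign α) with e | e
  · exact e
  · rw [e] at h2
    simp at h2

/-- A subgroup containing the diagonal alternating group and a twisted swap contains the swap. -/
lemma mem_of_twisted_swap (hY : 5 ≤ Fintype.card Y) {Γ : Type*} [Group Γ]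
    (Φ : Perm Y × Perm Y →* Γ) {t : Γ} (hΦ : ∀ π τ, t * Φ (π, τ) = Φ (τ, π) * t)
    {G : Subgroup Γ} (hG : ∀ π ∈ alternatingGroup Y, Φ (π, π) ∈ G) {α : Perm Y}
    (hα : Odd (orderOf α)) (hα1 : α ≠ 1) (ht : t * Φ (α, α⁻¹) ∈ G) : t ∈ G := by
  have hαA := mem_alternatingGroup_of_odd hα
  let N : Subgroup (alternatingGroup Y) :=
    G.comap (Φ.comp ((MonoidHom.inr _ _).comp (alternatingGroup Y).subtype))
  have hN : ∀ {π : alternatingGroup Y}, π ∈ N ↔ Φ (1, (π : Perm Y)) ∈ G := Iff.rfl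
  have hnorm : N.Normal := by
    constructor
    intro π hπ g
    rw [hN] at hπ ⊢
    have := mul_mem (mul_mem (hG g g.2) hπ) (inv_mem (hG g g.2))
    rw [← map_inv, ← map_mul, ← map_mul] at this
    simpa using this
  have hkey : ∀ π ∈ alternatingGroup Y, Φ (1, (α⁻¹ * π * α)⁻¹ * (α * π * α⁻¹)) ∈ G := by
    intro π hπ
    have h1 := mul_mem (mul_mem ht (hG π hπ)) (inv_mem ht)
    have h2 : t * Φ (α, α⁻¹) * Φ (π, π) * (t * Φ (α, α⁻¹))⁻¹ =
        Φ (α⁻¹ * π * α, α * π * α⁻¹) := by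
      rw [mul_inv_rev, mul_assoc t, ← map_mul, ← map_inv, mul_assoc, ← mul_assoc (Φ _) (Φ _),
        ← map_mul, ← mul_assoc, hΦ, mul_inv_cancel_right]
      simp
    rw [h2] at h1
    have h3 := hG (α⁻¹ * π * α) (mul_mem (mul_mem (inv_mem hαA) hπ) hαA)
    have h4 := mul_mem (inv_mem h3) h1
    rw [← map_inv, ← map_mul, Prod.inv_mk, Prod.mk_mul_mk, inv_mul_cancel] at h4
    exact h4
  have hmem : ∀ π ∈ alternatingGroup Y,
      (α⁻¹ * π * α)⁻¹ * (α * π * α⁻¹) ∈ alternatingGroup Y := fun π hπ =>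
    mul_mem (inv_mem (mul_mem (mul_mem (inv_mem hαA) hπ) hαA))
      (mul_mem (mul_mem hαA hπ) (inv_mem hαA))
  rcases alternatingGroup.normal_subgroup_eq_bot_or_eq_top (N := N)
    (by rwa [Nat.card_eq_fintype_card]) with hbot | htop
  · exfalso
    have hc : ∀ π ∈ alternatingGroup Y, Commute (α * α) π := by
      intro π hπ
      have h1 : (⟨_, hmem π hπ⟩ : alternatingGroup Y) ∈ N := hkey π hπ
      rw [hbot, mem_bot, Subtype.ext_iff] at h1
      have h2 : α⁻¹ * π * α = α * π * α⁻¹ := by simpa using inv_mul_eq_one.1 h1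
      have h3 : α * (α⁻¹ * π * α) * α = α * (α * π * α⁻¹) * α := by rw [h2]
      rw [Commute, SemiconjBy]
      simpa [mul_assoc] using h3.symm
    have h1 := eq_one_of_commute_alternating (by omega) hc
    have h2 : orderOf α ∣ 2 := orderOf_dvd_of_pow_eq_one (by rw [pow_two, h1])
    rcases (Nat.dvd_prime Nat.prime_two).1 h2 with h3 | h3
    · exact hα1 (orderOf_eq_one_iff.1 h3)
    · rw [h3] at hα
      exact absurd hα (by decide)
  · have h1 : Φ (1, α * α) ∈ G := by
      have : (⟨_, mul_mem hαA hαA⟩ : alternatingGroup Y) ∈ N := by rw [htop]; exact mem_top _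
      exact this
    have h2 := mul_mem (mul_mem ht h1) (hG _ (inv_mem hαA))
    have h3 : ((α, α⁻¹) * ((1, α * α) * (α⁻¹, α⁻¹)) : Perm Y × Perm Y) = 1 := by
      simp [Prod.ext_iff]
    rwa [mul_assoc, mul_assoc, ← map_mul, ← map_mul, h3, map_one, mul_one] at h2

end Alternating

namespace Blocks

variable {ι X Y : Type*} [Fintype ι] [DecidableEq ι] [Fintype X] [Fintype Y] [DecidableEq Y]
  {ρ : ι → Perm X} {pos : ι → ℤ} {i₀ : ι} {b : X → Fin 2} {κ : X → Y} {C : Finset ι} {j : ι}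

lemma false_of_even (h : Blocks ρ pos i₀ b κ) {ρ' : ι → Perm Y}
    (hf : ∀ i ∈ C, ∀ x, κ (ρ i x) = ρ' i (κ x)) (hi₀ : i₀ ∉ C) (hj : j ∉ C)
    (hc : ∀ i ∈ C, Commute (ρ i) (ρ i₀)) (hnc : ¬ Commute (ρ i₀) (ρ j))
    (hm : 7 ≤ Fintype.card Y) (halt : alternatingGroup Y ≤ gen ρ' C)
    (heven : Even (orderOf (ρ i₀ * ρ j))) : False := by
  obtain ⟨σ, hσ, hσ2, hσ1, hσi, hσj⟩ := exists_central_invol (h.invol i₀) (h.invol j) heven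
  rw [closure_pair_eq] at hσ
  obtain ⟨τ, hτ⟩ := h.exists_family (ι' := Unit) (τ := fun _ => σ) (S := {()})
    (fun _ _ => hσ2) (fun _ _ => hσi)
  set s := τ () with hs
  have hσs : ∀ x, κ (σ x) = s (κ x) := fun x => hτ () (by simp) x
  have hs2 : s * s = 1 := transport_invol h.surj hτ (i := ()) (by simp) hσ2
  have hρ2 : ∀ c ∈ C, ρ' c * ρ' c = 1 := fun c hc => transport_invol h.surj hf hc (h.invol c)
  have hjc : ∀ c ∈ C, Commute s (ρ' c) := by
    intro c hcC
    have hci : c ≠ i₀ := by rintro rfl; exact hi₀ hcC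
    have hcj : c ≠ j := by rintro rfl; exact hj hcC
    have hκ : ∀ x, κ ((σ * ρ c * σ) x) = (s * ρ' c * s) (κ x) := by
      intro x
      simp only [mul_apply, hσs, hf c hcC]
    have hmem : s * ρ' c * s ∈ gen ρ' C := by
      have h1 : s * ρ' c * s * ρ' c ∈ alternatingGroup Y := by
        rw [mem_alternatingGroup]
        simp only [Perm.sign_mul]
        rcases Int.units_eq_one_or (sign s) with e | e <;>
          rcases Int.units_eq_one_or (sign (ρ' c)) with e' | e' <;> rw [e, e'] <;> rfl
      have h2 := mul_mem (halt h1) (mem_gen (ρ := ρ') hcC)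
      rwa [mul_assoc, hρ2 c hcC, mul_one] at h2
    have hi0j : ρ i₀ ∈ gen ρ {i₀, j, c} := mem_gen (by simp)
    have hsub : ({i₀, j} : Finset ι) ⊆ {i₀, j, c} := by
      intro i hi
      simp only [Finset.mem_insert, Finset.mem_singleton] at hi ⊢
      tauto
    have hgσ : σ * ρ c * σ ∈ gen ρ {i₀, j, c} :=
      mul_mem (mul_mem (gen_mono hsub hσ) (mem_gen (by simp))) (gen_mono hsub hσ)
    have hins : σ * ρ c * σ ∈ gen ρ (insert i₀ C) := by
      rcases h.mem_of_mem_gen hf (gen_mono (Finset.subset_univ _)) (mem_univ _ hgσ) hκ hmem with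
        e | e
      · exact gen_mono (Finset.subset_insert _ _) e
      · have := mul_mem (mem_gen (ρ := ρ) (Finset.mem_insert_self i₀ C))
          (gen_mono (Finset.subset_insert i₀ _) e)
        rwa [← mul_assoc, h.invol, one_mul] at this
    have hpair : σ * ρ c * σ ∈ gen ρ {i₀, c} := by
      refine gen_mono ?_ (h.mem_inter hgσ hins)
      intro i hi
      simp only [Finset.mem_inter, Finset.mem_insert, Finset.mem_singleton] at hi ⊢
      rcases hi with ⟨rfl | rfl | rfl, hi⟩
      · exact Or.inl rfl
      · rcases hi with e | e
        · exact Or.inl e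
        · exact absurd e hj
      · exact Or.inr rfl
    have hconj : ∀ g, σ * ρ c * σ = g → ρ c = σ * g * σ := by
      rintro g rfl
      rw [mul_assoc σ, mul_assoc _ σ σ, hσ2, mul_one, ← mul_assoc, hσ2, one_mul]
    have hfin : s * ρ' c * s = ρ' c := by
      rcases mem_gen_pair (h.invol i₀) (h.invol c) (hc c hcC).symm hpair with e | e | e | e
      · exfalso
        have := hconj _ e
        rw [mul_one, hσ2] at this
        exact h.ne_one c this
      · exfalso
        have := hconj _ e
        rw [hσi.eq, mul_assoc, hσ2, mul_one] at this
        exact h.notMem (S := {i₀}) (i := c) (by simpa using hci)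
          (by rw [this]; exact mem_gen (by simp))
      · ext y
        obtain ⟨x, rfl⟩ := h.surj y
        rw [← hκ, e, hf c hcC]
      · ext y
        obtain ⟨x, rfl⟩ := h.surj y
        rw [← hκ, e, mul_apply, h.κ_swap, hf c hcC]
    rw [Commute, SemiconjBy]
    nth_rw 2 [← hfin]
    rw [mul_assoc _ s s, hs2, mul_one]
  have hs1 : s = 1 := eq_one_of_commute_alternating (by omega) fun π hπ =>
    (commute_of_mem_gen (fun c hcC => (hjc c hcC).symm) (halt hπ)).symm
  rcases h.eq_one_or_eq (mem_univ _ hσ) (fun x => by rw [hσs, hs1, one_apply]) with e | e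
  · exact hσ1 e
  · rw [e] at hσj
    exact hnc hσj

/-- Pairs of permutations of `Y`, acting on the two blocks separately. -/
lemma exists_hom (h : Blocks ρ pos i₀ b κ) : ∃ Φ : Perm Y × Perm Y →* Perm X,
    Function.Injective Φ ∧ (∀ q x, b (Φ q x) = b x) ∧
    (∀ q x, b x = 0 → κ (Φ q x) = q.1 (κ x)) ∧ (∀ q x, b x ≠ 0 → κ (Φ q x) = q.2 (κ x)) ∧
    ∀ g : Perm X, (∀ x, b (g x) = b x) → ∃ q, Φ q = g := by
  let F : X → Y ⊕ Y := fun x => if b x = 0 then Sum.inl (κ x) else Sum.inr (κ x)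
  have hF : Function.Bijective F := by
    refine (Fintype.bijective_iff_injective_and_card F).2 ⟨fun x y hxy => ?_, ?_⟩
    · by_cases hx : b x = 0 <;> by_cases hy : b y = 0 <;> simp only [F, hx, hy, if_true, if_false,
        Sum.inl.injEq, Sum.inr.injEq, reduceCtorEq] at hxy
      · exact h.eq_of hxy (hx.trans hy.symm)
      · exact h.eq_of hxy (fin_two_eq hx hy)
    · rw [h.card_eq, Fintype.card_sum, two_mul]
  let Θ : X ≃ Y ⊕ Y := Equiv.ofBijective F hF
  have hl : ∀ x, b x = 0 → Θ x = Sum.inl (κ x) := fun x hx => if_pos hx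
  have hr : ∀ x, b x ≠ 0 → Θ x = Sum.inr (κ x) := fun x hx => if_neg hx
  have hl' : ∀ x y, Θ x = Sum.inl y → b x = 0 ∧ κ x = y := by
    intro x y e
    by_cases hx : b x = 0
    · rw [hl x hx] at e
      exact ⟨hx, Sum.inl.inj e⟩
    · rw [hr x hx] at e
      cases e
  have hr' : ∀ x y, Θ x = Sum.inr y → b x ≠ 0 ∧ κ x = y := by
    intro x y e
    by_cases hx : b x = 0
    · rw [hl x hx] at e
      cases e
    · rw [hr x hx] at e
      exact ⟨hx, Sum.inr.inj e⟩
  let Φ : Perm Y × Perm Y →* Perm X := Θ.symm.permCongrHom.toMonoidHom.comp (sumCongrHom Y Y)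
  have hΦ : ∀ q x, Θ (Φ q x) = sumCongrHom Y Y q (Θ x) := by
    intro q x
    simp [Φ]
  have hΦl : ∀ q x, b x = 0 → b (Φ q x) = 0 ∧ κ (Φ q x) = q.1 (κ x) := by
    intro q x hx
    refine hl' _ _ ?_
    rw [hΦ, hl x hx]
    rfl
  have hΦr : ∀ q x, b x ≠ 0 → b (Φ q x) ≠ 0 ∧ κ (Φ q x) = q.2 (κ x) := by
    intro q x hx
    refine hr' _ _ ?_
    rw [hΦ, hr x hx]
    rfl
  refine ⟨Φ, Θ.symm.permCongrHom.injective.comp sumCongrHom_injective, fun q x => ?_,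
    fun q x hx => (hΦl q x hx).2, fun q x hx => (hΦr q x hx).2, fun g hg => ?_⟩
  · by_cases hx : b x = 0
    · rw [(hΦl q x hx).1, hx]
    · exact fin_two_eq (hΦr q x hx).1 hx
  · have hmaps : Set.MapsTo (Θ.permCongrHom g) (Set.range Sum.inl) (Set.range Sum.inl) := by
      rintro _ ⟨y, rfl⟩
      obtain ⟨x, hx⟩ := Θ.surjective (Sum.inl y)
      refine ⟨κ (g x), ?_⟩
      have : Θ.permCongrHom g (Sum.inl y) = Θ (g x) := by rw [← hx]; simp
      rw [this, hl]
      rw [hg]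
      exact (hl' _ _ hx).1
    obtain ⟨q, hq⟩ := mem_sumCongrHom_range_of_perm_mapsTo_inl hmaps
    refine ⟨q, ?_⟩
    ext x
    apply Θ.injective
    rw [hΦ, hq]
    simp

lemma false_of_odd (h : Blocks ρ pos i₀ b κ) {ρ' : ι → Perm Y}
    (hf : ∀ i ∈ C, ∀ x, κ (ρ i x) = ρ' i (κ x)) (hi₀ : i₀ ∉ C)
    (hnc : ¬ Commute (ρ i₀) (ρ j))
    (hm : 7 ≤ Fintype.card Y) (halt : alternatingGroup Y ≤ gen ρ' C)
    (hodd : Odd (orderOf (ρ i₀ * ρ j))) : False := by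
  obtain ⟨Φ, hinj, hb, hΦ0, hΦ1, hex⟩ := h.exists_hom
  have hΦswap : ∀ π τ, ρ i₀ * Φ (π, τ) = Φ (τ, π) * ρ i₀ := by
    intro π τ
    ext x
    simp only [mul_apply]
    refine h.eq_of ?_ ?_
    · rw [h.κ_swap]
      by_cases hx : b x = 0
      · rw [hΦ0 _ _ hx, hΦ1 _ _ (fun e => h.swap x (e.trans hx.symm)), h.κ_swap]
      · rw [hΦ1 _ _ hx, hΦ0 _ _ (fin_two_eq (h.swap x) (Ne.symm hx)), h.κ_swap]
    · rw [hb]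
      exact h.compat _ (mem_gen (by simp)) _ _ (hb _ _)
  have hsq : ∀ π ∈ gen ρ' C, Φ (π * π, π * π) ∈ gen ρ C := by
    intro π hπ
    obtain ⟨k, hk, hkx⟩ := exists_lift_gen hf hπ
    suffices Φ (π * π, π * π) = k * k by rw [this]; exact mul_mem hk hk
    ext x
    refine h.eq_of ?_ ?_
    · rw [mul_apply, hkx, hkx]
      by_cases hx : b x = 0
      · rw [hΦ0 _ _ hx]
        rfl
      · rw [hΦ1 _ _ hx]
        rfl
    · rw [hb, mul_apply]
      have := h.preserve_iff (mem_univ _ hk) (k x) x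
      by_cases e : b (k x) = b x
      · rw [this.2 e, e]
      · exact fin_two_eq (Ne.symm e) (fun e' => e (this.1 e'))
  have hdiag : ∀ π ∈ alternatingGroup Y, Φ (π, π) ∈ gen ρ (insert j C) := by
    have : alternatingGroup Y ≤
        (gen ρ (insert j C)).comap (Φ.comp ((MonoidHom.id _).prod (MonoidHom.id _))) := by
      rw [← closure_three_cycles_eq_alternating, closure_le]
      intro π hπ
      have hπ3 : IsThreeCycle π := hπ
      have h3 : π ^ 3 = 1 := by rw [← hπ3.orderOf, pow_orderOf_eq_one]
      have h4 : π ^ 2 * π ^ 2 = π := by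
        rw [← pow_add, show 2 + 2 = 3 + 1 from rfl, pow_succ, h3, one_mul]
      have := gen_mono (Finset.subset_insert j C)
        (hsq (π ^ 2) (pow_mem (halt hπ3.mem_alternatingGroup) 2))
      rw [h4] at this
      exact this
    exact this
  obtain ⟨⟨α, β⟩, hα⟩ := hex (ρ i₀ * ρ j) (OddPair.b_rot h hodd (mem_zpowers _))
  have hβ : β = α⁻¹ := by
    have h1 := OddPair.conj_rot h (mem_zpowers (ρ i₀ * ρ j))
    rw [← hα, hΦswap, ← map_inv] at h1
    exact congrArg Prod.fst (hinj (mul_right_cancel h1))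
  subst hβ
  have hαN : α ^ orderOf (ρ i₀ * ρ j) = 1 := by
    have h1 := pow_orderOf_eq_one (ρ i₀ * ρ j)
    nth_rw 1 [← hα] at h1
    rw [← map_pow, ← map_one Φ] at h1
    exact congrArg Prod.fst (hinj h1)
  refine h.notMem (S := insert j C) (i := i₀) ?_ (mem_of_twisted_swap (by omega) Φ hΦswap hdiag
    (α := α) (hodd.of_dvd_nat (orderOf_dvd_of_pow_eq_one hαN)) ?_ ?_)
  · rw [Finset.mem_insert, not_or]
    exact ⟨by rintro rfl; exact hnc (Commute.refl _), hi₀⟩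
  · rintro rfl
    rw [inv_one] at hα
    have h1 : ρ i₀ * ρ j = 1 := hα.symm.trans (map_one Φ)
    rw [mul_eq_one_iff_eq_inv, inv_eq_of_mul_eq_one_left (h.invol j)] at h1
    exact hnc (by rw [h1])
  · rw [hα, ← mul_assoc, h.invol, one_mul]
    exact mem_gen (by simp)

/-- If the generators centralizing `ρ i₀` induce the alternating group, nothing else remains. -/
theorem commute_of_alternatingGroup_le (h : Blocks ρ pos i₀ b κ) {ρ' : ι → Perm Y}
    (hf : ∀ i ∈ C, ∀ x, κ (ρ i x) = ρ' i (κ x)) (hi₀ : i₀ ∉ C) (hj : j ∉ C)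
    (hc : ∀ i ∈ C, Commute (ρ i) (ρ i₀)) (hm : 7 ≤ Fintype.card Y)
    (halt : alternatingGroup Y ≤ gen ρ' C) : Commute (ρ i₀) (ρ j) := by
  by_contra hnc
  rcases Nat.even_or_odd (orderOf (ρ i₀ * ρ j)) with hev | hodd
  · exact h.false_of_even hf hi₀ hj hc hnc hm halt hev
  · exact h.false_of_odd hf hi₀ hnc hm halt hodd

end Blocks

section Gap

variable {ι α : Type*} [DecidableEq ι] [Fintype α] {ρ : ι → Perm α} {pos : ι → ℤ} {S : Finset ι}

lemma StrFam.card_add_four_le_of_gap (h : StrFam ρ pos S) {t : ℤ} (ht : ∀ i ∈ S, pos i ≠ t)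
    {i k : ι} (hi : i ∈ S) (hk : k ∈ S) (hit : pos i < t) (hkt : t < pos k)
    (htr : orb (gen ρ S) = ⊤) (hm : 7 ≤ Fintype.card α) : S.card + 4 ≤ Fintype.card α := by
  let A := S.filter fun i => pos i < t
  let B := S.filter fun i => ¬ pos i < t
  have hAB : A ∪ B = S := Finset.filter_union_filter_not_eq _ _
  have hd : Disjoint A B := Finset.disjoint_filter_filter_not _ _ _
  have hcard : A.card + B.card = S.card := Finset.card_filter_add_card_filter_not _
  rw [← hAB] at h htr
  rw [← hcard]
  refine h.card_add_four_le_of_split hd (fun l hl l' hl' => ?_)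
    ⟨i, Finset.mem_filter.2 ⟨hi, hit⟩⟩ ⟨k, Finset.mem_filter.2 ⟨hk, by omega⟩⟩ htr hm
  refine h.comm l (Finset.mem_union_left _ hl) l' (Finset.mem_union_right _ hl') ?_
  obtain ⟨-, h1⟩ := Finset.mem_filter.1 hl
  obtain ⟨h2, h3⟩ := Finset.mem_filter.1 hl'
  have := ht l' h2
  rw [le_abs]
  omega

end Gap

namespace Blocks

variable {ι X Y : Type*} [Fintype ι] [DecidableEq ι] [Fintype X] [Fintype Y] [DecidableEq Y]
  {ρ : ι → Perm X} {pos : ι → ℤ} {i₀ : ι} {b : X → Fin 2} {κ : X → Y} {C : Finset ι} {j : ι}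

lemma commute_of_oneSided (h : Blocks ρ pos i₀ b κ) (hcard : Fintype.card ι = Fintype.card Y)
    (hm : 7 ≤ Fintype.card Y) (hC : ∀ i, i ∈ C ↔ i ≠ i₀ ∧ Commute (ρ i) (ρ i₀))
    (htr : orb (gen ρ (insert i₀ C)) = ⊤) (hside : ∀ i ∈ C, pos i₀ < pos i) (j : ι) :
    Commute (ρ j) (ρ i₀) := by
  have hi₀ : i₀ ∉ C := fun e => ((hC i₀).1 e).1 rfl
  have hc : ∀ i ∈ C, Commute (ρ i) (ρ i₀) := fun i hi => ((hC i).1 hi).2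
  obtain ⟨ρ', hf⟩ := h.exists_family (S := C) (fun i _ => h.invol i) hc
  have htr' := h.orb_proj hf htr
  have hstr := h.strFam_proj hi₀ hf
  have hcm : ∀ {i k : ι}, pos i + 2 ≤ pos k ∨ pos k + 2 ≤ pos i → Commute (ρ i) (ρ k) := by
    intro i k hik
    refine h.comm i k ?_
    rw [le_abs]
    omega
  have hR : ∀ k, ¬ Commute (ρ k) (ρ i₀) → k ∉ C ∧ (pos k = pos i₀ + 1 ∨ pos k = pos i₀ - 1) := by
    intro k hk
    refine ⟨fun e => hk (hc k e), ?_⟩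
    have h1 : pos k ≠ pos i₀ := fun e => hk (by rw [h.inj e])
    by_contra hcon
    exact hk (hcm (by omega))
  have hcov : ∀ k, k ∈ C ∨ pos k ∈ ({pos i₀, pos i₀ + 1, pos i₀ - 1} : Finset ℤ) := by
    intro k
    simp only [Finset.mem_insert, Finset.mem_singleton]
    by_cases hk : Commute (ρ k) (ρ i₀)
    · by_cases hk0 : k = i₀
      · exact Or.inr (Or.inl (by rw [hk0]))
      · exact Or.inl ((hC k).2 ⟨hk0, hk⟩)
    · exact Or.inr (Or.inr (hR k hk).2)
  have hbound : ∀ I : Finset ℤ, (∀ k, k ∈ C ∨ pos k ∈ I) → Fintype.card Y ≤ C.card + I.card := by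
    intro I hI
    have h1 : (Cᶜ).card ≤ I.card :=
      Finset.card_le_card_of_injOn pos (fun k hk =>
        (hI k).resolve_left (Finset.mem_compl.1 (Finset.mem_coe.1 hk))) h.inj.injOn
    rw [Finset.card_compl] at h1
    omega
  have hC3 := (hbound _ hcov).trans (Nat.add_le_add_left Finset.card_le_three _)
  by_contra hj
  have hleft : ∀ k, ¬ Commute (ρ k) (ρ i₀) → pos k = pos i₀ + 1 := by
    intro k hk
    refine (hR k hk).2.resolve_right fun e => ?_
    have := h.card_add_four_le_of_centralize hf hi₀ (hR k hk).1 hc (fun i hi => ?_)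
      (fun e => hk e.symm) htr' hm
    · omega
    · have := hside i hi
      exact hcm (by omega)
  have hjpos := hleft j hj
  have hjC := (hR j hj).1
  have hC2 : Fintype.card Y ≤ C.card + 2 := by
    refine (hbound {pos i₀, pos i₀ + 1} fun k => ?_).trans
      (Nat.add_le_add_left Finset.card_le_two _)
    rcases hcov k with hk | hk
    · exact Or.inl hk
    · by_cases hkc : Commute (ρ k) (ρ i₀)
      · by_cases hk0 : k = i₀
        · exact Or.inr (by simp [hk0])
        · exact Or.inl ((hC k).2 ⟨hk0, hkc⟩)
      · exact Or.inr (by simp [hleft k hkc])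
  have hCj : ∀ i ∈ C, pos j < pos i := by
    intro i hi
    have h1 := hside i hi
    have h2 : pos i ≠ pos j := fun e => hjC (h.inj e ▸ hi)
    omega
  obtain ⟨J, hJC, hJ⟩ := exists_minTrans (b := ⊥) (ρ := ρ') (S := C) (by rwa [bot_sup_eq])
  have hmax : ∀ i ∈ C, i ∉ J → ∀ k ∈ C, pos k ≤ pos i := by
    intro i hi hiJ
    have hsub : C.erase i ⊆ C := Finset.erase_subset _ _
    have htri : orb (gen ρ' (C.erase i)) = ⊤ := by
      have h1 := hJ.1
      rw [bot_sup_eq] at h1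
      rw [← top_le_iff, ← h1]
      exact orb_mono (gen_mono fun k hk => Finset.mem_erase.2
        ⟨by rintro rfl; exact hiJ hk, hJC hk⟩)
    have hcardi := Finset.card_erase_add_one hi
    by_contra! hcon
    obtain ⟨k, hk, hik⟩ := hcon
    by_cases hmin : ∃ l ∈ C, pos l < pos i
    · obtain ⟨l, hl, hli⟩ := hmin
      have := (hstr.mono hsub).card_add_four_le_of_gap (t := pos i) (i := l) (k := k)
        (fun l' hl' e => (Finset.mem_erase.1 hl').1 (h.inj e))
        (Finset.mem_erase.2 ⟨by rintro rfl; omega, hl⟩)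
        (Finset.mem_erase.2 ⟨by rintro rfl; omega, hk⟩) hli hik htri hm
      omega
    · push Not at hmin
      have := h.card_add_four_le_of_centralize (fun l hl => hf l (hsub hl))
        (fun e => hi₀ (hsub e)) (fun e => hjC (hsub e)) (fun l hl => hc l (hsub hl))
        (fun l hl => ?_) (fun e => hj e.symm) htri hm
      · omega
      · have h1 := hmin l (hsub hl)
        have h2 : pos l ≠ pos i := fun e => (Finset.mem_erase.1 hl).1 (h.inj e)
        have h3 := hCj i hi
        exact hcm (by omega)
  have hJcard : C.card ≤ J.card + 1 := by
    have h1 : (C \ J).card ≤ 1 := by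
      refine Finset.card_le_one.2 fun i hi k hk => h.inj ?_
      obtain ⟨hi, hiJ⟩ := Finset.mem_sdiff.1 hi
      obtain ⟨hk, hkJ⟩ := Finset.mem_sdiff.1 hk
      exact le_antisymm (hmax k hk hkJ i hi) (hmax i hi hiJ k hk)
    have := Finset.card_sdiff_add_card_eq_card hJC
    omega
  have halt := (hstr.mono hJC).alternatingGroup_le hJ hm (by omega)
  exact hj (h.commute_of_alternatingGroup_le hf hi₀ hjC hc hm
    (halt.trans (gen_mono hJC))).symm

/-- In a string C-group of maximal rank, if the generators centralizing `ρ i₀` form, together with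
`ρ i₀`, a transitive family, then all generators centralize `ρ i₀`. -/
theorem commute_of_transitive (h : Blocks ρ pos i₀ b κ) (hcard : Fintype.card ι = Fintype.card Y)
    (hm : 7 ≤ Fintype.card Y) (hC : ∀ i, i ∈ C ↔ i ≠ i₀ ∧ Commute (ρ i) (ρ i₀))
    (htr : orb (gen ρ (insert i₀ C)) = ⊤) (j : ι) : Commute (ρ j) (ρ i₀) := by
  by_cases hr : ∀ i ∈ C, pos i₀ < pos i
  · exact h.commute_of_oneSided hcard hm hC htr hr j
  by_cases hl : ∀ i ∈ C, pos i < pos i₀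
  · exact h.neg.commute_of_oneSided hcard hm hC htr (fun i hi => neg_lt_neg (hl i hi)) j
  exfalso
  push Not at hl hr
  obtain ⟨k, hk, hk'⟩ := hl
  obtain ⟨i, hi, hi'⟩ := hr
  have hi₀ : i₀ ∉ C := fun e => ((hC i₀).1 e).1 rfl
  have hne : ∀ l ∈ C, pos l ≠ pos i₀ := fun l hl e => hi₀ (h.inj e ▸ hl)
  obtain ⟨ρ', hf⟩ := h.exists_family (S := C) (fun i _ => h.invol i) fun i hi => ((hC i).1 hi).2
  have h1 := (h.strFam_proj hi₀ hf).card_add_four_le_of_gap (t := pos i₀) hne hi hk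
    (lt_of_le_of_ne hi' (hne i hi)) (lt_of_le_of_ne hk' (hne k hk).symm) (h.orb_proj hf htr) hm
  have h2 : (Cᶜ).card ≤ ({pos i₀, pos i₀ + 1, pos i₀ - 1} : Finset ℤ).card := by
    refine Finset.card_le_card_of_injOn pos (fun l hl => ?_) h.inj.injOn
    rw [Finset.mem_coe, Finset.mem_compl, hC, not_and] at hl
    simp only [Finset.coe_insert, Finset.coe_singleton, Set.mem_insert_iff, Set.mem_singleton_iff]
    by_contra hcon
    refine hl (by rintro rfl; simp at hcon) (h.comm _ _ ?_)
    rw [le_abs]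
    omega
  have h3 := h2.trans Finset.card_le_three
  rw [Finset.card_compl] at h3
  omega

end Blocks

end StringFamily

theorem stmt19 {n r : ℕ} (hm7 : 7 ≤ n / 2) (hn2 : Even n) (hr : r = n / 2)
    (ρ : Fin r → Equiv.Perm (Fin n)) (hstring : IsStringC ρ)
    (htrans : MulAction.IsPretransitive ↥(Subgroup.closure (Set.range ρ)) (Fin n))
    -- the two blocks B₁ = b⁻¹ 0 and B₂ = b⁻¹ 1
    (b : Fin n → Fin 2) (hbsurj : Function.Surjective b)
    (hfib : ∀ c : Fin 2, Set.ncard {x | b x = c} = n / 2)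
    (hcompat : ∀ g ∈ Subgroup.closure (Set.range ρ), ∀ x y : Fin n,
      b x = b y → b (g x) = b (g y))
    -- ρ i₀ interchanges the two blocks
    (i₀ : Fin r) (hswap : ∀ x : Fin n, b (ρ i₀ x) ≠ b x) :
    MulAction.IsPretransitive
      ↥(Subgroup.closure (ρ '' ({i | i ≠ i₀ ∧ Commute (ρ i) (ρ i₀)} ∪ {i₀}))) (Fin n) ↔
    {i : Fin r | i ≠ i₀ ∧ ¬ Commute (ρ i) (ρ i₀)} = ∅ := by
  classical
  obtain ⟨⟨hord, hcomm⟩, hip⟩ := hstring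
  have h2 : ∀ i, ρ i * ρ i = 1 := fun i => by rw [← pow_two, ← hord i, pow_orderOf_eq_one]
  constructor
  · intro hH
    have : Fintype (Quotient (StringFamily.pairs (ρ i₀) (h2 i₀))) := Fintype.ofFinite _
    have hnc := StringFamily.nc_pairs (h2 i₀) fun x e => hswap x (congrArg b e)
    have hY : Fintype.card (Quotient (StringFamily.pairs (ρ i₀) (h2 i₀))) =
        StringFamily.nc (StringFamily.pairs (ρ i₀) (h2 i₀)) := Nat.card_eq_fintype_card.symm
    have hX : Fintype.card (Fin n) = n := Fintype.card_fin n
    have hB : StringFamily.Blocks ρ (fun i => ((i : ℕ) : ℤ)) i₀ b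
        (Quotient.mk (StringFamily.pairs (ρ i₀) (h2 i₀))) :=
      { invol := h2
        ne_one := fun i e => by
          have := hord i
          rw [e, orderOf_one] at this
          omega
        comm := fun i j hij => by
          have h := hcomm i j (by omega)
          rw [pow_two, mul_eq_one_iff_eq_inv, mul_inv_rev, inv_eq_of_mul_eq_one_left (h2 i),
            inv_eq_of_mul_eq_one_left (h2 j)] at h
          exact h
        inj := fun i j e => Fin.ext (Int.ofNat_injective e)
        ip := fun J K => by
          rw [StringFamily.gen, StringFamily.gen, StringFamily.gen, Finset.coe_inter]
          exact hip J K
        compat := fun g hg => hcompat g (by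
          rwa [StringFamily.gen, Finset.coe_univ, Set.image_univ] at hg)
        swap := hswap
        surj := Quotient.mk_surjective
        ker := fun x y => Quotient.eq
        card_eq := by rw [hY, hnc] }
    have hall := hB.commute_of_transitive
      (C := Finset.univ.filter fun i => i ≠ i₀ ∧ Commute (ρ i) (ρ i₀))
      (by rw [hY, Fintype.card_fin]; omega) (by omega) (by simp)
      (StringFamily.eq_top_iff_rel.2 fun x y => by
        obtain ⟨⟨g, hg⟩, e⟩ := hH.exists_smul_eq x y
        refine ⟨g, ?_, e⟩
        rw [StringFamily.gen, Finset.coe_insert, Finset.coe_filter, Set.insert_eq, Set.union_comm]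
        simpa using hg)
    rw [Set.eq_empty_iff_forall_notMem]
    exact fun i hi => hi.2 (hall i)
  · intro hR
    have hset : ({i | i ≠ i₀ ∧ Commute (ρ i) (ρ i₀)} ∪ {i₀} : Set (Fin r)) = Set.univ := by
      refine Set.eq_univ_of_forall fun i => ?_
      by_cases hi : i = i₀
      · exact Or.inr hi
      · refine Or.inl ⟨hi, ?_⟩
        by_contra hc
        exact (Set.eq_empty_iff_forall_notMem.1 hR) i ⟨hi, hc⟩
    rw [hset, Set.image_univ]
    exact htrans
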